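/- Let 1 ≤ s < t be fixed integers with t ≥ 2s+1. There exists m₀ such that the following holds for all odd m with m ≥ m₀: if G is a balanced bipartite graph on 2n = 2m(s+t) vertices with δ(G) ≥ (n+3s)/2 − 1, then G can be tiled with K_{s,t}. -/

import Mathlib

open scoped Classical
open Finset

namespace PaperTiling

variable {V : Type*} [Fintype V] [DecidableEq V]

/-- The number of neighbours of `v` inside the set `S`. -/
noncomputable def degS (G : SimpleGraph V) (v : V) (S : Finset V) : ℕ :=
  (S.filter fun w => G.Adj v w).card

/-- The number of edges of `G` with one end in `A` and the other in `B`. -/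
noncomputable def eAB (G : SimpleGraph V) (A B : Finset V) : ℕ :=
  ∑ v ∈ A, degS G v B

/-- The edge density `d(A,B) = e(A,B)/(|A||B|)`. -/
noncomputable def dens (G : SimpleGraph V) (A B : Finset V) : ℝ :=
  (eAB G A B : ℝ) / ((A.card : ℝ) * (B.card : ℝ))

/-- `G` is a bipartite graph with parts `A` and `B`. -/
def IsBipartition (G : SimpleGraph V) (A B : Finset V) : Prop :=
  Disjoint A B ∧ A ∪ B = Finset.univ ∧
    ∀ u v : V, G.Adj u v → (u ∈ A ∧ v ∈ B) ∨ (u ∈ B ∧ v ∈ A)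

/-- `(S, T)` spans a copy of the complete bipartite graph `K_{s,t}` in `G`,
with `S` the side of size `s` and `T` the side of size `t`. -/
def IsKst (G : SimpleGraph V) (s t : ℕ) (S T : Finset V) : Prop :=
  Disjoint S T ∧ S.card = s ∧ T.card = t ∧ ∀ u ∈ S, ∀ v ∈ T, G.Adj u v

/-- `𝒯` is a perfect `K_{s,t}`-tiling of `G`: a collection of pairwise
vertex-disjoint copies of `K_{s,t}` covering all vertices. -/
def IsKstTiling (G : SimpleGraph V) (s t : ℕ)
    (𝒯 : Finset (Finset V × Finset V)) : Prop :=
  (∀ P ∈ 𝒯, IsKst G s t P.1 P.2) ∧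
  (𝒯 : Set (Finset V × Finset V)).PairwiseDisjoint (fun P => P.1 ∪ P.2) ∧
  𝒯.sup (fun P => P.1 ∪ P.2) = Finset.univ

/-- `G` can be tiled with `K_{s,t}`. -/
def KstTileable (G : SimpleGraph V) (s t : ℕ) : Prop :=
  ∃ 𝒯 : Finset (Finset V × Finset V), IsKstTiling G s t 𝒯

/-- `G` can be tiled with the complete graph `K_s`. -/
def CliqueTileable (G : SimpleGraph V) (s : ℕ) : Prop :=
  ∃ 𝒞 : Finset (Finset V),
    (∀ S ∈ 𝒞, S.card = s ∧ G.IsClique (S : Set V)) ∧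
    (𝒞 : Set (Finset V)).PairwiseDisjoint id ∧
    𝒞.sup id = Finset.univ

/-- The minimum degree of `G` equals the real number `c`. -/
def MinDegreeIs (G : SimpleGraph V) (c : ℝ) : Prop :=
  (∀ v : V, c ≤ (degS G v Finset.univ : ℝ)) ∧
  ∃ v : V, (degS G v Finset.univ : ℝ) = c

/-- `(c, L)` is an `h`-star with centre `c ∈ A` and `h` leaves `L ⊆ B`. -/
def IsStar (G : SimpleGraph V) (h : ℕ) (A B : Finset V) (c : V) (L : Finset V) : Prop :=
  c ∈ A ∧ L ⊆ B ∧ L.card = h ∧ ∀ v ∈ L, G.Adj c v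

/-- `𝒮` is a family of pairwise vertex-disjoint `h`-stars from `A` to `B`. -/
def StarFamily (G : SimpleGraph V) (h : ℕ) (A B : Finset V)
    (𝒮 : Finset (V × Finset V)) : Prop :=
  (∀ S ∈ 𝒮, IsStar G h A B S.1 S.2) ∧
  (𝒮 : Set (V × Finset V)).PairwiseDisjoint (fun S => insert S.1 S.2)

/-- The structure hypotheses (H) for the extremal construction of the paper:
`1 ≤ s < t`, `t ≥ 2s+1`, `k ≥ 1`, `G` is bipartite with parts
`U₀ ∪ U₁ ∪ U₂` and `V₀ ∪ V₁ ∪ V₂`, with the prescribed part sizes,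
complete pairs `(U₁,V₁)`, `(U₂,V₂)`, `(U₀, V₁∪V₂)`, `(V₀, U₁∪U₂)`,
no edges between `U₀` and `V₀`, and sparse `K_{2,2}`-free diagonal pairs. -/
structure StructH (G : SimpleGraph V) (s t k : ℕ)
    (U0 U1 U2 V0 V1 V2 : Finset V) : Prop where
  hs : 1 ≤ s
  hst : s < t
  ht : 2 * s + 1 ≤ t
  hk : 1 ≤ k
  bip : IsBipartition G (U0 ∪ U1 ∪ U2) (V0 ∪ V1 ∪ V2)
  hU01 : Disjoint U0 U1
  hU02 : Disjoint U0 U2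
  hU12 : Disjoint U1 U2
  hV01 : Disjoint V0 V1
  hV02 : Disjoint V0 V2
  hV12 : Disjoint V1 V2
  cardU0 : U0.card = s - 1
  cardV0 : V0.card = s - 1
  cardU1 : U1.card = k * (s + t) + (t + 1) / 2
  cardV2 : V2.card = k * (s + t) + (t + 1) / 2
  cardV1 : V1.card = k * (s + t) + (t + 2) / 2
  cardU2 : U2.card = k * (s + t) + (t + 2) / 2
  compU1V1 : ∀ u ∈ U1, ∀ v ∈ V1, G.Adj u v
  compU2V2 : ∀ u ∈ U2, ∀ v ∈ V2, G.Adj u v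
  compU0 : ∀ u ∈ U0, ∀ v ∈ V1 ∪ V2, G.Adj u v
  compV0 : ∀ v ∈ V0, ∀ u ∈ U1 ∪ U2, G.Adj u v
  emptyU0V0 : ∀ u ∈ U0, ∀ v ∈ V0, ¬ G.Adj u v
  K22freeU1V2 : ∀ S T : Finset V, S ⊆ U1 → T ⊆ V2 → ¬ IsKst G 2 2 S T
  K22freeU2V1 : ∀ S T : Finset V, S ⊆ U2 → T ⊆ V1 → ¬ IsKst G 2 2 S T
  degU1 : ∀ u ∈ U1, degS G u V2 ≤ s - 1
  degU2 : ∀ u ∈ U2, degS G u V1 ≤ s - 1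
  degV1 : ∀ v ∈ V1, degS G v U2 ≤ s - 1
  degV2 : ∀ v ∈ V2, degS G v U1 ≤ s - 1

/-- The vertex set `W` of a copy of `K_{s,t}` is crossing. -/
def Crossing (U1 V1 U2 V2 W : Finset V) : Prop :=
  (W ∩ (U1 ∪ V1)).Nonempty ∧ (W ∩ (U2 ∪ V2)).Nonempty

/-- `W` is crossing from the set `A`, where `AD = A^D` is the diagonal set of `A`
and `AM = A^M` is the opposite middle set of `A`. -/
def CrossingFrom (W A AD AM : Finset V) : Prop :=
  (W ∩ A).card = 1 ∧
    (2 ≤ (W ∩ AD).card ∨ ((W ∩ AD).card = 1 ∧ (W ∩ AM).Nonempty))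

/-- `W` is of Type 1 (crossing from `A`), where `AD = A^D`, `AN = A^N`,
`ANM = (A^N)^M`. -/
def Type1From (s t : ℕ) (W AD AN ANM : Finset V) : Prop :=
  ∃ p : ℕ, 2 ≤ p ∧ p ≤ s - 1 ∧ (W ∩ ANM).card = s - 1 ∧
    (W ∩ AN).card = t - p ∧ (W ∩ AD).card = p

/-- `W` is of Type 2 (crossing from `A`), where `AD = A^D`, `AM = A^M`,
`AND = (A^N)^D`. -/
def Type2From (s t : ℕ) (W AD AM AND : Finset V) : Prop :=
  ∃ p : ℕ, 1 ≤ p ∧ p ≤ s - 1 ∧ (W ∩ AND).card = t - 1 ∧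
    (W ∩ AM).card = s - p ∧ (W ∩ AD).card = p

set_option linter.unusedSectionVars false

section Basics

variable {α : Type*} [DecidableEq α] {G : SimpleGraph α}

theorem degS_le_card (v : α) (S : Finset α) : degS G v S ≤ S.card := card_filter_le _ _

theorem degS_mono (v : α) {S T : Finset α} (h : S ⊆ T) : degS G v S ≤ degS G v T :=
  card_le_card (filter_subset_filter _ h)

theorem degS_union (v : α) {S T : Finset α} (h : Disjoint S T) :
    degS G v (S ∪ T) = degS G v S + degS G v T := by
  unfold degS
  rw [filter_union, card_union_of_disjoint (disjoint_filter_filter h)]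

theorem degS_union_le (v : α) (S T : Finset α) :
    degS G v (S ∪ T) ≤ degS G v S + degS G v T := by
  unfold degS
  rw [filter_union]
  exact card_union_le _ _

theorem degS_le_add_of_sdiff (v : α) (S T : Finset α) :
    degS G v S ≤ degS G v T + (S \ T).card :=
  calc degS G v S ≤ degS G v (T ∪ (S \ T)) := degS_mono v (by simp)
    _ ≤ degS G v T + degS G v (S \ T) := degS_union_le v _ _
    _ ≤ _ := Nat.add_le_add_left (degS_le_card v _) _

theorem degS_add_card_nonadj (v : α) (S : Finset α) :
    degS G v S + (S.filter fun w => ¬ G.Adj v w).card = S.card :=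
  card_filter_add_card_filter_not _

theorem eAB_comm (S T : Finset α) : eAB G S T = eAB G T S := by
  unfold eAB degS
  simp_rw [card_filter]
  rw [sum_comm]
  simp_rw [G.adj_comm]

theorem eAB_mono {S S' T T' : Finset α} (h : S ⊆ S') (h' : T ⊆ T') :
    eAB G S T ≤ eAB G S' T' :=
  calc eAB G S T ≤ ∑ v ∈ S, degS G v T' := sum_le_sum fun v _ => degS_mono v h'
    _ ≤ _ := sum_le_sum_of_subset h

theorem eAB_le_mul (S T : Finset α) : eAB G S T ≤ S.card * T.card := by
  unfold eAB
  calc _ ≤ ∑ _v ∈ S, T.card := sum_le_sum fun v _ => degS_le_card v T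
    _ = _ := by simp

theorem eAB_union_left {S S' : Finset α} (h : Disjoint S S') (T : Finset α) :
    eAB G (S ∪ S') T = eAB G S T + eAB G S' T := sum_union h

theorem eAB_union_right (S : Finset α) {T T' : Finset α} (h : Disjoint T T') :
    eAB G S (T ∪ T') = eAB G S T + eAB G S T' := by
  rw [eAB_comm, eAB_union_left h, eAB_comm T, eAB_comm T']

theorem eAB_union_right_le (S T T' : Finset α) :
    eAB G S (T ∪ T') ≤ eAB G S T + eAB G S T' := by
  unfold eAB
  rw [← sum_add_distrib]
  exact sum_le_sum fun v _ => degS_union_le v _ _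

theorem eAB_fiberwise_right (S T : Finset α) (c : α → ℕ) (I : Finset ℕ)
    (h : ∀ v ∈ T, c v ∈ I) : eAB G S T = ∑ i ∈ I, eAB G S (T.filter (c · = i)) := by
  rw [eAB_comm]
  simp_rw [eAB_comm S]
  exact (sum_fiberwise_of_maps_to h _).symm

theorem eAB_fiberwise_left (S T : Finset α) (c : α → ℕ) (I : Finset ℕ)
    (h : ∀ v ∈ S, c v ∈ I) : eAB G S T = ∑ i ∈ I, eAB G (S.filter (c · = i)) T :=
  (sum_fiberwise_of_maps_to h _).symm

/-- A vertex of `S` whose degree into `T` is at least the average. -/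
theorem exists_le_degS_of_le_eAB {S T : Finset α} {x : ℝ} (hS : 0 < S.card)
    (h : x * S.card ≤ eAB G S T) : ∃ v ∈ S, x ≤ degS G v T := by
  by_contra! hc
  have h1 : ((∑ v ∈ S, degS G v T : ℕ) : ℝ) < ∑ _v ∈ S, x := by
    push_cast
    exact sum_lt_sum_of_nonempty (card_pos.1 hS) hc
  rw [sum_const, nsmul_eq_mul] at h1
  unfold eAB at h
  linarith

theorem exists_subset_card_eq_sdiff {S Z : Finset α} {k : ℕ} (h : k + Z.card ≤ S.card) :
    ∃ T ⊆ S, T.card = k ∧ Disjoint T Z := by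
  obtain ⟨T, hT, hk⟩ := exists_subset_card_eq (s := S \ Z) (n := k) (by
    have := le_card_sdiff Z S
    omega)
  exact ⟨T, hT.trans sdiff_subset, hk, disjoint_of_subset_left hT sdiff_disjoint⟩

/-- A set of prescribed size has a subset of prescribed size with at least the average weight. -/
theorem exists_subset_card_eq_le_sum (f : α → ℝ) (x : ℝ) (M : ℕ) (T : Finset α)
    (hM : M ≤ T.card) (h : x * T.card ≤ ∑ v ∈ T, f v) :
    ∃ T₀ ⊆ T, T₀.card = M ∧ x * M ≤ ∑ v ∈ T₀, f v := by
  induction T using Finset.strongInduction with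
  | H T ih =>
    rcases hM.eq_or_lt with hM | hM
    · exact ⟨T, Subset.rfl, hM.symm, by rw [hM]; exact h⟩
    by_cases hx : ∃ v ∈ T, f v ≤ x
    · obtain ⟨v, hv, hfv⟩ := hx
      have hc := card_erase_add_one hv
      obtain ⟨T₀, h0, h1, h2⟩ := ih (T.erase v) (erase_ssubset hv) (by omega) (by
        have := add_sum_erase T f hv
        rw [← hc] at h
        push_cast at h
        linarith)
      exact ⟨T₀, h0.trans (erase_subset _ _), h1, h2⟩
    · push Not at hx
      obtain ⟨T₀, h0, h1⟩ := exists_subset_card_eq hM.le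
      refine ⟨T₀, h0, h1, ?_⟩
      have := card_nsmul_le_sum T₀ f x fun v hv => (hx v (h0 hv)).le
      rwa [nsmul_eq_mul, h1, mul_comm] at this

/-- Kővári–Sós–Turán for bipartite graphs with unbalanced sides. -/
theorem exists_complete_of_dense {γ : ℝ} (hγ : 0 < γ) (l : ℕ) :
    ∃ L₀ : ℕ, ∀ (α : Type) [DecidableEq α] (G : SimpleGraph α) (S T : Finset α),
      L₀ ≤ S.card → L₀ ≤ T.card → γ * S.card * T.card ≤ eAB G S T →
      ∃ S' ⊆ S, ∃ T' ⊆ T, S'.card = l ∧ T'.card = l ∧ ∀ u ∈ S', ∀ v ∈ T', G.Adj u v := by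
  set M : ℕ := ⌈2 * l / γ⌉₊ + l with hMdef
  have hM : 2 * l ≤ γ * M := by
    have h1 := Nat.le_ceil (2 * l / γ)
    have h2 : 2 * l / γ ≤ M := h1.trans (by
      rw [hMdef]
      push_cast
      linarith [l.cast_nonneg (α := ℝ)])
    rw [div_le_iff₀ hγ] at h2
    linarith
  refine ⟨M + 1 + ⌈2 * M.choose l * l * (M + 1) / γ⌉₊, ?_⟩
  intro α _ G S T hS hT he
  have hbig : 2 * M.choose l * l * (M + 1) ≤ γ * S.card := by
    have h1 := Nat.le_ceil (2 * M.choose l * l * (M + 1) / γ)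
    have h2 : 2 * M.choose l * l * (M + 1) / γ ≤ S.card := h1.trans (Nat.cast_le.2 (by omega))
    rw [div_le_iff₀ hγ] at h2
    linarith
  obtain ⟨T₀, hT₀, hT₀c, hsum⟩ := exists_subset_card_eq_le_sum (fun v => (degS G v S : ℝ))
    (γ * S.card) M T (by omega) (by
      rw [eAB_comm] at he
      unfold eAB at he
      push_cast at he
      exact he)
  have he0 : γ * S.card * M ≤ eAB G S T₀ := by
    rw [eAB_comm]
    unfold eAB
    push_cast
    exact hsum
  set S₁ := S.filter fun u => l ≤ degS G u T₀ with hS₁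
  have hub : (eAB G S T₀ : ℝ) ≤ S₁.card * M + S.card * l := by
    have : eAB G S T₀ ≤ S₁.card * M + S.card * l := by
      unfold eAB
      rw [← sum_filter_add_sum_filter_not S (fun u => l ≤ degS G u T₀)]
      refine add_le_add ?_ ?_
      · rw [← smul_eq_mul]
        exact sum_le_card_nsmul _ _ _ fun v _ => hT₀c ▸ degS_le_card v T₀
      · refine (sum_le_card_nsmul _ _ l fun v hv => ?_).trans ?_
        · have := (mem_filter.1 hv).2
          omega
        · exact Nat.mul_le_mul_right _ (card_filter_le _ _)
    exact_mod_cast this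
  have hS₁M : γ * S.card * M ≤ 2 * (S₁.card * M) := by
    have : (S.card : ℝ) * (2 * l) ≤ S.card * (γ * M) := by gcongr
    nlinarith
  have hS₁c : M.choose l * l ≤ S₁.card := by
    have h1 : (2 * M.choose l * l * (M + 1) : ℝ) * M ≤ 2 * (S₁.card * M) :=
      (mul_le_mul_of_nonneg_right hbig M.cast_nonneg).trans hS₁M
    rcases Nat.eq_zero_or_pos M with h0 | h0
    · have : l = 0 := by omega
      simp [this]
    · have h0' : (0 : ℝ) < M := by exact_mod_cast h0
      have h2 : ((M.choose l * l : ℕ) : ℝ) * (M + 1) ≤ S₁.card := by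
        push_cast
        have := le_of_mul_le_mul_right (by linarith :
          (2 * M.choose l * l * (M + 1) : ℝ) * M ≤ 2 * S₁.card * M) h0'
        linarith
      have h3 : ((M.choose l * l : ℕ) : ℝ) ≤ ((M.choose l * l : ℕ) : ℝ) * (M + 1) :=
        le_mul_of_one_le_right (Nat.cast_nonneg _) (by linarith)
      exact_mod_cast h3.trans h2
  have hex : ∀ u ∈ S₁, ∃ R ⊆ T₀.filter (G.Adj u ·), R.card = l := fun u hu =>
    exists_subset_card_eq (mem_filter.1 hu).2
  choose! R hR hRc using hex
  obtain ⟨R₀, hR₀, hfib⟩ := exists_le_card_fiber_of_mul_le_card_of_maps_to (s := S₁)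
    (t := T₀.powersetCard l) (f := R) (n := l)
    (fun u hu => mem_powersetCard.2 ⟨(hR u hu).trans (filter_subset _ _), hRc u hu⟩)
    (powersetCard_nonempty.2 (by omega)) (by rwa [card_powersetCard, hT₀c])
  obtain ⟨S', hS', hS'c⟩ := exists_subset_card_eq hfib
  refine ⟨S', fun u hu => ?_, R₀, (mem_powersetCard.1 hR₀).1.trans hT₀, hS'c,
    (mem_powersetCard.1 hR₀).2, fun u hu v hv => ?_⟩
  · exact (mem_filter.1 (mem_filter.1 (hS' hu)).1).1
  · obtain ⟨hu1, hu2⟩ := mem_filter.1 (hS' hu)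
    rw [← hu2] at hv
    exact (mem_filter.1 (hR u hu1 hv)).2

end Basics

/-- `W` is the vertex set of a union of pairwise disjoint copies of `K_{s,t}`, of both
orientations, in the bipartite graph between `P` and `Q`. -/
inductive Tiled {α : Type*} [DecidableEq α] (G : SimpleGraph α) (P Q : Finset α) (s t : ℕ) :
    Finset α → Prop
  | nil : Tiled G P Q s t ∅
  | add {W S T : Finset α} : Tiled G P Q s t W → S ⊆ P → T ⊆ Q →
      (S.card = s ∧ T.card = t ∨ S.card = t ∧ T.card = s) →
      (∀ u ∈ S, ∀ v ∈ T, G.Adj u v) → Disjoint W (S ∪ T) → Tiled G P Q s t (W ∪ (S ∪ T))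

section Tilings

variable {α : Type*} [DecidableEq α] {G : SimpleGraph α} {P Q W W' S T : Finset α} {s t l : ℕ}

theorem Tiled.subset (h : Tiled G P Q s t W) : W ⊆ P ∪ Q := by
  induction h with
  | nil => simp
  | add _ hS hT _ _ _ ih => exact union_subset ih (union_subset_union hS hT)

theorem Tiled.union (h : Tiled G P Q s t W) (h' : Tiled G P Q s t W') (hd : Disjoint W W') :
    Tiled G P Q s t (W ∪ W') := by
  induction h' with
  | nil => simpa
  | add _ hS hT hc ha hd' ih =>
    rw [disjoint_union_right] at hd
    rw [← union_assoc]
    exact (ih hd.1).add hS hT hc ha (disjoint_union_left.2 ⟨hd.2, hd'⟩)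

theorem Tiled.single (hS : S ⊆ P) (hT : T ⊆ Q)
    (hc : S.card = s ∧ T.card = t ∨ S.card = t ∧ T.card = s)
    (ha : ∀ u ∈ S, ∀ v ∈ T, G.Adj u v) : Tiled G P Q s t (S ∪ T) := by
  have := (Tiled.nil (G := G) (P := P) (Q := Q)).add hS hT hc ha (disjoint_empty_left _)
  rwa [empty_union] at this

theorem Tiled.swap (h : Tiled G P Q s t W) : Tiled G Q P s t W := by
  induction h with
  | nil => exact .nil
  | @add W S T _ hS hT hc ha hd' ih =>
    rw [union_comm S T] at hd' ⊢
    exact ih.add hT hS (by tauto) (fun u hu v hv => (ha v hv u hu).symm) hd'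

theorem Tiled.mono {P' Q' : Finset α} (h : Tiled G P Q s t W) (hP : P ⊆ P') (hQ : Q ⊆ Q') :
    Tiled G P' Q' s t W := by
  induction h with
  | nil => exact .nil
  | add _ hS hT hc ha hd' ih => exact ih.add (hS.trans hP) (hT.trans hQ) hc ha hd'

/-- A balanced complete bipartite graph whose sides are divisible by `l`. -/
theorem Tiled.complete (r : ℕ) (hS : S ⊆ P) (hT : T ⊆ Q) (hd : Disjoint P Q)
    (hSc : S.card = l * r) (hTc : T.card = l * r) (ha : ∀ u ∈ S, ∀ v ∈ T, G.Adj u v) :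
    Tiled G P Q l l (S ∪ T) := by
  induction r generalizing S T with
  | zero =>
    rw [mul_zero, card_eq_zero] at hSc hTc
    rw [hSc, hTc]
    exact .nil
  | succ r ih =>
    obtain ⟨S₁, hS₁, hc₁⟩ := exists_subset_card_eq (s := S) (n := l) (by rw [hSc]; nlinarith)
    obtain ⟨T₁, hT₁, hc₂⟩ := exists_subset_card_eq (s := T) (n := l) (by rw [hTc]; nlinarith)
    have h1 := card_sdiff_add_card_eq_card hS₁
    have h2 := card_sdiff_add_card_eq_card hT₁
    have h3 := ih (S := S \ S₁) (T := T \ T₁) (sdiff_subset.trans hS) (sdiff_subset.trans hT)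
      (by rw [mul_add] at hSc; omega) (by rw [mul_add] at hTc; omega)
      fun u hu v hv => ha u (sdiff_subset hu) v (sdiff_subset hv)
    have hST : Disjoint S T := disjoint_of_subset_left hS (disjoint_of_subset_right hT hd)
    have h4 := h3.add (hS₁.trans hS) (hT₁.trans hT) (Or.inl ⟨hc₁, hc₂⟩)
      (fun u hu v hv => ha u (hS₁ hu) v (hT₁ hv)) (by
        rw [disjoint_left] at hST ⊢
        intro x hx hx'
        simp only [mem_union, mem_sdiff] at hx hx'
        rcases hx with hx | hx <;> rcases hx' with hx' | hx'
        · exact hx.2 hx'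
        · exact hST hx.1 (hT₁ hx')
        · exact hST (hS₁ hx') hx.1
        · exact hx.2 hx')
    convert h4 using 1
    rw [union_union_union_comm, sdiff_union_of_subset hS₁, sdiff_union_of_subset hT₁]

/-- `K_{s+t,s+t}` splits into two copies of `K_{s,t}`. -/
theorem Tiled.split (hPQ : Disjoint P Q) (h : Tiled G P Q (s + t) (s + t) W) :
    Tiled G P Q s t W := by
  induction h with
  | nil => exact .nil
  | @add W S T _ hS hT hc ha hd ih =>
    refine ih.union ?_ hd
    have hc' : S.card = s + t ∧ T.card = s + t := by tauto
    obtain ⟨S₁, hS₁, hc₁⟩ := exists_subset_card_eq (s := S) (n := s) (by omega)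
    obtain ⟨T₁, hT₁, hc₂⟩ := exists_subset_card_eq (s := T) (n := t) (by omega)
    have h1 := card_sdiff_add_card_eq_card hS₁
    have h2 := card_sdiff_add_card_eq_card hT₁
    have hST : Disjoint S T := disjoint_of_subset_left hS (disjoint_of_subset_right hT hPQ)
    have h3 := (Tiled.single (hS₁.trans hS) (hT₁.trans hT) (Or.inl ⟨hc₁, hc₂⟩)
      fun u hu v hv => ha u (hS₁ hu) v (hT₁ hv)).add (S := S \ S₁) (T := T \ T₁)
      (sdiff_subset.trans hS) (sdiff_subset.trans hT) (Or.inr ⟨by omega, by omega⟩)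
      (fun u hu v hv => ha u (sdiff_subset hu) v (sdiff_subset hv)) (by
        rw [disjoint_left] at hST ⊢
        intro x hx hx'
        simp only [mem_union, mem_sdiff] at hx hx'
        rcases hx with hx | hx <;> rcases hx' with hx' | hx'
        · exact hx'.2 hx
        · exact hST (hS₁ hx) hx'.1
        · exact hST hx'.1 (hT₁ hx)
        · exact hx'.2 hx)
    rwa [union_union_union_comm, union_sdiff_of_subset hS₁, union_sdiff_of_subset hT₁] at h3

theorem Tiled.kstTileable [Fintype α] (hPQ : Disjoint P Q) (h : Tiled G P Q s t univ) :
    KstTileable G s t := by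
  suffices H : ∀ W, Tiled G P Q s t W → ∃ 𝒯 : Finset (Finset α × Finset α),
      (∀ R ∈ 𝒯, IsKst G s t R.1 R.2) ∧
      (𝒯 : Set (Finset α × Finset α)).PairwiseDisjoint (fun R => R.1 ∪ R.2) ∧
      𝒯.sup (fun R => R.1 ∪ R.2) = W from H _ h
  intro W hW
  induction hW with
  | nil => exact ⟨∅, by simp⟩
  | @add W S T _ hS hT hc ha hd ih =>
    obtain ⟨𝒯, h1, h2, h3⟩ := ih
    have hST : Disjoint S T := disjoint_of_subset_left hS (disjoint_of_subset_right hT hPQ)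
    obtain ⟨R, hR, hRu⟩ : ∃ R : Finset α × Finset α, IsKst G s t R.1 R.2 ∧
        R.1 ∪ R.2 = S ∪ T := by
      rcases hc with hc | hc
      · exact ⟨(S, T), ⟨hST, hc.1, hc.2, ha⟩, rfl⟩
      · exact ⟨(T, S), ⟨hST.symm, hc.2, hc.1, fun u hu v hv => (ha v hv u hu).symm⟩,
          union_comm _ _⟩
    refine ⟨insert R 𝒯, ?_, ?_, ?_⟩
    · intro R' hR'
      rcases mem_insert.1 hR' with rfl | hR'
      · exact hR
      · exact h1 _ hR'
    · rw [coe_insert]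
      refine h2.insert fun R' hR' _ => ?_
      have : R'.1 ∪ R'.2 ⊆ W := h3 ▸ le_sup (f := fun R : Finset α × Finset α => R.1 ∪ R.2) hR'
      simp only [hRu]
      exact (disjoint_of_subset_left this hd).symm
    · rw [sup_insert, h3, hRu, sup_eq_union, union_comm]

end Tilings

/-- A balanced bipartite graph with parts of size `n`, minimum degree at least `n / 2`, and no
sparse pair of subsets of the two parts of almost half size. -/
structure Robust {α : Type*} (G : SimpleGraph α) (P Q : Finset α) (n : ℕ) (a : ℝ) : Prop where
  disj : Disjoint P Q
  cardP : P.card = n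
  cardQ : Q.card = n
  degP : ∀ u ∈ P, n ≤ 2 * degS G u Q
  degQ : ∀ v ∈ Q, n ≤ 2 * degS G v P
  dense : ∀ S ⊆ P, ∀ T ⊆ Q, (1 / 2 - a) * n ≤ S.card → (1 / 2 - a) * n ≤ T.card →
    a * n ^ 2 ≤ eAB G S T

/-- The labels `i < M` of `c` mark disjoint copies of `K_{L,L}`; the label `M` marks the
remaining vertices. -/
structure Blocks {α : Type*} (G : SimpleGraph α) (P Q : Finset α) (L M : ℕ) (c : α → ℕ) :
    Prop where
  cardP : ∀ i < M, (P.filter (c · = i)).card = L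
  cardQ : ∀ i < M, (Q.filter (c · = i)).card = L
  leP : ∀ v ∈ P, c v ≤ M
  leQ : ∀ v ∈ Q, c v ≤ M
  adj : ∀ u ∈ P, ∀ v ∈ Q, c u = c v → c u < M → G.Adj u v

/-- The number of vertices of `S` with label `i`. -/
def cnt {α : Type*} (c : α → ℕ) (S : Finset α) (i : ℕ) : ℕ := (S.filter (c · = i)).card

section Labels

variable {α : Type*} [DecidableEq α] {G : SimpleGraph α} {P Q W W' S T : Finset α} {s t l : ℕ}
  {n L M : ℕ} {a : ℝ} {c : α → ℕ}

theorem Robust.swap (h : Robust G P Q n a) : Robust G Q P n a :=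
  ⟨h.disj.symm, h.cardQ, h.cardP, h.degQ, h.degP, fun S hS T hT h1 h2 => by
    rw [eAB_comm]
    exact h.dense T hT S hS h2 h1⟩

theorem Blocks.swap (h : Blocks G P Q L M c) : Blocks G Q P L M c :=
  ⟨h.cardQ, h.cardP, h.leQ, h.leP, fun u hu v hv he hl => (h.adj v hv u hu he.symm
    (he ▸ hl)).symm⟩

theorem cnt_union (h : Disjoint S T) (i : ℕ) : cnt c (S ∪ T) i = cnt c S i + cnt c T i := by
  unfold cnt
  rw [filter_union, card_union_of_disjoint (disjoint_filter_filter h)]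

theorem cnt_union_inter (h : Disjoint W W') (i : ℕ) :
    cnt c ((W ∪ W') ∩ P) i = cnt c (W ∩ P) i + cnt c (W' ∩ P) i := by
  rw [union_inter_distrib_right, cnt_union]
  exact disjoint_of_subset_left inter_subset_left (disjoint_of_subset_right inter_subset_left h)

theorem cnt_eq_ite {i : ℕ} (h : ∀ v ∈ S, c v = i) (x : ℕ) :
    cnt c S x = if x = i then S.card else 0 := by
  unfold cnt
  split_ifs with hx
  · rw [filter_true_of_mem fun v hv => by rw [h v hv, hx]]
  · rw [filter_false_of_mem fun v hv => by rw [h v hv]; exact fun h => hx h.symm, card_empty]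

theorem card_filter_sdiff_add_cnt (i : ℕ) :
    ((P \ W).filter (c · = i)).card + cnt c (W ∩ P) i = (P.filter (c · = i)).card := by
  have : P = (P \ W) ∪ (W ∩ P) := by
    rw [inter_comm, sdiff_union_inter]
  conv_rhs => rw [this]
  exact (cnt_union (by
    rw [inter_comm]
    exact disjoint_sdiff_inter P W) i).symm

theorem union_inter_left_part (hPQ : Disjoint P Q) (hS : S ⊆ P) (hT : T ⊆ Q) :
    (S ∪ T) ∩ P = S := by
  rw [union_inter_distrib_right, inter_eq_left.2 hS,
    disjoint_iff_inter_eq_empty.1 (disjoint_of_subset_left hT hPQ.symm), union_empty]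

theorem union_inter_right_part (hPQ : Disjoint P Q) (hS : S ⊆ P) (hT : T ⊆ Q) :
    (S ∪ T) ∩ Q = T := by
  rw [union_comm]
  exact union_inter_left_part hPQ.symm hT hS

theorem Tiled.exists_blocks (hPQ : Disjoint P Q) (h : Tiled G P Q L L W) :
    ∃ M c, Blocks G P Q L M c ∧ ∀ v ∈ P ∪ Q, c v < M ↔ v ∈ W := by
  induction h with
  | nil => exact ⟨0, fun _ => 0, ⟨by simp, by simp, by simp, by simp, by simp⟩, by simp⟩
  | @add W S T _ hS hT hc ha hd ih =>
    obtain ⟨M, c, hB, hW⟩ := ih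
    have hc' : S.card = L ∧ T.card = L := by tauto
    rw [disjoint_left] at hd hPQ
    simp only [mem_union] at hW hd
    have hnot : ∀ v, v ∈ S ∨ v ∈ T → ¬ c v < M := fun v hv h' =>
      hd ((hW v (hv.imp (@hS v) (@hT v))).1 h') hv
    refine ⟨M + 1, fun v => if v ∈ S ∪ T then M else if c v < M then c v else M + 1,
      ⟨?_, ?_, ?_, ?_, ?_⟩, ?_⟩
    · intro i hi
      rcases (Nat.lt_succ_iff_lt_or_eq.1 hi) with hi | rfl
      · rw [← hB.cardP i hi]
        congr 1
        apply filter_congr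
        intro v hv
        have := hnot v
        simp only [mem_union]
        split_ifs with h1 h2
        · have := this h1; omega
        · rfl
        · omega
      · rw [← hc'.1]
        congr 1
        ext v
        simp only [mem_union, mem_filter]
        constructor
        · rintro ⟨hv, hv'⟩
          split_ifs at hv' with h1 h2
          · exact h1.resolve_right fun h => hPQ hv (hT h)
          · omega
          · omega
        · exact fun hv => ⟨hS hv, by simp [hv]⟩
    · intro i hi
      rcases (Nat.lt_succ_iff_lt_or_eq.1 hi) with hi | rfl
      · rw [← hB.cardQ i hi]
        congr 1
        apply filter_congr
        intro v hv
        have := hnot v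
        simp only [mem_union]
        split_ifs with h1 h2
        · have := this h1; omega
        · rfl
        · omega
      · rw [← hc'.2]
        congr 1
        ext v
        simp only [mem_union, mem_filter]
        constructor
        · rintro ⟨hv, hv'⟩
          split_ifs at hv' with h1 h2
          · exact h1.resolve_left fun h => hPQ (hS h) hv
          · omega
          · omega
        · exact fun hv => ⟨hT hv, by simp [hv]⟩
    · intro v _
      split_ifs <;> omega
    · intro v _
      split_ifs <;> omega
    · intro u hu v hv he hl
      simp only [mem_union] at he hl
      split_ifs at he hl with h1 h2 h3 h4 <;> try omega
      · exact ha u (h1.resolve_right fun h => hPQ hu (hT h)) v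
          (h2.resolve_left fun h => hPQ (hS h) hv)
      · exact hB.adj u hu v hv he ‹_›
    · intro v hv
      simp only [mem_union] at hv ⊢
      have := hW v hv
      split_ifs with h1 h2
      · simp [h1]
      · simp only [h1, or_false]
        exact ⟨fun _ => this.1 h2, fun _ => by omega⟩
      · simp only [h1, or_false]
        exact ⟨fun h => by omega, fun h => absurd (this.2 h) h2⟩

/-- The unused part of a family of blocks can be tiled when what was used is balanced and
divisible inside each block. -/
theorem Blocks.tiled_residual (hPQ : Disjoint P Q) (hB : Blocks G P Q L M c) (hl : l ∣ L)
    (hW : Tiled G P Q l l W)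
    (hc : ∀ i < M, cnt c (W ∩ P) i = cnt c (W ∩ Q) i ∧ l ∣ cnt c (W ∩ P) i) :
    Tiled G P Q l l (W ∪ (P ∪ Q).filter (c · < M)) := by
  suffices H : ∀ k ≤ M, Tiled G P Q l l (W ∪ (P ∪ Q).filter (c · < k)) from H M le_rfl
  intro k hk
  induction k with
  | zero => simpa
  | succ k ih =>
    have h1 := card_filter_sdiff_add_cnt (P := P) (W := W) (c := c) k
    have h2 := card_filter_sdiff_add_cnt (P := Q) (W := W) (c := c) k
    have h3 := hc k (by omega)
    rw [hB.cardP k (by omega)] at h1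
    rw [hB.cardQ k (by omega)] at h2
    obtain ⟨r, hr⟩ : l ∣ ((P \ W).filter (c · = k)).card := by
      have : ((P \ W).filter (c · = k)).card = L - cnt c (W ∩ P) k := by omega
      rw [this]
      exact Nat.dvd_sub hl h3.2
    have h4 := Tiled.complete (G := G) (P := P) (Q := Q) (l := l)
      (S := (P \ W).filter (c · = k)) (T := (Q \ W).filter (c · = k)) r
      ((filter_subset _ _).trans sdiff_subset) ((filter_subset _ _).trans sdiff_subset) hPQ hr
      (by omega) fun u hu v hv => by
        simp only [mem_filter, mem_sdiff] at hu hv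
        exact hB.adj u hu.1.1 v hv.1.1 (by omega) (by omega)
    convert (ih (by omega)).union h4 ?_ using 1
    · ext v
      simp only [mem_union, mem_filter, mem_sdiff]
      have : c v < k + 1 ↔ c v < k ∨ c v = k := by omega
      rw [this]
      tauto
    · rw [disjoint_left]
      intro v
      simp only [mem_union, mem_filter, mem_sdiff]
      rintro (h | h)
      · tauto
      · have : ¬ c v = k := by omega
        tauto

/-- A nonempty vertex set has many neighbours in the labels to which it is not sparse. -/
theorem Robust.card_filter_labels_ge (hR : Robust G P Q n a) (hB : ∀ v ∈ Q, c v ≤ M)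
    {γ : ℝ} (hγ : 0 ≤ γ) {L₀ : ℝ} (hL₀ : 0 ≤ L₀) {X : Finset α} (hX : X ⊆ P) (hX0 : 0 < X.card)
    (W : Finset α) (J : Finset ℕ) (hJ : ∀ i ≤ M, i ∉ J →
      ((Q \ W).filter (c · = i)).card < L₀ ∨
      eAB G X ((Q \ W).filter (c · = i)) ≤ γ * X.card * ((Q \ W).filter (c · = i)).card) :
    (n : ℝ) / 2 - W.card - γ * n - L₀ * (M + 1) ≤ ((Q \ W).filter (c · ∈ J)).card := by
  have hX0' : (0 : ℝ) < X.card := by exact_mod_cast hX0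
  have hlow : (X.card : ℝ) * (n / 2) ≤ eAB G X Q := by
    have : X.card * n ≤ 2 * eAB G X Q := by
      unfold eAB
      rw [mul_sum, ← smul_eq_mul]
      exact card_nsmul_le_sum _ _ _ fun v hv => hR.degP v (hX hv)
    have : (X.card : ℝ) * n ≤ 2 * eAB G X Q := by exact_mod_cast this
    linarith
  set K := (Q \ W).filter (c · ∈ J) with hK
  set K' := (Q \ W).filter (c · ∉ J) with hK'
  have h1 : (eAB G X Q : ℝ) ≤ X.card * W.card + (X.card * K.card + eAB G X K') := by
    have e1 : Q ⊆ W ∪ (K ∪ K') := by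
      rw [hK, hK', filter_union_filter_not_eq]
      simp
    have e2 := (eAB_mono (G := G) (Subset.refl X) e1).trans (eAB_union_right_le _ _ _)
    have e3 := eAB_union_right_le (G := G) X K K'
    have e4 := eAB_le_mul (G := G) X W
    have e5 := eAB_le_mul (G := G) X K
    have : eAB G X Q ≤ X.card * W.card + (X.card * K.card + eAB G X K') := by omega
    exact_mod_cast this
  have h2 : (eAB G X K' : ℝ) ≤ X.card * (L₀ * (M + 1) + γ * n) := by
    have hmem : ∀ v ∈ K', c v ∈ (range (M + 1)).filter (· ∉ J) := fun v hv => by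
      simp only [hK', mem_filter, mem_sdiff] at hv
      simp only [mem_filter, mem_range]
      exact ⟨by have := hB v hv.1.1; omega, hv.2⟩
    rw [eAB_fiberwise_right X K' c _ hmem]
    push_cast
    have hb : ∀ i ∈ (range (M + 1)).filter (· ∉ J), (eAB G X (K'.filter (c · = i)) : ℝ) ≤
        X.card * (L₀ + γ * (K'.filter (c · = i)).card) := fun i hi => by
      simp only [mem_filter, mem_range] at hi
      have hfe : K'.filter (c · = i) = (Q \ W).filter (c · = i) := by
        ext v
        simp only [hK', mem_filter]
        constructor
        · tauto
        · rintro ⟨h, rfl⟩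
          tauto
      rw [hfe]
      rcases hJ i (by omega) hi.2 with h | h
      · have e1 : (eAB G X ((Q \ W).filter (c · = i)) : ℝ) ≤
            X.card * ((Q \ W).filter (c · = i)).card := by exact_mod_cast eAB_le_mul _ _
        refine e1.trans (mul_le_mul_of_nonneg_left ?_ hX0'.le)
        have : 0 ≤ γ * (((Q \ W).filter (c · = i)).card : ℝ) := by positivity
        linarith
      · refine h.trans ?_
        have : 0 ≤ X.card * L₀ := by positivity
        nlinarith
    refine (sum_le_sum hb).trans ?_
    rw [← mul_sum, sum_add_distrib, ← mul_sum]
    have e1 := card_eq_sum_card_fiberwise (f := c) (s := K') (t := (range (M + 1)).filter (· ∉ J))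
      (fun v hv => hmem v hv)
    have e2 : K'.card ≤ n := by
      rw [← hR.cardQ]
      exact card_le_card ((filter_subset _ _).trans sdiff_subset)
    have e3 : ∑ i ∈ (range (M + 1)).filter (· ∉ J), ((K'.filter (c · = i)).card : ℝ) = K'.card := by
      rw [e1]
      push_cast
      rfl
    rw [e3, sum_const, nsmul_eq_mul]
    refine mul_le_mul_of_nonneg_left (add_le_add ?_ ?_) hX0'.le
    · rw [mul_comm]
      refine mul_le_mul_of_nonneg_left ?_ hL₀
      have := card_filter_le (range (M + 1)) (· ∉ J)
      rw [card_range] at this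
      exact_mod_cast this
    · exact mul_le_mul_of_nonneg_left (by exact_mod_cast e2) hγ
  have h3 : (X.card : ℝ) * (n / 2) ≤ X.card * (W.card + K.card + (L₀ * (M + 1) + γ * n)) := by
    linarith
  have := le_of_mul_le_mul_left h3 hX0'
  linarith

end Labels

section AlmostCover

variable {α : Type*} [DecidableEq α] {G : SimpleGraph α} {P Q W S T : Finset α}
  {n L M l : ℕ} {a γ : ℝ} {c : α → ℕ}

theorem card_filter_labels_eq_of_le {P Q : Finset α} (hP : ∀ v ∈ P, c v ≤ M)
    (hQ : ∀ v ∈ Q, c v ≤ M) (hPQ : P.card = Q.card)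
    (h : ∀ i < M, (P.filter (c · = i)).card = (Q.filter (c · = i)).card) :
    (P.filter (c · = M)).card = (Q.filter (c · = M)).card := by
  rw [card_eq_sum_card_fiberwise (f := c) (s := P) (t := range (M + 1))
      (fun v hv => by simpa [Nat.lt_succ_iff] using hP v hv),
    card_eq_sum_card_fiberwise (f := c) (s := Q) (t := range (M + 1))
      (fun v hv => by simpa [Nat.lt_succ_iff] using hQ v hv), sum_range_succ, sum_range_succ,
    sum_congr rfl fun i hi => h i (mem_range.1 hi)] at hPQ
  exact Nat.add_left_cancel hPQ

theorem Blocks.card_eq (hB : Blocks G P Q L M c) (hPQ : P.card = Q.card) (i : ℕ) (hi : i ≤ M) :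
    (P.filter (c · = i)).card = (Q.filter (c · = i)).card := by
  rcases hi.lt_or_eq with hi | rfl
  · rw [hB.cardP i hi, hB.cardQ i hi]
  · exact card_filter_labels_eq_of_le hB.leP hB.leQ hPQ fun i hi => by
      rw [hB.cardP i hi, hB.cardQ i hi]

theorem Blocks.mul_le (hB : Blocks G P Q L M c) : M * L + (P.filter (c · = M)).card = P.card := by
  rw [card_eq_sum_card_fiberwise (f := c) (s := P) (t := range (M + 1))
      (fun v hv => by simpa [Nat.lt_succ_iff] using hB.leP v hv), sum_range_succ,
    sum_congr rfl fun i hi => hB.cardP i (mem_range.1 hi), sum_const, card_range, smul_eq_mul]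

/-- The number of vertices with labels in `J` is the same on both sides. -/
theorem card_filter_mem_labels_eq {P Q : Finset α} (J : Finset ℕ)
    (h : ∀ i ∈ J, (P.filter (c · = i)).card = (Q.filter (c · = i)).card) :
    (P.filter (c · ∈ J)).card = (Q.filter (c · ∈ J)).card := by
  rw [card_eq_sum_card_fiberwise (f := c) (s := P.filter (c · ∈ J)) (t := J)
      (fun v hv => (mem_filter.1 hv).2), card_eq_sum_card_fiberwise (f := c)
      (s := Q.filter (c · ∈ J)) (t := J) (fun v hv => (mem_filter.1 hv).2)]
  refine sum_congr rfl fun i hi => ?_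
  rw [filter_filter, filter_filter]
  have : ∀ v, (c v ∈ J ∧ c v = i) ↔ c v = i := fun v => ⟨fun h => h.2, fun h => ⟨h ▸ hi, h⟩⟩
  simpa only [this] using h i hi

/-- `D` is a set of blocks, disjoint from `W`, which uses each label equally on both sides,
and the leftover label `l` times on each side. -/
structure Augment {α : Type*} [DecidableEq α] (G : SimpleGraph α) (P Q W : Finset α) (l M : ℕ)
    (c : α → ℕ) (D : Finset α) : Prop where
  tiled : Tiled G P Q l l D
  disj : Disjoint W D
  card : D.card ≤ 6 * l
  cnt_eq : ∀ i, cnt c (D ∩ P) i = cnt c (D ∩ Q) i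
  dvd : ∀ i, l ∣ cnt c (D ∩ P) i
  cnt_last : cnt c (D ∩ P) M = l

/-- A copy of `K_{l,l}` outside `W` with labels `i` and `j`. -/
def Piece {α : Type*} [DecidableEq α] (G : SimpleGraph α) (P Q W : Finset α) (l : ℕ)
    (c : α → ℕ) (i j : ℕ) : Prop :=
  ∃ S ⊆ (P \ W).filter (c · = i), ∃ T ⊆ (Q \ W).filter (c · = j),
    S.card = l ∧ T.card = l ∧ ∀ u ∈ S, ∀ v ∈ T, G.Adj u v

theorem Piece.augment (hPQ : Disjoint P Q) (h : Piece G P Q W l c M M) :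
    ∃ D, Augment G P Q W l M c D := by
  obtain ⟨S, hS, T, hT, hSc, hTc, ha⟩ := h
  have hSP : S ⊆ P := hS.trans ((filter_subset _ _).trans sdiff_subset)
  have hTQ : T ⊆ Q := hT.trans ((filter_subset _ _).trans sdiff_subset)
  have e1 : ∀ x, cnt c ((S ∪ T) ∩ P) x = if x = M then l else 0 := fun x => by
    rw [union_inter_left_part hPQ hSP hTQ, cnt_eq_ite (fun v hv => (mem_filter.1 (hS hv)).2), hSc]
  have e2 : ∀ x, cnt c ((S ∪ T) ∩ Q) x = if x = M then l else 0 := fun x => by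
    rw [union_inter_right_part hPQ hSP hTQ, cnt_eq_ite (fun v hv => (mem_filter.1 (hT hv)).2), hTc]
  refine ⟨S ∪ T, .single hSP hTQ (.inl ⟨hSc, hTc⟩) ha, ?_, ?_, fun i => by rw [e1, e2], fun i => ?_,
    by simp [e1]⟩
  · rw [disjoint_right]
    intro v hv
    rcases mem_union.1 hv with hv | hv
    · exact (mem_sdiff.1 (mem_filter.1 (hS hv)).1).2
    · exact (mem_sdiff.1 (mem_filter.1 (hT hv)).1).2
  · have := card_union_le S T
    omega
  · rw [e1]
    split_ifs <;> simp

/-- Joining a piece to a tiled set avoiding its labels. -/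
theorem Piece.extend (hPQ : Disjoint P Q) {i j : ℕ} (h : Piece G P Q W l c i j) {D : Finset α}
    (hD : Tiled G P Q l l D) (hWD : Disjoint W D) (hi : cnt c (D ∩ P) i = 0)
    (hj : cnt c (D ∩ Q) j = 0) :
    ∃ D', Tiled G P Q l l D' ∧ Disjoint W D' ∧ D'.card ≤ D.card + 2 * l ∧
      (∀ x, cnt c (D' ∩ P) x = cnt c (D ∩ P) x + if x = i then l else 0) ∧
      ∀ x, cnt c (D' ∩ Q) x = cnt c (D ∩ Q) x + if x = j then l else 0 := by
  obtain ⟨S, hS, T, hT, hSc, hTc, ha⟩ := h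
  have hSP : S ⊆ P := hS.trans ((filter_subset _ _).trans sdiff_subset)
  have hTQ : T ⊆ Q := hT.trans ((filter_subset _ _).trans sdiff_subset)
  have hSi : ∀ v ∈ S, c v = i := fun v hv => (mem_filter.1 (hS hv)).2
  have hTj : ∀ v ∈ T, c v = j := fun v hv => (mem_filter.1 (hT hv)).2
  have hd : Disjoint D (S ∪ T) := by
    rw [disjoint_right]
    intro v hv hvD
    rcases mem_union.1 hv with hv | hv
    · refine notMem_empty v ((card_eq_zero.1 hi) ▸ ?_)
      simp [hvD, hSP hv, hSi v hv]
    · refine notMem_empty v ((card_eq_zero.1 hj) ▸ ?_)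
      simp [hvD, hTQ hv, hTj v hv]
  refine ⟨D ∪ (S ∪ T), hD.union (.single hSP hTQ (.inl ⟨hSc, hTc⟩) ha) hd, ?_, ?_, fun x => ?_,
    fun x => ?_⟩
  · rw [disjoint_union_right]
    refine ⟨hWD, ?_⟩
    rw [disjoint_right]
    intro v hv
    rcases mem_union.1 hv with hv | hv
    · exact (mem_sdiff.1 (mem_filter.1 (hS hv)).1).2
    · exact (mem_sdiff.1 (mem_filter.1 (hT hv)).1).2
  · have := card_union_le S T
    have := card_union_le D (S ∪ T)
    omega
  · rw [cnt_union_inter hd, union_inter_left_part hPQ hSP hTQ, cnt_eq_ite hSi, hSc]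
  · rw [cnt_union_inter hd, union_inter_right_part hPQ hSP hTQ, cnt_eq_ite hTj, hTc]

@[simp] theorem cnt_empty (x : ℕ) : cnt c ∅ x = 0 := by simp [cnt]

theorem Piece.augment_two (hPQ : Disjoint P Q) {k : ℕ} (hk : k ≠ M) (h1 : Piece G P Q W l c M k)
    (h2 : Piece G P Q W l c k M) : ∃ D, Augment G P Q W l M c D := by
  obtain ⟨D, hD, hWD, hDc, hDP, hDQ⟩ := h1.extend hPQ .nil (disjoint_empty_right _) (by simp)
    (by simp)
  obtain ⟨D', hD', hWD', hDc', hDP', hDQ'⟩ := h2.extend hPQ hD hWD (by simp [hDP, hk])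
    (by simp [hDQ, hk.symm])
  refine ⟨D', hD', hWD', by simp at hDc; omega, fun i => ?_, fun i => ?_, ?_⟩
  · simp [hDP', hDQ', hDP, hDQ, add_comm]
  · rw [hDP', hDP]
    exact dvd_add (dvd_add (by simp) (by split_ifs <;> simp)) (by split_ifs <;> simp)
  · simp [hDP', hDP, hk.symm]

theorem Piece.augment_three (hPQ : Disjoint P Q) {i j : ℕ} (hi : i ≠ M) (hj : j ≠ M) (hij : i ≠ j)
    (h1 : Piece G P Q W l c M i) (h2 : Piece G P Q W l c i j) (h3 : Piece G P Q W l c j M) :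
    ∃ D, Augment G P Q W l M c D := by
  obtain ⟨D, hD, hWD, hDc, hDP, hDQ⟩ := h1.extend hPQ .nil (disjoint_empty_right _) (by simp)
    (by simp)
  obtain ⟨D', hD', hWD', hDc', hDP', hDQ'⟩ := h2.extend hPQ hD hWD (by simp [hDP, hi])
    (by simp [hDQ, hij.symm])
  obtain ⟨E, hE, hWE, hEc, hEP, hEQ⟩ := h3.extend hPQ hD' hWD'
    (by simp [hDP', hDP, hj, hij.symm]) (by simp [hDQ', hDQ, hi.symm, hj.symm])
  refine ⟨E, hE, hWE, by simp at hDc; omega, fun x => ?_, fun x => ?_, ?_⟩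
  · simp only [hEP, hEQ, hDP', hDQ', hDP, hDQ, empty_inter]
    simp only [cnt_empty]
    omega
  · rw [hEP, hDP', hDP]
    exact dvd_add (dvd_add (dvd_add (by simp) (by split_ifs <;> simp))
      (by split_ifs <;> simp)) (by split_ifs <;> simp)
  · simp [hEP, hDP', hDP, hi.symm, hj.symm]

theorem Robust.exists_augment (hR : Robust G P Q n a) (hB : Blocks G P Q L M c) (hγ : 0 < γ)
    (hγa : γ < a) (hn : 0 < n) {L₀ : ℕ}
    (hK : ∀ S T : Finset α, L₀ ≤ S.card → L₀ ≤ T.card → γ * S.card * T.card ≤ eAB G S T →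
      ∃ S' ⊆ S, ∃ T' ⊆ T, S'.card = l ∧ T'.card = l ∧ ∀ u ∈ S', ∀ v ∈ T', G.Adj u v)
    (hW : ∀ i, cnt c (W ∩ P) i = cnt c (W ∩ Q) i)
    (hlast : L₀ + cnt c (W ∩ P) M < (P.filter (c · = M)).card)
    (hsmall : W.card + γ * n + L₀ * (M + 1) ≤ a * n) :
    ∃ D, Augment G P Q W l M c D := by
  set A : ℕ → Finset α := fun i => (P \ W).filter (c · = i) with hA
  set B : ℕ → Finset α := fun i => (Q \ W).filter (c · = i) with hBdef
  have hAB : ∀ i ≤ M, (A i).card = (B i).card := fun i hi => by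
    have h1 := card_filter_sdiff_add_cnt (P := P) (W := W) (c := c) i
    have h2 := card_filter_sdiff_add_cnt (P := Q) (W := W) (c := c) i
    have h3 := hW i
    have h4 := hB.card_eq (hR.cardP.trans hR.cardQ.symm) i hi
    simp only [hA, hBdef]
    omega
  have hAM : L₀ < (A M).card := by
    have h1 := card_filter_sdiff_add_cnt (P := P) (W := W) (c := c) M
    simp only [hA]
    omega
  have hBM : L₀ < (B M).card := hAB M le_rfl ▸ hAM
  set T1 := (range (M + 1)).filter fun i => i = M ∨ (L₀ ≤ (B i).card ∧
    γ * (A M).card * (B i).card ≤ eAB G (A M) (B i)) with hT1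
  set T2 := (range (M + 1)).filter fun i => i = M ∨ (L₀ ≤ (A i).card ∧
    γ * (B M).card * (A i).card ≤ eAB G (B M) (A i)) with hT2
  have h1 := hR.card_filter_labels_ge hB.leQ hγ.le (Nat.cast_nonneg L₀) (X := A M)
    ((filter_subset _ _).trans sdiff_subset) (by omega) W T1 fun i hi hi' => by
      simp only [hT1, mem_filter, mem_range, not_and, not_or, not_le] at hi'
      have := (hi' (by omega)).2
      by_cases h : L₀ ≤ (B i).card
      · exact .inr (this h).le
      · exact .inl (by exact_mod_cast not_le.1 h)
  have h2 := hR.swap.card_filter_labels_ge hB.leP hγ.le (Nat.cast_nonneg L₀) (X := B M)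
    ((filter_subset _ _).trans sdiff_subset) (by omega) W T2 fun i hi hi' => by
      simp only [hT2, mem_filter, mem_range, not_and, not_or, not_le] at hi'
      have := (hi' (by omega)).2
      by_cases h : L₀ ≤ (A i).card
      · exact .inr (this h).le
      · exact .inl (by exact_mod_cast not_le.1 h)
  have h3 : ((P \ W).filter (c · ∈ T1)).card = ((Q \ W).filter (c · ∈ T1)).card :=
    card_filter_mem_labels_eq T1 fun i hi =>
      hAB i (Nat.lt_succ_iff.1 (mem_range.1 (mem_filter.1 hi).1))
  have h4 : ((P \ W).filter (c · ∈ T2)).card = ((Q \ W).filter (c · ∈ T2)).card :=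
    card_filter_mem_labels_eq T2 fun i hi =>
      hAB i (Nat.lt_succ_iff.1 (mem_range.1 (mem_filter.1 hi).1))
  rw [← h3] at h1
  rw [h4] at h2
  have h5 := hR.dense _ ((filter_subset (c · ∈ T1) _).trans (sdiff_subset (t := W))) _
    ((filter_subset (c · ∈ T2) _).trans (sdiff_subset (t := W))) (by linarith) (by linarith)
  have hcard1 : ((P \ W).filter (c · ∈ T1)).card ≤ n := hR.cardP ▸
    card_le_card ((filter_subset _ _).trans sdiff_subset)
  have hcard2 : ((Q \ W).filter (c · ∈ T2)).card ≤ n := hR.cardQ ▸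
    card_le_card ((filter_subset _ _).trans sdiff_subset)
  obtain ⟨i, hi, j, hj, hij⟩ : ∃ i ∈ T1, ∃ j ∈ T2,
      γ * (A i).card * (B j).card ≤ eAB G (A i) (B j) := by
    by_contra! hcon
    have hfA : ∀ i ∈ T1, ((P \ W).filter (c · ∈ T1)).filter (c · = i) = A i := fun i hi => by
      ext v
      simp only [hA, mem_filter]
      constructor
      · tauto
      · rintro ⟨h, rfl⟩
        tauto
    have hfB : ∀ i ∈ T2, ((Q \ W).filter (c · ∈ T2)).filter (c · = i) = B i := fun i hi => by
      ext v
      simp only [hBdef, mem_filter]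
      constructor
      · tauto
      · rintro ⟨h, rfl⟩
        tauto
    have e1 := card_eq_sum_card_fiberwise (f := c) (s := (P \ W).filter (c · ∈ T1)) (t := T1)
      (fun v hv => (mem_filter.1 hv).2)
    have e2 := card_eq_sum_card_fiberwise (f := c) (s := (Q \ W).filter (c · ∈ T2)) (t := T2)
      (fun v hv => (mem_filter.1 hv).2)
    rw [sum_congr rfl fun i hi => by rw [hfA i hi]] at e1
    rw [sum_congr rfl fun i hi => by rw [hfB i hi]] at e2
    have e3 : (eAB G ((P \ W).filter (c · ∈ T1)) ((Q \ W).filter (c · ∈ T2)) : ℝ) ≤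
        γ * (((P \ W).filter (c · ∈ T1)).card * ((Q \ W).filter (c · ∈ T2)).card) := by
      rw [eAB_fiberwise_left _ _ c T1 fun v hv => (mem_filter.1 hv).2, e1, e2]
      push_cast
      rw [sum_mul_sum, mul_sum]
      refine sum_le_sum fun i hi => ?_
      rw [hfA i hi, eAB_fiberwise_right _ _ c T2 fun v hv => (mem_filter.1 hv).2]
      push_cast
      rw [mul_sum]
      refine sum_le_sum fun j hj => ?_
      rw [hfB j hj, ← mul_assoc]
      exact (hcon i hi j hj).le
    have e4 : (((P \ W).filter (c · ∈ T1)).card : ℝ) * ((Q \ W).filter (c · ∈ T2)).card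
        ≤ n * n := by
      exact_mod_cast Nat.mul_le_mul hcard1 hcard2
    have e5 : (0 : ℝ) < (n : ℝ) * n := by positivity
    nlinarith
  simp only [hT1, mem_filter, mem_range, Nat.lt_succ_iff] at hi
  simp only [hT2, mem_filter, mem_range, Nat.lt_succ_iff] at hj
  have hAi : L₀ ≤ (A i).card := by
    rcases hi.2 with rfl | h
    · exact hAM.le
    · exact hAB i hi.1 ▸ h.1
  have hBj : L₀ ≤ (B j).card := by
    rcases hj.2 with rfl | h
    · exact hBM.le
    · exact hAB j hj.1 ▸ h.1
  have hp : Piece G P Q W l c i j := hK _ _ hAi hBj hij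
  have hp1 : i ≠ M → Piece G P Q W l c M i := fun h => by
    have := hi.2.resolve_left h
    exact hK _ _ hAM.le this.1 this.2
  have hp2 : j ≠ M → Piece G P Q W l c j M := fun h => by
    have := hj.2.resolve_left h
    refine hK _ _ this.1 hBM.le ?_
    have h' := this.2
    rw [eAB_comm] at h'
    simp only [hA, hBdef] at h' ⊢
    linarith
  by_cases hiM : i = M
  · subst hiM
    by_cases hjM : j = i
    · subst hjM
      exact hp.augment hR.disj
    · exact hp.augment_two hR.disj hjM (hp2 hjM)
  · by_cases hjM : j = M
    · subst hjM
      exact (hp1 hiM).augment_two hR.disj hiM hp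
    · by_cases hij' : i = j
      · subst hij'
        exact (hp1 hiM).augment_two hR.disj hiM (hp2 hjM)
      · exact (hp1 hiM).augment_three hR.disj hiM hjM hij' hp (hp2 hjM)

end AlmostCover

section AlmostCoverIterate

variable {α : Type*} [DecidableEq α] {G : SimpleGraph α} {P Q W S T : Finset α}
  {n L M l : ℕ} {a γ : ℝ} {c : α → ℕ}

theorem Robust.exists_augments (hR : Robust G P Q n a) (hB : Blocks G P Q L M c) (hγ : 0 < γ)
    (hγa : γ < a) (hn : 0 < n) (hl : 0 < l) {L₀ : ℕ}
    (hK : ∀ S T : Finset α, L₀ ≤ S.card → L₀ ≤ T.card → γ * S.card * T.card ≤ eAB G S T →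
      ∃ S' ⊆ S, ∃ T' ⊆ T, S'.card = l ∧ T'.card = l ∧ ∀ u ∈ S', ∀ v ∈ T', G.Adj u v)
    (J : ℕ) (hlast : L₀ + l * J ≤ (P.filter (c · = M)).card)
    (hsmall : 6 * l * J + γ * n + L₀ * (M + 1) ≤ a * n) :
    ∃ W, Tiled G P Q l l W ∧ W.card ≤ 6 * l * J ∧ (∀ i, cnt c (W ∩ P) i = cnt c (W ∩ Q) i) ∧
      (∀ i, l ∣ cnt c (W ∩ P) i) ∧ cnt c (W ∩ P) M = l * J := by
  induction J with
  | zero => exact ⟨∅, .nil, by simp, by simp, by simp, by simp⟩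
  | succ J ih =>
    push_cast at hsmall
    have hl' : (0 : ℝ) ≤ l := by positivity
    obtain ⟨W, hW, hWc, hWe, hWd, hWM⟩ := ih (by nlinarith) (by linarith)
    have hWc' : (W.card : ℝ) ≤ 6 * l * J := by exact_mod_cast hWc
    obtain ⟨D, hD⟩ := hR.exists_augment hB hγ hγa hn hK hWe (by rw [hWM]; nlinarith) (by linarith)
    refine ⟨W ∪ D, hW.union hD.tiled hD.disj, ?_, fun i => ?_, fun i => ?_, ?_⟩
    · have := card_union_le W D
      have := hD.card
      linarith
    · rw [cnt_union_inter hD.disj, cnt_union_inter hD.disj, hWe, hD.cnt_eq]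
    · rw [cnt_union_inter hD.disj]
      exact dvd_add (hWd i) (hD.dvd i)
    · rw [cnt_union_inter hD.disj, hWM, hD.cnt_last]
      ring

/-- A used set and the unused parts of the blocks cover most of `P`. -/
theorem Blocks.card_covered (hB : Blocks G P Q L M c) :
    P.card + cnt c (W ∩ P) M =
      ((W ∪ (P ∪ Q).filter (c · < M)) ∩ P).card + (P.filter (c · = M)).card := by
  have h1 := card_filter_sdiff_add_cnt (P := P) (W := W) (c := c) M
  have h2 : P = ((W ∪ (P ∪ Q).filter (c · < M)) ∩ P) ∪ (P \ W).filter (c · = M) := by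
    ext v
    simp only [mem_union, mem_inter, mem_filter, mem_sdiff]
    constructor
    · intro hv
      rcases (hB.leP v hv).lt_or_eq with h | h <;> tauto
    · tauto
  have h3 : Disjoint ((W ∪ (P ∪ Q).filter (c · < M)) ∩ P) ((P \ W).filter (c · = M)) := by
    rw [disjoint_left]
    intro v
    simp only [mem_union, mem_inter, mem_filter, mem_sdiff]
    rintro ⟨h | h, _⟩ ⟨_, h'⟩
    · tauto
    · omega
  have h4 := congrArg card h2
  rw [card_union_of_disjoint h3] at h4
  omega

end AlmostCoverIterate

/-- A robust graph has copies of `K_{l,l}` covering almost all vertices. -/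
theorem exists_almost_cover {a ε : ℝ} (ha : 0 < a) (hε : 0 < ε) (l : ℕ) (hl : 0 < l) :
    ∃ n₀ : ℕ, ∀ n, n₀ ≤ n → ∀ (α : Type) [DecidableEq α] (G : SimpleGraph α) (P Q : Finset α),
      Robust G P Q n a → ∃ W, Tiled G P Q l l W ∧ (1 - ε) * n ≤ (W ∩ P).card := by
  set δ := min (a / 24) (ε / 2) with hδ
  have hδ0 : 0 < δ := by positivity
  have hδa : δ ≤ a / 24 := min_le_left _ _
  have hδε : δ ≤ ε / 2 := min_le_right _ _
  suffices H : ∀ j : ℕ, ∀ l, 0 < l → ∃ n₀ : ℕ, ∀ n, n₀ ≤ n → ∀ (α : Type) [DecidableEq α]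
      (G : SimpleGraph α) (P Q : Finset α), Robust G P Q n a →
      ∃ W, Tiled G P Q l l W ∧ min (j * δ) (1 - ε) * n ≤ (W ∩ P).card by
    obtain ⟨j, hj⟩ := exists_nat_ge (1 / δ)
    obtain ⟨n₀, hn₀⟩ := H j l hl
    refine ⟨n₀, fun n hn α _ G P Q hR => ?_⟩
    obtain ⟨W, hW, hc⟩ := hn₀ n hn α G P Q hR
    refine ⟨W, hW, ?_⟩
    rwa [min_eq_right] at hc
    rw [div_le_iff₀ hδ0] at hj
    linarith
  intro j
  induction j with
  | zero =>
    intro l _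
    refine ⟨0, fun n _ α _ G P Q _ => ⟨∅, .nil, ?_⟩⟩
    have : min ((0 : ℕ) * δ) (1 - ε) * n ≤ 0 :=
      mul_nonpos_of_nonpos_of_nonneg (by simp) (by positivity)
    simpa using this
  | succ j ih =>
    intro l hl
    obtain ⟨L₀, hL₀⟩ := exists_complete_of_dense (γ := a / 4) (by positivity) l
    obtain ⟨q, hq⟩ := exists_nat_ge (4 * L₀ / a)
    obtain ⟨n₁, hn₁⟩ := ih (l * (q + 1)) (by positivity)
    obtain ⟨n₂, hn₂⟩ := exists_nat_ge ((4 * (6 * l + L₀)) / a)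
    obtain ⟨n₃, hn₃⟩ := exists_nat_ge ((2 * (l + L₀)) / ε)
    refine ⟨max (max n₁ n₂) (max n₃ 1), fun n hn α _ G P Q hR => ?_⟩
    simp only [max_le_iff] at hn
    obtain ⟨⟨hn1, hn2⟩, hn3, hn4⟩ := hn
    have hn2' : (n₂ : ℝ) ≤ n := by exact_mod_cast hn2
    have hn3' : (n₃ : ℝ) ≤ n := by exact_mod_cast hn3
    have hn0 : (0 : ℝ) < n := by exact_mod_cast hn4
    obtain ⟨W₁, hW₁, hc₁⟩ := hn₁ n hn1 α G P Q hR
    obtain ⟨M, c, hB, hcM⟩ := hW₁.exists_blocks hR.disj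
    have hc₂ : (W₁ ∩ P).card + (P.filter (c · = M)).card = n := by
      rw [← hR.cardP]
      have := card_filter_add_card_filter_not (s := P) (fun v => c v = M)
      have e : W₁ ∩ P = P.filter (¬ c · = M) := by
        ext v
        simp only [mem_inter, mem_filter]
        constructor
        · rintro ⟨h1, h2⟩
          have := (hcM v (mem_union_left _ h2)).2 h1
          exact ⟨h2, by omega⟩
        · rintro ⟨h1, h2⟩
          have := hB.leP v h1
          exact ⟨(hcM v (mem_union_left _ h1)).1 (by omega), h1⟩
      rw [e]
      omega
    have hc₂' : ((W₁ ∩ P).card : ℝ) + (P.filter (c · = M)).card = n := by exact_mod_cast hc₂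
    by_cases hdone : (1 - ε) * n ≤ (W₁ ∩ P).card
    · have hW := Blocks.tiled_residual (l := l) (W := ∅) hR.disj hB (dvd_mul_right _ _) .nil
        (by simp)
      refine ⟨_, hW, ?_⟩
      have h := hB.card_covered (W := ∅)
      simp only [empty_inter, cnt_empty, add_zero] at h
      have h' : (W₁ ∩ P).card = ((∅ ∪ (P ∪ Q).filter (c · < M)) ∩ P).card := by
        rw [hR.cardP] at h
        omega
      rw [← h']
      exact (mul_le_mul_of_nonneg_right (min_le_right _ _) hn0.le).trans hdone
    · have hlε : 2 * (l + L₀) ≤ ε * n := by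
        rw [div_le_iff₀ hε] at hn₃
        nlinarith
      have hla : 4 * (6 * l + L₀) ≤ a * n := by
        rw [div_le_iff₀ ha] at hn₂
        nlinarith
      have hl0 : (0 : ℝ) < l := by exact_mod_cast hl
      set J := ⌈δ * n / l⌉₊ with hJ
      have hJ1 : δ * n ≤ l * J := by
        have := Nat.le_ceil (δ * n / l)
        rw [div_le_iff₀ hl0] at this
        linarith
      have hJ2 : l * J ≤ δ * n + l := by
        have := (Nat.ceil_lt_add_one (a := δ * n / l) (by positivity)).le
        rw [← hJ] at this
        calc (l : ℝ) * J ≤ l * (δ * n / l + 1) := by gcongr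
          _ = _ := by field_simp
      have hδn : δ * n ≤ a / 24 * n := mul_le_mul_of_nonneg_right hδa hn0.le
      have hδn' : δ * n ≤ ε / 2 * n := mul_le_mul_of_nonneg_right hδε hn0.le
      have hML : (L₀ : ℝ) * M ≤ a / 4 * n := by
        have e1 : M * (l * (q + 1)) ≤ n := by
          have := hB.mul_le
          rw [hR.cardP] at this
          omega
        have e2 : (M : ℝ) * (l * (q + 1)) ≤ n := by exact_mod_cast e1
        rw [div_le_iff₀ ha] at hq
        have e3 : (1 : ℝ) ≤ l := by exact_mod_cast hl
        have e4 : (M : ℝ) * q ≤ n := by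
          have : (q : ℝ) ≤ l * (q + 1) := by nlinarith [(Nat.cast_nonneg q : (0:ℝ) ≤ q)]
          have := mul_le_mul_of_nonneg_left this (Nat.cast_nonneg M : (0:ℝ) ≤ M)
          linarith
        have e5 := mul_le_mul_of_nonneg_left hq (Nat.cast_nonneg M : (0:ℝ) ≤ M)
        have e6 := mul_le_mul_of_nonneg_left e4 ha.le
        nlinarith
      obtain ⟨W, hW, hWc, hWe, hWd, hWM⟩ := hR.exists_augments hB (γ := a / 4) (by positivity)
        (by linarith) hn4 hl (hL₀ α G) J (by
          have : (L₀ : ℝ) + l * J ≤ (P.filter (c · = M)).card := by linarith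
          exact_mod_cast this) (by linarith)
      refine ⟨_, Blocks.tiled_residual hR.disj hB (dvd_mul_right _ _) hW
        fun i _ => ⟨hWe i, hWd i⟩, ?_⟩
      have h := hB.card_covered (W := W)
      have h' : (n : ℝ) + l * J = ((W ∪ (P ∪ Q).filter (c · < M)) ∩ P).card +
          (P.filter (c · = M)).card := by
        rw [hR.cardP, hWM] at h
        exact_mod_cast h
      have hmin : min ((j + 1 : ℕ) * δ) (1 - ε) ≤ min (j * δ) (1 - ε) + δ := by
        rw [← min_add_add_right]
        refine min_le_min ?_ (by linarith)
        push_cast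
        linarith
      have := mul_le_mul_of_nonneg_right hmin hn0.le
      linarith

section Insertion

variable {α : Type*} [DecidableEq α] {G : SimpleGraph α} {P Q W W' S T Z D D' : Finset α}
  {n L M h r p i j b b' : ℕ} {a γ τ : ℝ} {c : α → ℕ}

/-- `D` is disjoint from `W` and uses, up to multiples of `h` which are the same on both sides,
`r` more vertices of label `p` and `r` fewer of label `j` on the side of `P`. -/
structure Shift {α : Type*} [DecidableEq α] (G : SimpleGraph α) (P Q W : Finset α) (h M : ℕ)
    (c : α → ℕ) (r p j b : ℕ) (D : Finset α) : Prop where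
  tiled : Tiled G P Q h h D
  disj : Disjoint W D
  card : D.card ≤ b
  bal : ∃ f : ℕ → ℕ, f M = 0 ∧ ∀ x, cnt c (D ∩ Q) x = h * f x ∧
    cnt c (D ∩ P) x + (if x = j then r else 0) = h * f x + if x = p then r else 0

theorem Shift.trans (h1 : Shift G P Q W h M c r p i b D)
    (h2 : Shift G P Q (W ∪ D) h M c r i j b' D') :
    Shift G P Q W h M c r p j (b + b') (D ∪ D') := by
  obtain ⟨hW, hD⟩ := disjoint_union_left.1 h2.disj
  obtain ⟨f, hf, hf'⟩ := h1.bal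
  obtain ⟨g, hg, hg'⟩ := h2.bal
  refine ⟨h1.tiled.union h2.tiled hD, disjoint_union_right.2 ⟨h1.disj, hW⟩,
    (card_union_le _ _).trans (add_le_add h1.card h2.card), fun x => f x + g x, by simp [hf, hg],
    fun x => ?_⟩
  rw [cnt_union_inter hD, cnt_union_inter hD, mul_add]
  have := hf' x
  have := hg' x
  omega

theorem Shift.add (h1 : Shift G P Q W h M c r p j b D)
    (h2 : Shift G P Q (W ∪ D) h M c 1 p j b' D') :
    Shift G P Q W h M c (r + 1) p j (b + b') (D ∪ D') := by
  obtain ⟨hW, hD⟩ := disjoint_union_left.1 h2.disj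
  obtain ⟨f, hf, hf'⟩ := h1.bal
  obtain ⟨g, hg, hg'⟩ := h2.bal
  refine ⟨h1.tiled.union h2.tiled hD, disjoint_union_right.2 ⟨h1.disj, hW⟩,
    (card_union_le _ _).trans (add_le_add h1.card h2.card), fun x => f x + g x, by simp [hf, hg],
    fun x => ?_⟩
  rw [cnt_union_inter hD, cnt_union_inter hD, mul_add]
  have := hf' x
  have := hg' x
  split_ifs at * <;> omega

/-- Exchanging a vertex `u` with a vertex of a block in which `u` has many neighbours. -/
theorem Blocks.exists_shift (hPQ : Disjoint P Q) (hB : Blocks G P Q L M c) (hi : i < M)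
    (hh : 0 < h) {u : α} (hu : u ∈ P) (huW : u ∉ W) (huZ : u ∉ Z)
    (hdeg : h + Z.card ≤ degS G u ((Q \ W).filter (c · = i)))
    (hcard : h + Z.card ≤ ((P \ W).filter (c · = i)).card) :
    ∃ D, Shift G P Q W h M c 1 (c u) i (2 * h) D ∧ Disjoint Z D := by
  obtain ⟨T, hT, hTc, hTZ⟩ := exists_subset_card_eq_sdiff hdeg
  obtain ⟨S, hS, hSc, hSZ⟩ := exists_subset_card_eq_sdiff (k := h - 1) (Z := insert u Z)
    (S := (P \ W).filter (c · = i)) (by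
      have := card_insert_le u Z
      omega)
  rw [disjoint_insert_right] at hSZ
  have hSmem : ∀ v ∈ S, (v ∈ P ∧ v ∉ W) ∧ c v = i := fun v hv => by simpa using hS hv
  have hTmem : ∀ v ∈ T, ((v ∈ Q ∧ v ∉ W) ∧ c v = i) ∧ G.Adj u v := fun v hv => by simpa using hT hv
  have hSP : insert u S ⊆ P := insert_subset hu fun v hv => (hSmem v hv).1.1
  have hTQ : T ⊆ Q := fun v hv => (hTmem v hv).1.1.1
  have hS' : (insert u S).card = h := by
    rw [card_insert_of_notMem hSZ.1]
    omega
  refine ⟨insert u S ∪ T, ⟨.single hSP hTQ (.inl ⟨hS', hTc⟩) ?_, ?_, ?_, ?_⟩, ?_⟩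
  · intro v hv w hw
    rcases mem_insert.1 hv with rfl | hv
    · exact (hTmem w hw).2
    · have h1 := hSmem v hv
      have h2 := (hTmem w hw).1
      exact hB.adj v h1.1.1 w h2.1.1 (by rw [h1.2, h2.2]) (by omega)
  · rw [disjoint_right]
    intro v hv
    simp only [mem_union, mem_insert] at hv
    rcases hv with (rfl | hv) | hv
    · exact huW
    · exact (hSmem v hv).1.2
    · exact (hTmem v hv).1.1.2
  · have := card_union_le (insert u S) T
    omega
  · refine ⟨fun x => if x = i then 1 else 0, by simp [hi.ne'], fun x => ?_⟩
    rw [union_inter_left_part hPQ hSP hTQ, union_inter_right_part hPQ hSP hTQ,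
      cnt_eq_ite fun v hv => (hTmem v hv).1.2, insert_eq, cnt_union (by simpa using hSZ.1),
      cnt_eq_ite (i := c u) (by simp), cnt_eq_ite fun v hv => (hSmem v hv).2, hTc, hSc,
      card_singleton]
    simp only [mul_ite, mul_one, mul_zero]
    refine ⟨trivial, ?_⟩
    split_ifs <;> omega
  · rw [disjoint_right]
    intro v hv
    simp only [mem_union, mem_insert] at hv
    rcases hv with (rfl | hv) | hv
    · exact huZ
    · exact disjoint_left.1 hSZ.2 hv
    · exact disjoint_left.1 hTZ hv

/-- In a robust graph, labels to which `X` is not sparse and labels to which `Y` is not sparse are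
linked by a pair of labels which is not sparse. -/
theorem Robust.exists_link (hR : Robust G P Q n a) (hB : Blocks G P Q L M c) (hγ : 0 < γ)
    (hγa : γ < a) (hn : 0 < n) (hτ : 0 ≤ τ) {X Y : Finset α} (hX : X ⊆ P) (hY : Y ⊆ Q)
    (hX0 : 0 < X.card) (hY0 : 0 < Y.card)
    (hW : ∀ i ≤ M, ((P \ W).filter (c · = i)).card = ((Q \ W).filter (c · = i)).card)
    (hsmall : W.card + γ * n + τ * (M + 1) ≤ a * n) :
    ∃ i ≤ M, ∃ k ≤ M, τ ≤ ((Q \ W).filter (c · = i)).card ∧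
      γ * X.card * ((Q \ W).filter (c · = i)).card ≤ eAB G X ((Q \ W).filter (c · = i)) ∧
      τ ≤ ((P \ W).filter (c · = k)).card ∧
      γ * Y.card * ((P \ W).filter (c · = k)).card ≤ eAB G Y ((P \ W).filter (c · = k)) ∧
      γ * ((P \ W).filter (c · = i)).card * ((Q \ W).filter (c · = k)).card ≤
        eAB G ((P \ W).filter (c · = i)) ((Q \ W).filter (c · = k)) := by
  set A : ℕ → Finset α := fun i => (P \ W).filter (c · = i) with hA
  set B : ℕ → Finset α := fun i => (Q \ W).filter (c · = i) with hBdef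
  set T1 := (range (M + 1)).filter fun i => τ ≤ (B i).card ∧
    γ * X.card * (B i).card ≤ eAB G X (B i) with hT1
  set T2 := (range (M + 1)).filter fun i => τ ≤ (A i).card ∧
    γ * Y.card * (A i).card ≤ eAB G Y (A i) with hT2
  have h1 := hR.card_filter_labels_ge hB.leQ hγ.le hτ hX hX0 W T1 fun i hi hi' => by
      simp only [hT1, mem_filter, mem_range, not_and, not_le] at hi'
      by_cases h : τ ≤ (B i).card
      · exact .inr (hi' (by omega) h).le
      · exact .inl (not_le.1 h)
  have h2 := hR.swap.card_filter_labels_ge hB.leP hγ.le hτ hY hY0 W T2 fun i hi hi' => by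
      simp only [hT2, mem_filter, mem_range, not_and, not_le] at hi'
      by_cases h : τ ≤ (A i).card
      · exact .inr (hi' (by omega) h).le
      · exact .inl (not_le.1 h)
  have h3 : ((P \ W).filter (c · ∈ T1)).card = ((Q \ W).filter (c · ∈ T1)).card :=
    card_filter_mem_labels_eq T1 fun i hi =>
      hW i (Nat.lt_succ_iff.1 (mem_range.1 (mem_filter.1 hi).1))
  have h4 : ((P \ W).filter (c · ∈ T2)).card = ((Q \ W).filter (c · ∈ T2)).card :=
    card_filter_mem_labels_eq T2 fun i hi =>
      hW i (Nat.lt_succ_iff.1 (mem_range.1 (mem_filter.1 hi).1))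
  rw [← h3] at h1
  rw [h4] at h2
  have h5 := hR.dense _ ((filter_subset (c · ∈ T1) _).trans (sdiff_subset (t := W))) _
    ((filter_subset (c · ∈ T2) _).trans (sdiff_subset (t := W))) (by linarith) (by linarith)
  have hcard1 : ((P \ W).filter (c · ∈ T1)).card ≤ n := hR.cardP ▸
    card_le_card ((filter_subset _ _).trans sdiff_subset)
  have hcard2 : ((Q \ W).filter (c · ∈ T2)).card ≤ n := hR.cardQ ▸
    card_le_card ((filter_subset _ _).trans sdiff_subset)
  by_contra! hcon
  have hfA : ∀ i ∈ T1, ((P \ W).filter (c · ∈ T1)).filter (c · = i) = A i := fun i hi => by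
    ext v
    simp only [hA, mem_filter]
    constructor
    · tauto
    · rintro ⟨h, rfl⟩
      tauto
  have hfB : ∀ i ∈ T2, ((Q \ W).filter (c · ∈ T2)).filter (c · = i) = B i := fun i hi => by
    ext v
    simp only [hBdef, mem_filter]
    constructor
    · tauto
    · rintro ⟨h, rfl⟩
      tauto
  have e1 := card_eq_sum_card_fiberwise (f := c) (s := (P \ W).filter (c · ∈ T1)) (t := T1)
    (fun v hv => (mem_filter.1 hv).2)
  have e2 := card_eq_sum_card_fiberwise (f := c) (s := (Q \ W).filter (c · ∈ T2)) (t := T2)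
    (fun v hv => (mem_filter.1 hv).2)
  rw [sum_congr rfl fun i hi => by rw [hfA i hi]] at e1
  rw [sum_congr rfl fun i hi => by rw [hfB i hi]] at e2
  have e3 : (eAB G ((P \ W).filter (c · ∈ T1)) ((Q \ W).filter (c · ∈ T2)) : ℝ) ≤
      γ * (((P \ W).filter (c · ∈ T1)).card * ((Q \ W).filter (c · ∈ T2)).card) := by
    rw [eAB_fiberwise_left _ _ c T1 fun v hv => (mem_filter.1 hv).2, e1, e2]
    push_cast
    rw [sum_mul_sum, mul_sum]
    refine sum_le_sum fun i hi => ?_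
    rw [hfA i hi, eAB_fiberwise_right _ _ c T2 fun v hv => (mem_filter.1 hv).2]
    push_cast
    rw [mul_sum]
    refine sum_le_sum fun j hj => ?_
    rw [hfB j hj, ← mul_assoc]
    simp only [hT1, mem_filter, mem_range, Nat.lt_succ_iff] at hi
    simp only [hT2, mem_filter, mem_range, Nat.lt_succ_iff] at hj
    exact (hcon i hi.1 j hj.1 hi.2.1 hi.2.2 hj.2.1 hj.2.2).le
  have e4 : (((P \ W).filter (c · ∈ T1)).card : ℝ) * ((Q \ W).filter (c · ∈ T2)).card
      ≤ n * n := by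
    exact_mod_cast Nat.mul_le_mul hcard1 hcard2
  have e5 : (0 : ℝ) < (n : ℝ) * n := by positivity
  nlinarith

end Insertion

section Chains

variable {α : Type*} [DecidableEq α] {G : SimpleGraph α} {P Q W W' S T Z D D' : Finset α}
  {n L M h r p i j b b' : ℕ} {a γ τ : ℝ} {c : α → ℕ}

theorem filter_sdiff_sdiff_subset (Q W D : Finset α) (p : α → Prop) [DecidablePred p] :
    (Q \ W).filter p \ (Q \ (W ∪ D)).filter p ⊆ D := by
  intro v
  simp only [mem_sdiff, mem_filter, mem_union]
  tauto

theorem degS_filter_sdiff_le (v : α) (Q W D : Finset α) (p : α → Prop) [DecidablePred p] :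
    degS G v ((Q \ W).filter p) ≤ degS G v ((Q \ (W ∪ D)).filter p) + D.card :=
  (degS_le_add_of_sdiff _ _ _).trans
    (Nat.add_le_add_left (card_le_card (filter_sdiff_sdiff_subset Q W D p)) _)

theorem card_filter_sdiff_le (Q W D : Finset α) (p : α → Prop) [DecidablePred p] :
    ((Q \ W).filter p).card ≤ ((Q \ (W ∪ D)).filter p).card + D.card := by
  have h1 := card_le_card (filter_sdiff_sdiff_subset Q W D p)
  have h2 := le_card_sdiff ((Q \ (W ∪ D)).filter p) ((Q \ W).filter p)
  omega

/-- A leftover vertex can be exchanged with a vertex of any given block. -/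
theorem Robust.exists_shift_one (hR : Robust G P Q n a) (hB : Blocks G P Q L M c) (hγ : 0 < γ)
    (hγa : γ < a) (hn : 0 < n) (hh : 0 < h) (hτ : 10 * h ≤ γ * τ) (hγ1 : γ ≤ 1) (hj : j < M)
    (hbal : ∀ i < M, i ≠ j →
      ((P \ W).filter (c · = i)).card = ((Q \ W).filter (c · = i)).card)
    (hjP : τ ≤ ((P \ W).filter (c · = j)).card) (hjQ : τ ≤ ((Q \ W).filter (c · = j)).card)
    (hne : 0 < ((P \ W).filter (c · = M)).card)
    (hsmall : W.card + 2 * (P.filter (c · = M)).card + 2 * L + γ * n + τ * (M + 1) ≤ a * n) :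
    ∃ D, Shift G P Q W h M c 1 M j (6 * h) D := by
  have hh' : (1 : ℝ) ≤ h := by exact_mod_cast hh
  have hτ0 : 0 < τ := by
    by_contra hcon
    nlinarith
  have hττ : 10 * h ≤ τ := by nlinarith
  obtain ⟨u, hu⟩ := card_pos.1 hne
  simp only [mem_filter, mem_sdiff] at hu
  obtain ⟨⟨huP, huW⟩, huM⟩ := hu
  set W₁ := W ∪ (P ∪ Q).filter (fun v => c v = M ∨ c v = j) with hW₁
  have hfil : ∀ R, R ⊆ P ∪ Q → ∀ i, (i ≠ M ∧ i ≠ j → (R \ W₁).filter (c · = i) =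
      (R \ W).filter (c · = i)) ∧ (¬ (i ≠ M ∧ i ≠ j) → (R \ W₁).filter (c · = i) = ∅) := by
    intro R hRPQ i
    refine ⟨fun hi => ?_, fun hi => ?_⟩
    · ext v
      simp only [hW₁, mem_filter, mem_sdiff, mem_union]
      constructor
      · tauto
      · rintro ⟨hv, rfl⟩
        tauto
    · rw [filter_eq_empty_iff]
      intro v hv hvi
      simp only [hW₁, mem_filter, mem_sdiff, mem_union, not_or, not_and] at hv
      have h1 := mem_union.1 (hRPQ hv.1)
      have := hv.2.2 h1
      subst hvi
      tauto
  have hPs : P ⊆ P ∪ Q := subset_union_left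
  have hQs : Q ⊆ P ∪ Q := subset_union_right
  have hW₁c : W₁.card ≤ W.card + 2 * (P.filter (c · = M)).card + 2 * L := by
    have e1 : (P ∪ Q).filter (fun v => c v = M ∨ c v = j) =
        (P.filter (c · = M) ∪ P.filter (c · = j)) ∪ (Q.filter (c · = M) ∪ Q.filter (c · = j)) := by
      rw [filter_union, filter_or, filter_or]
    have e2 := card_union_le W ((P ∪ Q).filter (fun v => c v = M ∨ c v = j))
    rw [← hW₁, e1] at e2
    have e3 := card_union_le (P.filter (c · = M) ∪ P.filter (c · = j))
      (Q.filter (c · = M) ∪ Q.filter (c · = j))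
    have e4 := card_union_le (P.filter (c · = M)) (P.filter (c · = j))
    have e5 := card_union_le (Q.filter (c · = M)) (Q.filter (c · = j))
    have e6 := hB.cardP j hj
    have e7 := hB.cardQ j hj
    have e8 := hB.card_eq (hR.cardP.trans hR.cardQ.symm) M le_rfl
    omega
  have hW₁c' : (W₁.card : ℝ) ≤ W.card + 2 * (P.filter (c · = M)).card + 2 * L := by
    exact_mod_cast hW₁c
  have hjQ0 : 0 < ((Q \ W).filter (c · = j)).card := by
    have : (0 : ℝ) < ((Q \ W).filter (c · = j)).card := by linarith
    exact_mod_cast this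
  obtain ⟨i, hi, k, hk, hi1, hi2, hk1, hk2, hik⟩ := hR.exists_link hB hγ hγa hn hτ0.le
    (X := {u}) (Y := (Q \ W).filter (c · = j)) (W := W₁) (by simpa using huP)
    ((filter_subset _ _).trans sdiff_subset) (by simp) hjQ0 (fun i hi => by
      by_cases hij : i ≠ M ∧ i ≠ j
      · rw [(hfil P hPs i).1 hij, (hfil Q hQs i).1 hij]
        exact hbal i (by omega) hij.2
      · rw [(hfil P hPs i).2 hij, (hfil Q hQs i).2 hij]) (by linarith)
  have hiM : i ≠ M ∧ i ≠ j := by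
    by_contra hcon
    rw [(hfil Q hQs i).2 hcon] at hi1
    simp at hi1
    linarith
  have hkM : k ≠ M ∧ k ≠ j := by
    by_contra hcon
    rw [(hfil P hPs k).2 hcon] at hk1
    simp at hk1
    linarith
  rw [(hfil Q hQs i).1 hiM] at hi1 hi2
  rw [(hfil P hPs k).1 hkM] at hk1 hk2
  rw [(hfil P hPs i).1 hiM, (hfil Q hQs k).1 hkM] at hik
  have hiM' : i < M := by omega
  have hkM' : k < M := by omega
  have hi3 := hbal i hiM' hiM.2
  have hk3 := hbal k hkM' hkM.2
  have hdegu : 10 * h ≤ degS G u ((Q \ W).filter (c · = i)) := by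
    have : eAB G {u} ((Q \ W).filter (c · = i)) = degS G u ((Q \ W).filter (c · = i)) := by
      simp [eAB]
    rw [this] at hi2
    simp only [card_singleton, Nat.cast_one, mul_one] at hi2
    have : (10 : ℝ) * h ≤ degS G u ((Q \ W).filter (c · = i)) := by nlinarith
    exact_mod_cast this
  have hi1' : 10 * h ≤ ((P \ W).filter (c · = i)).card := by
    rw [← hi3] at hi1
    have : (10 : ℝ) * h ≤ ((P \ W).filter (c · = i)).card := by linarith
    exact_mod_cast this
  have hk1' : 10 * h ≤ ((P \ W).filter (c · = k)).card := by
    have : (10 : ℝ) * h ≤ ((P \ W).filter (c · = k)).card := by linarith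
    exact_mod_cast this
  have hj1' : 10 * h ≤ ((P \ W).filter (c · = j)).card := by
    have : (10 : ℝ) * h ≤ ((P \ W).filter (c · = j)).card := by linarith
    exact_mod_cast this
  obtain ⟨y, hy, hdegy⟩ := exists_le_degS_of_le_eAB (G := G) (S := (P \ W).filter (c · = k))
    (T := (Q \ W).filter (c · = j)) (x := γ * ((Q \ W).filter (c · = j)).card) (by omega)
    (by rwa [eAB_comm])
  have hdegy' : 10 * h ≤ degS G y ((Q \ W).filter (c · = j)) := by
    have : (10 : ℝ) * h ≤ degS G y ((Q \ W).filter (c · = j)) := by nlinarith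
    exact_mod_cast this
  simp only [mem_filter, mem_sdiff] at hy
  obtain ⟨⟨hyP, hyW⟩, hyk⟩ := hy
  by_cases hik' : i = k
  · subst hik'
    obtain ⟨D₁, hD₁, hZ₁⟩ := hB.exists_shift hR.disj hiM' hh huP huW (Z := {y})
      (by simp only [mem_singleton]; rintro rfl; omega) (by simp; omega) (by simp; omega)
    rw [huM] at hD₁
    have hc := hD₁.card
    have h1 := degS_filter_sdiff_le (G := G) y Q W D₁ (c · = j)
    have h2 := card_filter_sdiff_le P W D₁ (c · = j)
    obtain ⟨D₂, hD₂, -⟩ := hB.exists_shift (Z := ∅) (W := W ∪ D₁) hR.disj hj hh hyP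
      (by simpa [hyW] using hZ₁) (by simp) (by rw [card_empty]; omega) (by rw [card_empty]; omega)
    rw [hyk] at hD₂
    have := hD₁.trans hD₂
    exact ⟨_, this.tiled, this.disj, by have := this.card; omega, this.bal⟩
  · obtain ⟨x, hx, hdegx⟩ := exists_le_degS_of_le_eAB (G := G) (S := (P \ W).filter (c · = i))
      (T := (Q \ W).filter (c · = k)) (x := γ * ((Q \ W).filter (c · = k)).card) (by omega)
      (by linarith)
    have hdegx' : 10 * h ≤ degS G x ((Q \ W).filter (c · = k)) := by
      rw [hk3] at hk1
      have : (10 : ℝ) * h ≤ degS G x ((Q \ W).filter (c · = k)) := by nlinarith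
      exact_mod_cast this
    simp only [mem_filter, mem_sdiff] at hx
    obtain ⟨⟨hxP, hxW⟩, hxi⟩ := hx
    have hxy : x ≠ y := by
      rintro rfl
      omega
    obtain ⟨D₁, hD₁, hZ₁⟩ := hB.exists_shift hR.disj hiM' hh huP huW (Z := {x, y})
      (by
        simp only [mem_insert, mem_singleton]
        rintro (rfl | rfl) <;> omega)
      (by rw [card_pair hxy]; omega) (by rw [card_pair hxy]; omega)
    rw [huM] at hD₁
    have hc := hD₁.card
    simp only [disjoint_insert_left, disjoint_singleton_left] at hZ₁
    have h1 := degS_filter_sdiff_le (G := G) x Q W D₁ (c · = k)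
    have h2 := card_filter_sdiff_le P W D₁ (c · = k)
    obtain ⟨D₂, hD₂, hZ₂⟩ := hB.exists_shift (Z := {y}) (W := W ∪ D₁) hR.disj hkM' hh hxP
      (by simp [hxW, hZ₁.1]) (by simpa using hxy) (by rw [card_singleton]; omega)
      (by rw [card_singleton]; omega)
    rw [hxi] at hD₂
    have h12 := hD₁.trans hD₂
    have hc := h12.card
    have h1 := degS_filter_sdiff_le (G := G) y Q W (D₁ ∪ D₂) (c · = j)
    have h2 := card_filter_sdiff_le P W (D₁ ∪ D₂) (c · = j)
    obtain ⟨D₃, hD₃, -⟩ := hB.exists_shift (Z := ∅) (W := W ∪ (D₁ ∪ D₂)) hR.disj hj hh hyP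
      (by
        simp only [mem_union, not_or]
        exact ⟨hyW, hZ₁.2, by simpa using hZ₂⟩) (by simp)
          (by rw [card_empty]; omega) (by rw [card_empty]; omega)
    rw [hyk] at hD₃
    have := h12.trans hD₃
    exact ⟨_, this.tiled, this.disj, by have := this.card; omega, this.bal⟩

end Chains

section Groups

variable {α : Type*} [DecidableEq α] {G : SimpleGraph α} {P Q W W' S T Z D D' : Finset α}
  {n L M h r p i j b b' : ℕ} {a γ τ : ℝ} {c : α → ℕ}

theorem Robust.exists_shift_many (hR : Robust G P Q n a) (hB : Blocks G P Q L M c) (hγ : 0 < γ)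
    (hγa : γ < a) (hn : 0 < n) (hh : 0 < h) (hτ : 10 * h ≤ γ * τ) (hγ1 : γ ≤ 1) (hj : j < M)
    (hbal : ∀ i < M, i ≠ j → cnt c (W ∩ P) i = cnt c (W ∩ Q) i) (r : ℕ)
    (hjP : τ + 6 * h * r ≤ ((P \ W).filter (c · = j)).card)
    (hjQ : τ + 6 * h * r ≤ ((Q \ W).filter (c · = j)).card)
    (hne : r + cnt c (W ∩ P) M ≤ (P.filter (c · = M)).card)
    (hsmall : W.card + 6 * h * r + 2 * (P.filter (c · = M)).card + 2 * L + γ * n + τ * (M + 1) ≤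
      a * n) :
    ∃ D, Shift G P Q W h M c r M j (6 * h * r) D := by
  induction r with
  | zero =>
    exact ⟨∅, .nil, disjoint_empty_right _, by simp, fun _ => 0, rfl, by simp⟩
  | succ r ih =>
    push_cast at hjP hjQ hsmall
    have hh' : (0 : ℝ) < h := by exact_mod_cast hh
    obtain ⟨D, hD⟩ := ih (by linarith) (by linarith) (by omega) (by linarith)
    have hDc : (D.card : ℝ) ≤ 6 * h * r := by exact_mod_cast hD.card
    have hWD : ((W ∪ D).card : ℝ) ≤ W.card + D.card := by exact_mod_cast card_union_le W D
    obtain ⟨f, hfM, hf⟩ := hD.bal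
    obtain ⟨D', hD'⟩ := hR.exists_shift_one (W := W ∪ D) hB hγ hγa hn hh hτ hγ1 hj
      (fun i hi hij => by
        have h1 := card_filter_sdiff_add_cnt (P := P) (W := W ∪ D) (c := c) i
        have h2 := card_filter_sdiff_add_cnt (P := Q) (W := W ∪ D) (c := c) i
        rw [cnt_union_inter hD.disj] at h1 h2
        have h3 := hbal i hi hij
        have h4 := hf i
        rw [hB.cardP i hi] at h1
        rw [hB.cardQ i hi] at h2
        rw [if_neg hij, if_neg hi.ne] at h4
        omega)
      (by
        have h1 := card_filter_sdiff_le P W D (c · = j)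
        have h2 : (((P \ W).filter (c · = j)).card : ℝ) ≤
          ((P \ (W ∪ D)).filter (c · = j)).card + D.card := by exact_mod_cast h1
        linarith)
      (by
        have h1 := card_filter_sdiff_le Q W D (c · = j)
        have h2 : (((Q \ W).filter (c · = j)).card : ℝ) ≤
          ((Q \ (W ∪ D)).filter (c · = j)).card + D.card := by exact_mod_cast h1
        linarith)
      (by
        have h1 := card_filter_sdiff_add_cnt (P := P) (W := W ∪ D) (c := c) M
        rw [cnt_union_inter hD.disj] at h1
        have h4 := (hf M).2
        rw [if_neg hj.ne', if_pos rfl, hfM] at h4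
        omega)
      (by linarith)
    have := hD.add hD'
    exact ⟨_, this.tiled, this.disj, this.card.trans (by linarith), this.bal⟩

theorem Robust.exists_group (hR : Robust G P Q n a) (hB : Blocks G P Q L M c) (hγ : 0 < γ)
    (hγa : γ < a) (ha : a < 1) (hn : 0 < n) (hh : 0 < h) (hτ : 10 * h ≤ γ * τ)
    (hbal : ∀ i, cnt c (W ∩ P) i = cnt c (W ∩ Q) i)
    (hne : h + cnt c (W ∩ P) M ≤ (P.filter (c · = M)).card)
    (hsmall : W.card + 12 * h ^ 2 + 2 * (P.filter (c · = M)).card + 2 * L + γ * n +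
      (τ + 12 * h ^ 2) * (M + 1) ≤ a * n) :
    ∃ D, Tiled G P Q h h D ∧ Disjoint W D ∧ D.card ≤ 12 * h ^ 2 ∧
      (∀ i, cnt c (D ∩ P) i = cnt c (D ∩ Q) i) ∧ (∀ i, h ∣ cnt c (D ∩ P) i) ∧
      cnt c (D ∩ P) M = h := by
  have hn' : (0 : ℝ) < n := by exact_mod_cast hn
  have hh' : (1 : ℝ) ≤ h := by exact_mod_cast hh
  have hτ0 : 0 < τ := by
    by_contra hcon
    nlinarith
  have hcards : ∀ i < M, ((P \ W).filter (c · = i)).card = ((Q \ W).filter (c · = i)).card := by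
    intro i hi
    have h1 := card_filter_sdiff_add_cnt (P := P) (W := W) (c := c) i
    have h2 := card_filter_sdiff_add_cnt (P := Q) (W := W) (c := c) i
    have h3 := hbal i
    have h4 := hB.cardP i hi
    have h5 := hB.cardQ i hi
    omega
  obtain ⟨j, hj, hjP⟩ : ∃ j < M, τ + 12 * h ^ 2 ≤ ((P \ W).filter (c · = j)).card := by
    by_contra! hcon
    have h1 : (P \ W).card = ∑ i ∈ range (M + 1), ((P \ W).filter (c · = i)).card :=
      card_eq_sum_card_fiberwise fun v hv => by
        simpa [Nat.lt_succ_iff] using hB.leP v (mem_sdiff.1 hv).1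
    have h2 : P.card ≤ (P \ W).card + W.card := by
      have := le_card_sdiff W P
      omega
    have h3 : ((P \ W).filter (c · = M)).card ≤ (P.filter (c · = M)).card :=
      card_le_card (filter_subset_filter _ sdiff_subset)
    rw [sum_range_succ] at h1
    have h4 : (n : ℝ) ≤ ∑ i ∈ range M, (((P \ W).filter (c · = i)).card : ℝ) +
        (P.filter (c · = M)).card + W.card := by
      rw [← hR.cardP]
      exact_mod_cast (by omega)
    have h5 : ∑ i ∈ range M, (((P \ W).filter (c · = i)).card : ℝ) ≤ M * (τ + 12 * h ^ 2) := by
      have := sum_le_card_nsmul (range M) (fun i => (((P \ W).filter (c · = i)).card : ℝ))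
        (τ + 12 * h ^ 2) fun i hi => (hcon i (mem_range.1 hi)).le
      rwa [card_range, nsmul_eq_mul] at this
    have h6 : 0 ≤ γ * n := by positivity
    have h7 : (0 : ℝ) ≤ (P.filter (c · = M)).card := by positivity
    have h8 : (0 : ℝ) ≤ (L : ℝ) := by positivity
    nlinarith
  have hjQ := hjP
  rw [hcards j hj] at hjQ
  have hMh : 0 ≤ 12 * (h : ℝ) ^ 2 * (M + 1) := by positivity
  obtain ⟨D, hD⟩ := hR.exists_shift_many hB hγ hγa hn hh hτ (by linarith) hj
    (fun i _ _ => hbal i) h (by nlinarith) (by nlinarith) hne (by nlinarith)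
  have hDc : (D.card : ℝ) ≤ 6 * h * h := by exact_mod_cast hD.card
  have hWD : ((W ∪ D).card : ℝ) ≤ W.card + D.card := by exact_mod_cast card_union_le W D
  obtain ⟨f, hfM, hf⟩ := hD.bal
  have e1 := hB.card_eq (hR.cardP.trans hR.cardQ.symm) M le_rfl
  obtain ⟨D', hD'⟩ := hR.swap.exists_shift_many (W := W ∪ D) hB.swap hγ hγa hn hh hτ (by linarith)
    hj (fun i hi hij => by
      rw [cnt_union_inter hD.disj, cnt_union_inter hD.disj, hbal]
      have := hf i
      rw [if_neg hij, if_neg hi.ne] at this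
      omega) h
    (by
      have h1 := card_filter_sdiff_le Q W D (c · = j)
      have h2 : (((Q \ W).filter (c · = j)).card : ℝ) ≤
        ((Q \ (W ∪ D)).filter (c · = j)).card + D.card := by exact_mod_cast h1
      nlinarith)
    (by
      have h1 := card_filter_sdiff_le P W D (c · = j)
      have h2 : (((P \ W).filter (c · = j)).card : ℝ) ≤
        ((P \ (W ∪ D)).filter (c · = j)).card + D.card := by exact_mod_cast h1
      nlinarith)
    (by
      rw [cnt_union_inter hD.disj, ← e1, ← hbal, (hf M).1, hfM]
      omega)
    (by
      rw [← e1]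
      nlinarith)
  obtain ⟨g, hgM, hg⟩ := hD'.bal
  obtain ⟨hWD', hDD'⟩ := disjoint_union_left.1 hD'.disj
  refine ⟨D ∪ D', hD.tiled.union hD'.tiled.swap hDD', disjoint_union_right.2 ⟨hD.disj, hWD'⟩,
    (card_union_le _ _).trans (by nlinarith [hD.card, hD'.card]), fun i => ?_, fun i => ?_, ?_⟩
  · rw [cnt_union_inter hDD', cnt_union_inter hDD']
    have := hf i
    have := hg i
    omega
  · rw [cnt_union_inter hDD']
    have h1 := hf i
    have h2 := hg i
    have h3 : h ∣ cnt c (D ∩ P) i := by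
      have h4 : h ∣ cnt c (D ∩ P) i + if i = j then h else 0 := by
        rw [h1.2]
        exact dvd_add (dvd_mul_right _ _) (by split_ifs <;> simp)
      exact (Nat.dvd_add_left (by split_ifs <;> simp)).1 h4
    rw [h2.1]
    exact dvd_add h3 (dvd_mul_right _ _)
  · rw [cnt_union_inter hDD']
    have h1 := (hf M).2
    have h2 := (hg M).1
    rw [if_neg hj.ne', if_pos rfl, hfM] at h1
    rw [hgM] at h2
    omega

theorem Robust.exists_groups (hR : Robust G P Q n a) (hB : Blocks G P Q L M c) (hγ : 0 < γ)
    (hγa : γ < a) (ha : a < 1) (hn : 0 < n) (hh : 0 < h) (hτ : 10 * h ≤ γ * τ) (N : ℕ)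
    (hne : h * N ≤ (P.filter (c · = M)).card)
    (hsmall : 12 * h ^ 2 * N + 12 * h ^ 2 + 2 * (P.filter (c · = M)).card + 2 * L + γ * n +
      (τ + 12 * h ^ 2) * (M + 1) ≤ a * n) :
    ∃ W, Tiled G P Q h h W ∧ W.card ≤ 12 * h ^ 2 * N ∧
      (∀ i, cnt c (W ∩ P) i = cnt c (W ∩ Q) i) ∧ (∀ i, h ∣ cnt c (W ∩ P) i) ∧
      cnt c (W ∩ P) M = h * N := by
  induction N with
  | zero => exact ⟨∅, .nil, by simp, by simp, by simp, by simp⟩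
  | succ N ih =>
    push_cast at hsmall
    have hh' : 0 ≤ (h : ℝ) ^ 2 := by positivity
    obtain ⟨W, hW, hWc, hWe, hWd, hWM⟩ := ih (by nlinarith) (by linarith)
    have hWc' : (W.card : ℝ) ≤ 12 * h ^ 2 * N := by exact_mod_cast hWc
    obtain ⟨D, hD, hWD, hDc, hDe, hDd, hDM⟩ := hR.exists_group hB hγ hγa ha hn hh hτ hWe
      (by rw [hWM]; nlinarith) (by linarith)
    refine ⟨W ∪ D, hW.union hD hWD, ?_, fun i => ?_, fun i => ?_, ?_⟩
    · have := card_union_le W D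
      linarith
    · rw [cnt_union_inter hWD, cnt_union_inter hWD, hWe, hDe]
    · rw [cnt_union_inter hWD]
      exact dvd_add (hWd i) (hDd i)
    · rw [cnt_union_inter hWD, hWM, hDM]
      ring

end Groups

/-- Large robust graphs can be tiled with `K_{h,h}` when the parts are divisible by `h`. -/
theorem Robust.exists_tiled {a : ℝ} (ha0 : 0 < a) (ha : a < 1) {h : ℕ} (hh : 0 < h) :
    ∃ n₀ : ℕ, ∀ n, n₀ ≤ n → h ∣ n → ∀ (α : Type) [DecidableEq α] (G : SimpleGraph α)
      (P Q : Finset α), Robust G P Q n a → Tiled G P Q h h (P ∪ Q) := by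
  have hh' : (1 : ℝ) ≤ h := by exact_mod_cast hh
  obtain ⟨q, hq⟩ := exists_nat_ge (640 * h / a ^ 2 + 100 * h ^ 2 / a + 1)
  set L := h * q with hL
  have hq1 : 640 * h / a ^ 2 ≤ q ∧ 100 * h ^ 2 / a ≤ q ∧ (1 : ℝ) ≤ q := by
    have : 0 ≤ 640 * h / a ^ 2 := by positivity
    have : 0 ≤ 100 * h ^ 2 / a := by positivity
    refine ⟨by linarith, by linarith, by linarith⟩
  obtain ⟨hq1, hq2, hq3⟩ := hq1
  rw [div_le_iff₀ (by positivity)] at hq1 hq2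
  have hLr : (L : ℝ) = h * q := by
    rw [hL]
    push_cast
    rfl
  have hLq : (q : ℝ) ≤ L := by nlinarith
  obtain ⟨n₁, hn₁⟩ := exists_almost_cover ha0 (ε := a / (56 * h)) (by positivity) L
    (Nat.mul_pos hh (by exact_mod_cast hq3))
  obtain ⟨n₂, hn₂⟩ := exists_nat_ge ((4 * (24 * h ^ 2 + 3 * L)) / a)
  refine ⟨max n₁ (max n₂ 1), fun n hn hdvd α _ G P Q hR => ?_⟩
  simp only [max_le_iff] at hn
  obtain ⟨hn1, hn2, hn3⟩ := hn
  have hn2' : (n₂ : ℝ) ≤ n := by exact_mod_cast hn2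
  have hn0 : (0 : ℝ) < n := by exact_mod_cast hn3
  obtain ⟨W₁, hW₁, hc₁⟩ := hn₁ n hn1 α G P Q hR
  obtain ⟨M, c, hB, hcM⟩ := hW₁.exists_blocks hR.disj
  have hML := hB.mul_le
  rw [hR.cardP] at hML
  have hPM : ((P.filter (c · = M)).card : ℝ) * (56 * h) ≤ a * n := by
    have e : W₁ ∩ P ⊆ P.filter (¬ c · = M) := by
      intro v hv
      rw [mem_inter] at hv
      have := (hcM v (mem_union_left _ hv.2)).2 hv.1
      exact mem_filter.2 ⟨hv.2, by omega⟩
    have e1 := card_le_card e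
    have e2 := card_filter_add_card_filter_not (s := P) (fun v => c v = M)
    rw [hR.cardP] at e2
    have e3 : ((W₁ ∩ P).card : ℝ) + (P.filter (c · = M)).card ≤ n := by
      exact_mod_cast (by omega)
    have e4 : ((P.filter (c · = M)).card : ℝ) ≤ a / (56 * h) * n := by linarith
    calc _ ≤ a / (56 * h) * n * (56 * h) := by gcongr
      _ = _ := by field_simp
  obtain ⟨N, hN⟩ : h ∣ (P.filter (c · = M)).card := by
    have e : h ∣ M * L := Dvd.dvd.mul_left (dvd_mul_right _ _) _
    exact (Nat.dvd_add_right e).1 (by rw [hML]; exact hdvd)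
  have hN' : ((P.filter (c · = M)).card : ℝ) = h * N := by exact_mod_cast hN
  have hML' : (M : ℝ) * L ≤ n := by exact_mod_cast (by omega)
  have hM2 : 12 * (h : ℝ) ^ 2 * M ≤ 12 / 100 * (a * n) := by
    have e1 : 100 * (h : ℝ) ^ 2 * M ≤ L * a * M := by
      have : 100 * (h : ℝ) ^ 2 ≤ L * a := by nlinarith
      exact mul_le_mul_of_nonneg_right this (by positivity)
    have e2 := mul_le_mul_of_nonneg_left hML' ha0.le
    linarith
  have hM3 : a / 8 * L * M ≤ a / 8 * n := by
    have := mul_le_mul_of_nonneg_left hML' (by positivity : 0 ≤ a / 8)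
    linarith
  have hlarge : 4 * (24 * (h : ℝ) ^ 2 + 3 * L) ≤ a * n := by
    rw [div_le_iff₀ ha0] at hn₂
    nlinarith
  have haL : a * L ≤ 1 * L := mul_le_mul_of_nonneg_right ha.le (by positivity)
  have hPM2 : (P.filter (c · = M)).card * 56 ≤ a * n := by
    refine le_trans ?_ hPM
    have : (0 : ℝ) ≤ (P.filter (c · = M)).card := by positivity
    nlinarith
  obtain ⟨W, hW, hWc, hWe, hWd, hWM⟩ := hR.exists_groups hB (γ := a / 8) (τ := a / 8 * L)
    (by positivity) (by linarith) ha hn3 hh (by nlinarith) N hN.ge (by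
      have e1 : 12 * (h : ℝ) ^ 2 * N ≤ 12 / 56 * (a * n) := by
        rw [hN'] at hPM
        nlinarith
      nlinarith)
  have := Blocks.tiled_residual hR.disj hB (dvd_mul_right h q) hW fun i _ => ⟨hWe i, hWd i⟩
  convert this using 1
  refine (union_subset_iff.2 ⟨?_, ?_⟩).antisymm (union_subset hW.subset (filter_subset _ _))
  · intro v hv
    rcases (hB.leP v hv).lt_or_eq with h1 | h1
    · simp [hv, h1]
    · have h2 := card_filter_sdiff_add_cnt (P := P) (W := W) (c := c) M
      rw [hWM, hN] at h2
      have h3 : (P \ W).filter (c · = M) = ∅ := card_eq_zero.1 (by omega)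
      by_contra hcon
      have : v ∈ (P \ W).filter (c · = M) := by
        simp only [mem_filter, mem_sdiff]
        exact ⟨⟨hv, fun h => hcon (mem_union_left _ h)⟩, h1⟩
      rw [h3] at this
      exact notMem_empty _ this
  · intro v hv
    rcases (hB.leQ v hv).lt_or_eq with h1 | h1
    · simp [hv, h1]
    · have h2 := card_filter_sdiff_add_cnt (P := Q) (W := W) (c := c) M
      rw [← hWe, hWM, ← hB.card_eq (hR.cardP.trans hR.cardQ.symm) M le_rfl, hN] at h2
      have h3 : (Q \ W).filter (c · = M) = ∅ := card_eq_zero.1 (by omega)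
      by_contra hcon
      have : v ∈ (Q \ W).filter (c · = M) := by
        simp only [mem_filter, mem_sdiff]
        exact ⟨⟨hv, fun h => hcon (mem_union_left _ h)⟩, h1⟩
      rw [h3] at this
      exact notMem_empty _ this

section

variable {α : Type*} [DecidableEq α] {G : SimpleGraph α} {X Y C D : Finset α} {e d : ℕ}

/-- The bipartite graph between `X` and `Y` is nearly complete: up to few exceptional vertices, `X`
is `C` and `Y` is `D`, the vertices of `C` and `D` miss at most `e` vertices of the opposite core,
and every vertex has at least `d` neighbours in the opposite core. -/
structure NearComplete (G : SimpleGraph α) (X Y C D : Finset α) (e d : ℕ) : Prop where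
  disj : Disjoint X Y
  subX : C ⊆ X
  subY : D ⊆ Y
  missX : ∀ u ∈ C, D.card ≤ degS G u D + e
  missY : ∀ v ∈ D, C.card ≤ degS G v C + e
  degX : ∀ u ∈ X, d ≤ degS G u D
  degY : ∀ v ∈ Y, d ≤ degS G v C

namespace NearComplete

theorem swap (h : NearComplete G X Y C D e d) : NearComplete G Y X D C e d :=
  ⟨h.disj.symm, h.subY, h.subX, h.missY, h.missX, h.degY, h.degX⟩

end NearComplete

theorem card_le_degS_add_of_subset {v : α} {S T : Finset α} (h : T ⊆ S)
    (hS : S.card ≤ degS G v S + e) : T.card ≤ degS G v T + e := by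
  have h1 := degS_add_card_nonadj (G := G) v S
  have h2 := degS_add_card_nonadj (G := G) v T
  have h3 := card_le_card (filter_subset_filter (fun w => ¬ G.Adj v w) h)
  omega

/-- A set of vertices each missing at most `e` vertices of `C` has many common neighbours in `C`. -/
theorem exists_common_nbrs {T C Z : Finset α} {r : ℕ}
    (hT : ∀ v ∈ T, C.card ≤ degS G v C + e) (hr : r + Z.card + T.card * e ≤ C.card) :
    ∃ S ⊆ C, S.card = r ∧ Disjoint S Z ∧ ∀ u ∈ S, ∀ v ∈ T, G.Adj u v := by
  obtain ⟨S, hS, hSc, hSd⟩ := exists_subset_card_eq_sdiff (S := C) (k := r)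
    (Z := Z ∪ T.biUnion fun v => C.filter fun w => ¬ G.Adj v w) (by
      have h1 : (T.biUnion fun v => C.filter fun w => ¬ G.Adj v w).card ≤ T.card * e :=
        card_biUnion_le_card_mul _ _ _ fun v hv => by
          have h2 := degS_add_card_nonadj (G := G) v C
          have h3 := hT v hv
          omega
      have h2 := card_union_le Z (T.biUnion fun v => C.filter fun w => ¬ G.Adj v w)
      omega)
  rw [disjoint_union_right] at hSd
  refine ⟨S, hS, hSc, hSd.1, fun u hu v hv => ?_⟩
  by_contra hcon
  refine disjoint_left.1 hSd.2 hu (mem_biUnion.2 ⟨v, hv, mem_filter.2 ⟨hS hu, ?_⟩⟩)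
  exact fun h => hcon h.symm

namespace NearComplete

theorem sdiff (h : NearComplete G X Y C D e d) {S T : Finset α} {k : ℕ} (hS : S.card ≤ k)
    (hT : T.card ≤ k) : NearComplete G (X \ S) (Y \ T) (C \ S) (D \ T) e (d - k) where
  disj := disjoint_of_subset_left sdiff_subset (disjoint_of_subset_right sdiff_subset h.disj)
  subX := sdiff_subset_sdiff h.subX Subset.rfl
  subY := sdiff_subset_sdiff h.subY Subset.rfl
  missX u hu := card_le_degS_add_of_subset sdiff_subset (h.missX u (sdiff_subset hu))
  missY u hu := card_le_degS_add_of_subset sdiff_subset (h.missY u (sdiff_subset hu))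
  degX u hu := by
    have h1 := h.degX u (sdiff_subset hu)
    have h2 := degS_le_add_of_sdiff (G := G) u D (D \ T)
    have h3 : (D \ (D \ T)).card ≤ T.card := card_le_card (by simp)
    omega
  degY u hu := by
    have h1 := h.degY u (sdiff_subset hu)
    have h2 := degS_le_add_of_sdiff (G := G) u C (C \ S)
    have h3 : (C \ (C \ S)).card ≤ S.card := card_le_card (by simp)
    omega

/-- Any vertex lies in a balanced complete bipartite graph using only core vertices otherwise. -/
theorem exists_complete_mem (h : NearComplete G X Y C D e d) {u : α} {r : ℕ} (hu : u ∈ X)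
    (hr : 0 < r) (hd : r ≤ d) (hC : r * (e + 1) ≤ C.card) :
    ∃ S ⊆ X, ∃ T ⊆ D, u ∈ S ∧ S.card = r ∧ T.card = r ∧ ∀ u ∈ S, ∀ v ∈ T, G.Adj u v := by
  obtain ⟨T, hT, hTc⟩ := exists_subset_card_eq (hd.trans (h.degX u hu))
  obtain ⟨S, hS, hSc, hSu, hST⟩ := exists_common_nbrs (G := G) (T := T) (C := C) (Z := {u}) (e := e)
    (r := r - 1) (fun v hv => h.missY v (mem_filter.1 (hT hv)).1) (by
      rw [card_singleton, hTc]
      rw [mul_add] at hC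
      omega)
  refine ⟨insert u S, insert_subset hu (hS.trans h.subX), T, hT.trans (filter_subset _ _),
    mem_insert_self _ _, ?_, hTc, ?_⟩
  · rw [card_insert_of_notMem (disjoint_singleton_right.1 hSu)]
    omega
  · intro w hw v hv
    rcases mem_insert.1 hw with rfl | hw
    · exact (mem_filter.1 (hT hv)).2
    · exact hST w hw v hv

end NearComplete

theorem card_sdiff_of_card_eq {S X : Finset α} {a b : ℕ} (h : S ⊆ X) (hX : X.card = a + b)
    (hS : S.card = a) : (X \ S).card = b := by
  have := card_sdiff_add_card_eq_card h
  omega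

theorem Tiled.of_sdiff {S T : Finset α} {s t : ℕ} (hd : Disjoint X Y) (hS : S ⊆ X) (hT : T ⊆ Y)
    (hc : S.card = s ∧ T.card = t ∨ S.card = t ∧ T.card = s)
    (ha : ∀ u ∈ S, ∀ v ∈ T, G.Adj u v)
    (h : Tiled G (X \ S) (Y \ T) s t ((X \ S) ∪ (Y \ T))) : Tiled G X Y s t (X ∪ Y) := by
  have h1 := (h.mono (sdiff_subset (s := X)) (sdiff_subset (s := Y))).union
    (Tiled.single hS hT hc ha) (by
      rw [disjoint_left] at *
      grind)
  convert h1 using 1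
  ext v
  have := @hS v
  have := @hT v
  simp only [mem_union, mem_sdiff]
  tauto

/-- A balanced nearly complete bipartite graph is robust. -/
theorem NearComplete.robust (h : NearComplete G X Y X Y e d) {n : ℕ} (hX : X.card = n)
    (hY : Y.card = n) (he : 10 * e ≤ n) : Robust G X Y n (1 / 10) where
  disj := h.disj
  cardP := hX
  cardQ := hY
  degP u hu := by
    have := h.missX u hu
    omega
  degQ u hu := by
    have := h.missY u hu
    omega
  dense S hS T hT hSc hTc := by
    have h1 : S.card * T.card ≤ eAB G S T + S.card * e := by
      unfold eAB
      calc S.card * T.card = ∑ _u ∈ S, T.card := by simp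
        _ ≤ ∑ u ∈ S, (degS G u T + e) :=
          sum_le_sum fun u hu => card_le_degS_add_of_subset hT (h.missX u (hS hu))
        _ = _ := by rw [sum_add_distrib, sum_const, smul_eq_mul]
    have h2 : (S.card : ℝ) * T.card ≤ eAB G S T + S.card * e := by exact_mod_cast h1
    have h3 : 10 * (e : ℝ) ≤ n := by exact_mod_cast he
    have h4 : (0 : ℝ) ≤ n := by positivity
    nlinarith [mul_le_mul hSc (by linarith : (3 / 10 : ℝ) * n ≤ T.card - e) (by positivity)
      (by positivity)]

theorem exists_tiled_of_nearComplete_of_card_eq {h : ℕ} (hh : 0 < h) :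
    ∃ N₀ : ℕ, ∀ K M : ℕ, N₀ ≤ M → ∀ (α : Type) [DecidableEq α] (G : SimpleGraph α)
      (X Y C D : Finset α) (e d q : ℕ), NearComplete G X Y C D e d →
      (X \ C).card + (Y \ D).card ≤ K → h * K ≤ d → 10 * h * (e + 1) ≤ M →
      M + h * K ≤ C.card → M + h * K ≤ D.card → X.card = h * q → Y.card = h * q →
      Tiled G X Y h h (X ∪ Y) := by
  obtain ⟨N₀, hN₀⟩ := Robust.exists_tiled (a := 1 / 10) (by norm_num) (by norm_num) hh
  refine ⟨N₀, fun K M hM => ?_⟩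
  induction K with
  | zero =>
    intro α _ G X Y C D e d q hN hK hd he hC hD hX hY
    have h1 : X = C := (sdiff_eq_empty_iff_subset.1 (card_eq_zero.1 (by omega))).antisymm hN.subX
    have h2 : Y = D := (sdiff_eq_empty_iff_subset.1 (card_eq_zero.1 (by omega))).antisymm hN.subY
    subst h1 h2
    refine hN₀ (h * q) (by omega) (dvd_mul_right _ _) α G X Y (hN.robust hX hY ?_)
    nlinarith
  | succ K ih =>
    have key : ∀ (α : Type) [DecidableEq α] (G : SimpleGraph α)
      (X Y C D : Finset α) (e d q : ℕ), NearComplete G X Y C D e d →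
      (X \ C).card + (Y \ D).card ≤ K + 1 → h * (K + 1) ≤ d → 10 * h * (e + 1) ≤ M →
      M + h * (K + 1) ≤ C.card → M + h * (K + 1) ≤ D.card → X.card = h * q → Y.card = h * q →
      (X \ C).Nonempty → Tiled G X Y h h (X ∪ Y) := by
      intro α _ G X Y C D e d q hN hK hd he hC hD hX hY ⟨u, hu⟩
      rw [mem_sdiff] at hu
      obtain ⟨S, hS, T, hT, huS, hSc, hTc, hST⟩ := hN.exists_complete_mem hu.1 hh
        (by nlinarith) (by nlinarith)
      refine Tiled.of_sdiff hN.disj hS (hT.trans hN.subY) (Or.inl ⟨hSc, hTc⟩) hST ?_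
      have hq : q ≠ 0 := by
        rintro rfl
        have := card_le_card hS
        omega
      obtain ⟨q, rfl⟩ := Nat.exists_eq_succ_of_ne_zero hq
      have e1 := le_card_sdiff S C
      have e2 := le_card_sdiff T D
      have e3 : ((X \ S) \ (C \ S)).card < (X \ C).card := by
        refine card_lt_card ((ssubset_iff_of_subset ?_).2 ⟨u, mem_sdiff.2 hu, by simp [huS]⟩)
        intro v
        simp only [mem_sdiff]
        tauto
      have e4 : ((Y \ T) \ (D \ T)).card ≤ (Y \ D).card := by
        refine card_le_card ?_
        intro v
        simp only [mem_sdiff]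
        tauto
      have e5 : h * (K + 1) = h * K + h := by ring
      refine ih α G _ _ _ _ e (d - h) q (hN.sdiff hSc.le hTc.le) ?_ ?_ he ?_ ?_
        (card_sdiff_of_card_eq hS (by rw [hX, Nat.succ_eq_add_one]; ring) hSc)
        (card_sdiff_of_card_eq (hT.trans hN.subY) (by rw [hY, Nat.succ_eq_add_one]; ring) hTc)
      all_goals omega
    intro α _ G X Y C D e d q hN hK hd he hC hD hX hY
    rcases (X \ C).eq_empty_or_nonempty with h1 | h1
    · rcases (Y \ D).eq_empty_or_nonempty with h2 | h2
      · have e5 : h * (K + 1) = h * K + h := by ring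
        refine ih α G X Y C D e d q hN (by rw [h1, h2, card_empty]; omega) ?_ he ?_ ?_ hX hY
        all_goals omega
      · rw [union_comm]
        exact (key α G Y X D C e d q hN.swap (by omega) hd he hD hC hY hX h2).swap
    · exact key α G X Y C D e d q hN hK hd he hC hD hX hY h1

theorem exists_tiled_of_nearComplete_of_card_add_eq {s t : ℕ} (hs : 0 < s) :
    ∃ N₀ : ℕ, ∀ r K M : ℕ, N₀ ≤ M → ∀ (α : Type) [DecidableEq α] (G : SimpleGraph α)
      (X Y C D : Finset α) (e d q : ℕ), NearComplete G X Y C D e d →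
      (X \ C).card + (Y \ D).card ≤ K → (s + t) * (K + r) ≤ d → 10 * (s + t) * (e + 1) ≤ M →
      M + (s + t) * (K + r) ≤ C.card → M + (s + t) * (K + r) ≤ D.card →
      X.card = r * s + (s + t) * q → Y.card = r * t + (s + t) * q →
      Tiled G X Y s t (X ∪ Y) := by
  obtain ⟨N₀, hN₀⟩ := exists_tiled_of_nearComplete_of_card_eq (h := s + t) (by omega)
  refine ⟨N₀, fun r K M hM => ?_⟩
  induction r with
  | zero =>
    intro α _ G X Y C D e d q hN hK hd he hC hD hX hY
    exact (hN₀ K M hM α G X Y C D e d q hN hK hd he hC hD (by omega) (by omega)).split hN.disj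
  | succ r ih =>
    intro α _ G X Y C D e d q hN hK hd he hC hD hX hY
    have e5 : (s + t) * (K + (r + 1)) = (s + t) * (K + r) + (s + t) := by ring
    obtain ⟨T, hT, hTc⟩ := exists_subset_card_eq (s := D) (n := t) (by omega)
    obtain ⟨S, hS, hSc, -, hST⟩ := exists_common_nbrs (G := G) (T := T) (C := C) (Z := ∅) (e := e)
      (r := s) (fun v hv => hN.missY v (hT hv)) (by
        rw [card_empty, hTc]
        nlinarith)
    have e1 := le_card_sdiff S C
    have e2 := le_card_sdiff T D
    have e3 : ((X \ S) \ (C \ S)).card ≤ (X \ C).card := by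
      refine card_le_card ?_
      intro v
      simp only [mem_sdiff]
      tauto
    have e4 : ((Y \ T) \ (D \ T)).card ≤ (Y \ D).card := by
      refine card_le_card ?_
      intro v
      simp only [mem_sdiff]
      tauto
    refine Tiled.of_sdiff hN.disj (hS.trans hN.subX) (hT.trans hN.subY) (Or.inl ⟨hSc, hTc⟩) hST ?_
    refine ih α G _ _ _ _ e (d - (s + t)) q (hN.sdiff (k := s + t) (by omega) (by omega)) ?_ ?_ he
      ?_ ?_
      (card_sdiff_of_card_eq (hS.trans hN.subX) (by rw [hX]; ring) hSc)
      (card_sdiff_of_card_eq (hT.trans hN.subY) (by rw [hY]; ring) hTc)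
    all_goals omega

/-- A nearly complete bipartite graph whose part sizes lie in the lattice generated by `(s, t)` and
`(t, s)` can be tiled. -/
theorem exists_tiled_of_nearComplete {s t : ℕ} (hs : 0 < s) (hst : s < t) :
    ∃ N₀ : ℕ, ∀ M : ℕ, N₀ ≤ M → ∀ (α : Type) [DecidableEq α] (G : SimpleGraph α)
      (X Y C D : Finset α) (e d : ℕ) (a b : ℤ), NearComplete G X Y C D e d →
      (X \ C).card ≤ e → (Y \ D).card ≤ e → X.card ≤ Y.card + e → Y.card ≤ X.card + e →
      3 * (s + t) * e ≤ d → 10 * (s + t) * (e + 1) ≤ M →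
      M + 3 * (s + t) * e ≤ C.card → M + 3 * (s + t) * e ≤ D.card →
      X.card = a * s + b * t → Y.card = a * t + b * s →
      Tiled G X Y s t (X ∪ Y) := by
  obtain ⟨N₀, hN₀⟩ := exists_tiled_of_nearComplete_of_card_add_eq hs (t := t)
  refine ⟨N₀, fun M hM => ?_⟩
  have key : ∀ (α : Type) [DecidableEq α] (G : SimpleGraph α)
      (X Y C D : Finset α) (e d : ℕ) (a b : ℤ), NearComplete G X Y C D e d →
      (X \ C).card ≤ e → (Y \ D).card ≤ e → Y.card ≤ X.card + e →
      3 * (s + t) * e ≤ d → 10 * (s + t) * (e + 1) ≤ M →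
      M + 3 * (s + t) * e ≤ C.card → M + 3 * (s + t) * e ≤ D.card →
      X.card = a * s + b * t → Y.card = a * t + b * s → b ≤ a →
      Tiled G X Y s t (X ∪ Y) := by
    intro α _ G X Y C D e d a b hN hXC hYD hYX hd he hC hD hX hY hab
    obtain ⟨r, rfl⟩ : ∃ r : ℕ, a = b + r := ⟨(a - b).toNat, by omega⟩
    have hr : r ≤ e := by
      have : (Y.card : ℤ) - X.card = r * (t - s) := by rw [hX, hY]; ring
      have h1 : (1 : ℤ) ≤ t - s := by omega
      have h2 : (r : ℤ) * 1 ≤ r * (t - s) := mul_le_mul_of_nonneg_left h1 (by positivity)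
      omega
    have hb : 0 ≤ b := by
      have h1 : (X.card : ℤ) = r * s + b * (s + t) := by rw [hX]; ring
      have h2 : (r : ℤ) * s < X.card := by
        have h3 := card_le_card hN.subX
        have h4 : r * s ≤ e * (s + t) := Nat.mul_le_mul hr (by omega)
        have h5 : 10 * (s + t) * (e + 1) = 10 * (e * (s + t)) + 10 * (s + t) := by ring
        exact_mod_cast (by omega : r * s < X.card)
      have h3 : 0 < b * ((s : ℤ) + t) := by linarith
      exact (pos_of_mul_pos_left h3 (by positivity)).le
    obtain ⟨q, rfl⟩ : ∃ q : ℕ, b = q := ⟨b.toNat, by omega⟩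
    have h1 : (s + t) * (2 * e + r) ≤ 3 * (s + t) * e := by nlinarith
    refine hN₀ r (2 * e) M hM α G X Y C D e d q hN (by omega) (by omega) he (by omega) (by omega)
      ?_ ?_
    · zify
      rw [hX]
      ring
    · zify
      rw [hY]
      ring
  intro α _ G X Y C D e d a b hN hXC hYD hXY hYX hd he hC hD hX hY
  rcases le_total b a with hab | hab
  · exact key α G X Y C D e d a b hN hXC hYD hYX hd he hC hD hX hY hab
  · rw [union_comm]
    exact (key α G Y X D C e d b a hN.swap hYD hXC hXY hd he hD hC (by rw [hY]; ring)
      (by rw [hX]; ring) hab).swap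

end

/-- A nearly complete pair `(X, Y)` with few exceptional vertices and almost equal part sizes. -/
structure NearBalanced {α : Type*} [DecidableEq α] (G : SimpleGraph α) (X Y C D : Finset α)
    (e d : ℕ) : Prop extends NearComplete G X Y C D e d where
  excX : (X \ C).card ≤ e
  excY : (Y \ D).card ≤ e
  leX : X.card ≤ Y.card + e
  leY : Y.card ≤ X.card + e
  leC : d ≤ C.card
  leD : d ≤ D.card

section

variable {α : Type*} [DecidableEq α] {G : SimpleGraph α} {X Y C D : Finset α} {e d : ℕ}

theorem NearBalanced.sdiff (h : NearBalanced G X Y C D e d) {W : Finset α} {k : ℕ}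
    (hW : W.card ≤ k) : NearBalanced G (X \ W) (Y \ W) (C \ W) (D \ W) (e + k) (d - k) where
  toNearComplete := by
    have h1 := h.toNearComplete.sdiff hW hW
    exact ⟨h1.disj, h1.subX, h1.subY, fun u hu => (h1.missX u hu).trans (by omega),
      fun u hu => (h1.missY u hu).trans (by omega), h1.degX, h1.degY⟩
  excX := by
    have h1 : ((X \ W) \ (C \ W)).card ≤ (X \ C).card := by
      refine card_le_card fun v => ?_
      simp only [mem_sdiff]
      tauto
    have := h.excX
    omega
  excY := by
    have h1 : ((Y \ W) \ (D \ W)).card ≤ (Y \ D).card := by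
      refine card_le_card fun v => ?_
      simp only [mem_sdiff]
      tauto
    have := h.excY
    omega
  leX := by
    have h1 := le_card_sdiff W Y
    have h2 := card_le_card (sdiff_subset (s := X) (t := W))
    have := h.leX
    omega
  leY := by
    have h1 := le_card_sdiff W X
    have h2 := card_le_card (sdiff_subset (s := Y) (t := W))
    have := h.leY
    omega
  leC := by
    have h1 := le_card_sdiff W C
    have := h.leC
    omega
  leD := by
    have h1 := le_card_sdiff W D
    have := h.leD
    omega

end

theorem exists_tiled_of_nearBalanced {s t : ℕ} (hs : 0 < s) (hst : s < t) :
    ∃ e₀ : ℕ, ∀ e : ℕ, e₀ ≤ e → ∀ (α : Type) [DecidableEq α] (G : SimpleGraph α)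
      (X Y C D : Finset α) (d : ℕ) (a b : ℤ), NearBalanced G X Y C D e d →
      14 * (s + t) * e ≤ d → X.card = a * s + b * t → Y.card = a * t + b * s →
      Tiled G X Y s t (X ∪ Y) := by
  obtain ⟨N₀, hN₀⟩ := exists_tiled_of_nearComplete hs hst
  refine ⟨N₀ + 10, fun e he α _ G X Y C D d a b hN hd hX hY => ?_⟩
  have h1 : e ≤ (s + t) * e := Nat.le_mul_of_pos_left _ (by omega)
  have h2 : 10 * (s + t) * (e + 1) ≤ 11 * ((s + t) * e) := by nlinarith
  have h3 : 14 * (s + t) * e = 14 * ((s + t) * e) := by ring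
  have h4 : 3 * (s + t) * e = 3 * ((s + t) * e) := by ring
  have h5 := hN.leC
  have h6 := hN.leD
  refine hN₀ (11 * ((s + t) * e)) (by omega) α G X Y C D e d a b hN.toNearComplete hN.excX hN.excY
    hN.leX hN.leY (by omega) h2 (by omega) (by omega) hX hY

/-- Two nearly complete pairs can be tiled after removing a bounded tiled set that makes their sizes
lie in the lattice generated by `(s, t)` and `(t, s)`. -/
theorem exists_tiled_of_two_nearBalanced {s t : ℕ} (hs : 0 < s) (hst : s < t) :
    ∃ e₀ : ℕ, ∀ e : ℕ, e₀ ≤ e → ∀ (α : Type) [DecidableEq α] (G : SimpleGraph α)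
      (X₁ Y₁ C₁ D₁ X₂ Y₂ C₂ D₂ W : Finset α) (d : ℕ) (a b a' b' : ℤ),
      NearBalanced G X₁ Y₁ C₁ D₁ e d → NearBalanced G X₂ Y₂ C₂ D₂ e d →
      Disjoint X₁ X₂ → Disjoint Y₁ Y₂ → Disjoint (X₁ ∪ X₂) (Y₁ ∪ Y₂) →
      29 * (s + t) * e ≤ d → Tiled G (X₁ ∪ X₂) (Y₁ ∪ Y₂) s t W → W.card ≤ e →
      (X₁ \ W).card = a * s + b * t → (Y₁ \ W).card = a * t + b * s →
      (X₂ \ W).card = a' * s + b' * t → (Y₂ \ W).card = a' * t + b' * s →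
      Tiled G (X₁ ∪ X₂) (Y₁ ∪ Y₂) s t ((X₁ ∪ X₂) ∪ (Y₁ ∪ Y₂)) := by
  obtain ⟨e₀, he₀⟩ := exists_tiled_of_nearBalanced hs hst
  refine ⟨e₀, fun e he α _ G X₁ Y₁ C₁ D₁ X₂ Y₂ C₂ D₂ W d a b a' b' h₁ h₂ hX hY hXY hd hW hWe
    hX₁ hY₁ hX₂ hY₂ => ?_⟩
  have e1 : e ≤ (s + t) * e := Nat.le_mul_of_pos_left _ (by omega)
  have e2 : 29 * (s + t) * e = 29 * ((s + t) * e) := by ring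
  have e3 : 14 * (s + t) * (e + e) = 28 * ((s + t) * e) := by ring
  have t₁ := he₀ (e + e) (by omega) α G _ _ _ _ (d - e) a b (h₁.sdiff hWe) (by omega) hX₁ hY₁
  have t₂ := he₀ (e + e) (by omega) α G _ _ _ _ (d - e) a' b' (h₂.sdiff hWe) (by omega) hX₂ hY₂
  have t₁' := t₁.mono (sdiff_subset.trans subset_union_left : X₁ \ W ⊆ X₁ ∪ X₂)
    (sdiff_subset.trans subset_union_left : Y₁ \ W ⊆ Y₁ ∪ Y₂)
  have t₂' := t₂.mono (sdiff_subset.trans subset_union_right : X₂ \ W ⊆ X₁ ∪ X₂)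
    (sdiff_subset.trans subset_union_right : Y₂ \ W ⊆ Y₁ ∪ Y₂)
  have hsub := hW.subset
  rw [disjoint_left] at hX hY hXY
  have key := (hW.union t₁' (by rw [disjoint_left]; grind)).union t₂' (by rw [disjoint_left]; grind)
  convert key using 1
  ext v
  have := @hsub v
  simp only [mem_union, mem_sdiff] at *
  tauto

/-- A vertex outside `C` with `s` neighbours in a set `D`, all of whose vertices are adjacent to
almost all of `C`, extends to a copy of `K_{s,t}`. -/
theorem exists_complete_of_star {α : Type*} [DecidableEq α] {G : SimpleGraph α}
    {C D Z : Finset α} {f s t : ℕ} (hD : ∀ v ∈ D, C.card ≤ degS G v C + f) {p : α} (hp : p ∉ C)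
    (hpD : s ≤ degS G p (D \ Z)) (ht : 0 < t) (hC : t + Z.card + s * f ≤ C.card) :
    ∃ S ⊆ C, ∃ T ⊆ D, S.card = t - 1 ∧ T.card = s ∧ (insert p S).card = t ∧ Disjoint S Z ∧
      Disjoint T Z ∧ ∀ u ∈ insert p S, ∀ v ∈ T, G.Adj u v := by
  obtain ⟨T, hT, hTc⟩ := exists_subset_card_eq hpD
  have hT' : ∀ v ∈ T, v ∈ D ∧ v ∉ Z ∧ G.Adj p v := fun v hv => by
    have := hT hv
    simp only [mem_filter, mem_sdiff] at this
    tauto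
  obtain ⟨S, hS, hSc, hSZ, hST⟩ := exists_common_nbrs (G := G) (T := T) (C := C) (Z := Z)
    (r := t - 1) (e := f) (fun v hv => hD v (hT' v hv).1) (by rw [hTc]; omega)
  refine ⟨S, hS, T, fun v hv => (hT' v hv).1, hSc, hTc, ?_, hSZ,
    disjoint_left.2 fun v hv => (hT' v hv).2.1, ?_⟩
  · rw [card_insert_of_notMem fun hpS => hp (hS hpS)]
    omega
  · intro u hu v hv
    rcases mem_insert.1 hu with rfl | hu
    · exact (hT' v hv).2.2
    · exact hST u hu v hv

theorem exists_star_tiles {α : Type*} [DecidableEq α] {G : SimpleGraph α}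
    {X₁ X₂ Y₂ C₂ D₂ Z₀ : Finset α} {f s t B : ℕ} (hC₂ : C₂ ⊆ X₂) (hD₂ : D₂ ⊆ Y₂)
    (hmiss : ∀ v ∈ D₂, C₂.card ≤ degS G v C₂ + f) (hX : Disjoint X₁ X₂)
    (hXY : Disjoint (X₁ ∪ X₂) Y₂) (ht : 0 < t)
    (hstar : ∀ Z : Finset α, Z.card ≤ B → ∃ p ∈ X₁ \ Z, s ≤ degS G p (D₂ \ Z))
    (hC : t + B + s * f ≤ C₂.card) (a : ℕ) (ha : Z₀.card + a * (s + t) ≤ B) :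
    ∃ W, Tiled G (X₁ ∪ X₂) Y₂ s t W ∧ Disjoint W Z₀ ∧ (W ∩ X₁).card = a ∧
      (W ∩ X₂).card = a * (t - 1) ∧ (W ∩ Y₂).card = a * s ∧ W.card = a * (s + t) := by
  induction a with
  | zero => exact ⟨∅, .nil, by simp, by simp, by simp, by simp, by simp⟩
  | succ a ih =>
    rw [add_mul, one_mul] at ha
    obtain ⟨W, hW, hWZ, hW1, hW2, hWY, hWc⟩ := ih (by omega)
    have hZ : (W ∪ Z₀).card ≤ B := by
      have := card_union_le W Z₀
      omega
    obtain ⟨p, hp, hpd⟩ := hstar (W ∪ Z₀) hZ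
    rw [mem_sdiff] at hp
    have hpX : p ∉ X₂ := disjoint_left.1 hX hp.1
    obtain ⟨S, hS, T, hT, hSc, hTc, hpc, hSZ, hTZ, hST⟩ := exists_complete_of_star (Z := W ∪ Z₀)
      (t := t) hmiss (fun hh => hpX (hC₂ hh)) hpd ht (by omega)
    have hS2 := hS.trans hC₂
    have hT2 := hT.trans hD₂
    have hpS : p ∉ S := fun hh => hpX (hS2 hh)
    have hSX : S ∩ X₁ = ∅ := disjoint_iff_inter_eq_empty.1
      (disjoint_of_subset_left hS2 hX.symm)
    have hTX : T ∩ (X₁ ∪ X₂) = ∅ := disjoint_iff_inter_eq_empty.1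
      (disjoint_of_subset_left hT2 hXY.symm)
    have hTX1 : T ∩ X₁ = ∅ := subset_empty.1 (hTX ▸ inter_subset_inter_left subset_union_left)
    have hTX2 : T ∩ X₂ = ∅ := subset_empty.1 (hTX ▸ inter_subset_inter_left subset_union_right)
    have hSY : insert p S ∩ Y₂ = ∅ := disjoint_iff_inter_eq_empty.1
      (disjoint_of_subset_left (insert_subset (mem_union_left _ hp.1)
        (hS2.trans subset_union_right)) hXY)
    have hd : Disjoint (W ∪ Z₀) (insert p S ∪ T) :=
      (disjoint_union_left.2 ⟨disjoint_insert_left.2 ⟨hp.2, hSZ⟩, hTZ⟩).symm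
    have hd' := disjoint_union_left.1 hd
    have key : ∀ A : Finset α, ((W ∪ (insert p S ∪ T)) ∩ A).card =
        (W ∩ A).card + ((insert p S ∪ T) ∩ A).card := fun A => by
      rw [union_inter_distrib_right, card_union_of_disjoint]
      exact disjoint_of_subset_left inter_subset_left
        (disjoint_of_subset_right inter_subset_left hd'.1)
    refine ⟨W ∪ (insert p S ∪ T), hW.add (insert_subset (mem_union_left _ hp.1)
        (hS2.trans subset_union_right)) hT2 (Or.inr ⟨hpc, hTc⟩) hST hd'.1,
      disjoint_union_left.2 ⟨hWZ, hd'.2.symm⟩, ?_, ?_, ?_, ?_⟩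
    · rw [key, hW1, union_inter_distrib_right, hTX1, union_empty, insert_inter_of_mem hp.1, hSX]
      simp
    · rw [key, hW2, union_inter_distrib_right, hTX2, union_empty, insert_inter_of_notMem hpX,
        inter_eq_left.2 hS2, hSc]
      ring
    · rw [key, hWY, union_inter_distrib_right, hSY, empty_union, inter_eq_left.2 hT2, hTc]
      ring
    · rw [card_union_of_disjoint hd'.1, card_union_of_disjoint, hWc, hpc, hTc]
      · ring
      · exact disjoint_of_subset_left (insert_subset (mem_union_left _ hp.1)
          (hS2.trans subset_union_right)) (disjoint_of_subset_right hT2 hXY)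

/-- Two nearly complete pairs joined by robustly many `s`-stars in both directions can be tiled. -/
theorem exists_tiled_of_stars {s t : ℕ} (hs : 0 < s) (hst : s < t) :
    ∃ B e₀ : ℕ, ∀ e : ℕ, e₀ ≤ e → ∀ (α : Type) [DecidableEq α] (G : SimpleGraph α)
      (X₁ Y₁ C₁ D₁ X₂ Y₂ C₂ D₂ U V : Finset α) (d f m : ℕ),
      NearBalanced G X₁ Y₁ C₁ D₁ e d → NearBalanced G X₂ Y₂ C₂ D₂ e d →
      Disjoint X₁ X₂ → Disjoint Y₁ Y₂ → Disjoint (X₁ ∪ X₂) (Y₁ ∪ Y₂) →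
      29 * (s + t) * e ≤ d → X₁.card + X₂.card = m * (s + t) → Y₁.card + Y₂.card = m * (s + t) →
      U ⊆ X₁ → V ⊆ Y₂ → (∀ u ∈ U, D₁.card ≤ degS G u D₁ + f) →
      (∀ v ∈ V, C₂.card ≤ degS G v C₂ + f) → e + s * f ≤ D₁.card → e + s * f ≤ C₂.card →
      (∀ Z : Finset α, Z.card ≤ B → ∃ p ∈ U \ Z, s ≤ degS G p (V \ Z)) →
      (∀ Z : Finset α, Z.card ≤ B → ∃ q ∈ V \ Z, s ≤ degS G q (U \ Z)) →
      Tiled G (X₁ ∪ X₂) (Y₁ ∪ Y₂) s t ((X₁ ∪ X₂) ∪ (Y₁ ∪ Y₂)) := by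
  obtain ⟨e₀, he₀⟩ := exists_tiled_of_two_nearBalanced hs hst
  set N : ℕ := t ^ 2 - s ^ 2 with hN
  have hNpos : 0 < N := Nat.sub_pos_of_lt (Nat.pow_lt_pow_left hst two_ne_zero)
  have hNZ : (N : ℤ) = t ^ 2 - s ^ 2 := by
    rw [hN, Nat.cast_sub (Nat.pow_le_pow_left hst.le 2)]
    push_cast
    rfl
  refine ⟨2 * N * (s + t), e₀ + t + 2 * N * (s + t), fun e he α _ G X₁ Y₁ C₁ D₁ X₂ Y₂ C₂ D₂ U V d f
    m h₁ h₂ hX hY hXY hd hXm hYm hU hV hfU hfV hD₁ hC₂ hp hq => ?_⟩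
  obtain ⟨a, i, haN, hai⟩ : ∃ a i : ℕ, a ≤ N ∧ X₁.card = a + N * i :=
    ⟨_, _, (Nat.mod_lt _ hNpos).le, (Nat.mod_add_div _ N).symm⟩
  obtain ⟨b, j, hbN, hbj⟩ : ∃ b j : ℕ, b ≤ N ∧ Y₁.card + b = N * j := by
    refine ⟨N - Y₁.card % N, Y₁.card / N + 1, Nat.sub_le _ _, ?_⟩
    have e1 := Nat.mod_lt Y₁.card hNpos
    have e2 := Nat.mod_add_div Y₁.card N
    rw [mul_add, mul_one]
    omega
  have haN' := Nat.mul_le_mul_right (s + t) haN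
  have hbN' := Nat.mul_le_mul_right (s + t) hbN
  have e0 : 2 * N * (s + t) = N * (s + t) + N * (s + t) := by ring
  obtain ⟨Wp, hWp, -, p1, p2, p3, p4⟩ := exists_star_tiles (s := s) (t := t) (Z₀ := ∅) h₂.subX hV
    hfV hX (disjoint_of_subset_right subset_union_right hXY) (by omega)
    (fun Z hZ => (hp Z hZ).imp fun p hp => ⟨sdiff_subset_sdiff hU Subset.rfl hp.1, hp.2⟩)
    (by omega) a (by rw [card_empty]; omega)
  obtain ⟨Wq, hWq, hd', q1, q2, q3, q4⟩ := exists_star_tiles (s := s) (t := t) (Z₀ := Wp)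
    (X₁ := Y₂) h₁.subY hU hfU hY.symm
    (disjoint_of_subset_left (union_comm Y₂ Y₁).subset
      (disjoint_of_subset_right subset_union_left hXY.symm)) (by omega)
    (fun Z hZ => (hq Z hZ).imp fun p hp => ⟨sdiff_subset_sdiff hV Subset.rfl hp.1, hp.2⟩)
    (by omega) b (by omega)
  have hWpY : Wp ∩ Y₁ = ∅ := disjoint_iff_inter_eq_empty.1 <| by
    refine disjoint_of_subset_left hWp.subset (disjoint_union_left.2 ⟨?_, hY.symm⟩)
    exact disjoint_of_subset_right subset_union_left hXY
  have hWqX : Wq ∩ X₂ = ∅ := disjoint_iff_inter_eq_empty.1 <| by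
    refine disjoint_of_subset_left hWq.subset (disjoint_union_left.2 ⟨?_, hX⟩)
    rw [union_comm]
    exact disjoint_of_subset_right subset_union_right hXY.symm
  have key : ∀ A : Finset α, (A \ (Wp ∪ Wq)).card + ((Wp ∩ A).card + (Wq ∩ A).card) = A.card :=
    fun A => by
      have f1 := card_sdiff_add_card_inter A (Wp ∪ Wq)
      rw [inter_comm, union_inter_distrib_right, card_union_of_disjoint] at f1
      · exact f1
      · exact disjoint_of_subset_left inter_subset_left
          (disjoint_of_subset_right inter_subset_left hd'.symm)
  have k1 := key X₁
  have k2 := key X₂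
  have k3 := key Y₁
  have k4 := key Y₂
  rw [p1, q3] at k1
  rw [p2, hWqX, card_empty, add_zero] at k2
  rw [hWpY, card_empty, zero_add, q2] at k3
  rw [p3, q1] at k4
  have ht1 : ((t - 1 : ℕ) : ℤ) = t - 1 := by omega
  zify [ht1] at k1 k2 k3 k4 hai hbj hXm hYm
  rw [hNZ] at hai hbj
  refine he₀ e (by omega) α G X₁ Y₁ C₁ D₁ X₂ Y₂ C₂ D₂ (Wp ∪ Wq) d
    (-s * i + t * j - b) (t * i - s * j) (m + s * i - t * j) (m - t * i + s * j - a) h₁ h₂ hX hY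
    hXY hd ?_ ?_ ?_ ?_ ?_ ?_
  · refine (hWp.mono Subset.rfl subset_union_right).union (hWq.swap.mono subset_union_left ?_)
      hd'.symm
    rw [union_comm]
  · have := card_union_le Wp Wq
    omega
  all_goals linarith

/-- The graph between `P` and `Q` is, up to few vertices, the union of two nearly complete balanced
pairs `(C₁, D₁)` and `(C₂, D₂)` of almost equal sizes. -/
structure TwoCores {α : Type*} [DecidableEq α] (G : SimpleGraph α) (P Q : Finset α) (n : ℕ) (ε : ℝ)
    (C₁ C₂ D₁ D₂ : Finset α) : Prop where
  disj : Disjoint P Q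
  cardP : P.card = n
  cardQ : Q.card = n
  degP : ∀ u ∈ P, n ≤ 2 * degS G u Q
  degQ : ∀ v ∈ Q, n ≤ 2 * degS G v P
  subC₁ : C₁ ⊆ P
  subC₂ : C₂ ⊆ P
  subD₁ : D₁ ⊆ Q
  subD₂ : D₂ ⊆ Q
  disjC : Disjoint C₁ C₂
  disjD : Disjoint D₁ D₂
  leC₁ : (1 / 2 - ε) * n ≤ C₁.card
  leC₂ : (1 / 2 - ε) * n ≤ C₂.card
  leD₁ : (1 / 2 - ε) * n ≤ D₁.card
  leD₂ : (1 / 2 - ε) * n ≤ D₂.card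
  missC₁ : ∀ u ∈ C₁, (D₁.card : ℝ) ≤ degS G u D₁ + ε * n
  missC₂ : ∀ u ∈ C₂, (D₂.card : ℝ) ≤ degS G u D₂ + ε * n
  missD₁ : ∀ v ∈ D₁, (C₁.card : ℝ) ≤ degS G v C₁ + ε * n
  missD₂ : ∀ v ∈ D₂, (C₂.card : ℝ) ≤ degS G v C₂ + ε * n

namespace TwoCores

variable {α : Type*} [DecidableEq α] {G : SimpleGraph α} {P Q C₁ C₂ D₁ D₂ X Y : Finset α} {n : ℕ}
  {ε : ℝ}

/-- Exchange the two sides of the graph. -/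
theorem swap (h : TwoCores G P Q n ε C₁ C₂ D₁ D₂) : TwoCores G Q P n ε D₁ D₂ C₁ C₂ where
  disj := h.disj.symm
  cardP := h.cardQ
  cardQ := h.cardP
  degP := h.degQ
  degQ := h.degP
  subC₁ := h.subD₁
  subC₂ := h.subD₂
  subD₁ := h.subC₁
  subD₂ := h.subC₂
  disjC := h.disjD
  disjD := h.disjC
  leC₁ := h.leD₁
  leC₂ := h.leD₂
  leD₁ := h.leC₁
  leD₂ := h.leC₂
  missC₁ := h.missD₁
  missC₂ := h.missD₂
  missD₁ := h.missC₁
  missD₂ := h.missC₂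

/-- Exchange the two pairs. -/
theorem flip (h : TwoCores G P Q n ε C₁ C₂ D₁ D₂) : TwoCores G P Q n ε C₂ C₁ D₂ D₁ where
  disj := h.disj
  cardP := h.cardP
  cardQ := h.cardQ
  degP := h.degP
  degQ := h.degQ
  subC₁ := h.subC₂
  subC₂ := h.subC₁
  subD₁ := h.subD₂
  subD₂ := h.subD₁
  disjC := h.disjC.symm
  disjD := h.disjD.symm
  leC₁ := h.leC₂
  leC₂ := h.leC₁
  leD₁ := h.leD₂
  leD₂ := h.leD₁
  missC₁ := h.missC₂
  missC₂ := h.missC₁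
  missD₁ := h.missD₂
  missD₂ := h.missD₁

theorem card_add_card_le (h : TwoCores G P Q n ε C₁ C₂ D₁ D₂) : C₁.card + C₂.card ≤ n := by
  rw [← h.cardP, ← card_union_of_disjoint h.disjC]
  exact card_le_card (union_subset h.subC₁ h.subC₂)

theorem card_C₁_le (h : TwoCores G P Q n ε C₁ C₂ D₁ D₂) : (C₁.card : ℝ) ≤ (1 / 2 + ε) * n := by
  have h1 : (C₁.card : ℝ) + C₂.card ≤ n := by exact_mod_cast h.card_add_card_le
  have := h.leC₂
  linarith

theorem card_le (h : TwoCores G P Q n ε C₁ C₂ D₁ D₂) (hX : X ⊆ P) (hd : Disjoint X C₂) :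
    (X.card : ℝ) ≤ (1 / 2 + ε) * n := by
  have h1 : X.card + C₂.card ≤ n := by
    rw [← h.cardP, ← card_union_of_disjoint hd]
    exact card_le_card (union_subset hX h.subC₂)
  have h1 : (X.card : ℝ) + C₂.card ≤ n := by exact_mod_cast h1
  have := h.leC₂
  linarith

theorem half_le_degS (h : TwoCores G P Q n ε C₁ C₂ D₁ D₂) {u : α} (hu : u ∈ P) :
    (1 / 2 - 2 * ε) * n ≤ degS G u D₁ + degS G u D₂ := by
  have h1 := h.degP u hu
  have h2 := degS_le_add_of_sdiff (G := G) u Q (D₁ ∪ D₂)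
  rw [degS_union u h.disjD] at h2
  have h3 := card_sdiff_add_card_eq_card (union_subset h.subD₁ h.subD₂)
  rw [card_union_of_disjoint h.disjD, h.cardQ] at h3
  have h4 : (n : ℝ) ≤ 2 * (degS G u D₁ + degS G u D₂ + (Q \ (D₁ ∪ D₂)).card) := by
    exact_mod_cast (by omega)
  have h5 : ((Q \ (D₁ ∪ D₂)).card : ℝ) + (D₁.card + D₂.card) = n := by exact_mod_cast h3
  linarith [h.leD₁, h.leD₂]

theorem nearBalanced (h : TwoCores G P Q n ε C₁ C₂ D₁ D₂) {e d : ℕ} (hε : ε ≤ 1 / 16)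
    (hCX : C₁ ⊆ X) (hXP : X ⊆ P) (hXC : Disjoint X C₂) (hDY : D₁ ⊆ Y) (hYQ : Y ⊆ Q)
    (hYD : Disjoint Y D₂) (he : 2 * ε * n ≤ e) (hd : 4 * d ≤ n)
    (hX : ∀ u ∈ X, u ∉ C₁ → d ≤ degS G u D₁) (hY : ∀ v ∈ Y, v ∉ D₁ → d ≤ degS G v C₁) :
    NearBalanced G X Y C₁ D₁ e d := by
  have hd' : 4 * (d : ℝ) ≤ n := by exact_mod_cast hd
  have hn : (0 : ℝ) ≤ n := by positivity
  have hεn : ε * n ≤ 1 / 16 * n := mul_le_mul_of_nonneg_right hε hn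
  have hXc := h.card_le hXP hXC
  have hYc := h.swap.card_le hYQ hYD
  have b1 := h.leC₁
  have b2 := h.leD₁
  have e1 : (X.card : ℝ) = (X \ C₁).card + C₁.card := by
    exact_mod_cast (card_sdiff_add_card_eq_card hCX).symm
  have e2 : (Y.card : ℝ) = (Y \ D₁).card + D₁.card := by
    exact_mod_cast (card_sdiff_add_card_eq_card hDY).symm
  have e3 : (0 : ℝ) ≤ (X \ C₁).card := by positivity
  have e4 : (0 : ℝ) ≤ (Y \ D₁).card := by positivity
  have hε0 : 0 ≤ ε * n := by linarith
  refine ⟨⟨disjoint_of_subset_left hXP (disjoint_of_subset_right hYQ h.disj), hCX, hDY, ?_, ?_, ?_,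
    ?_⟩, ?_, ?_, ?_, ?_, ?_, ?_⟩
  · intro u hu
    have := h.missC₁ u hu
    exact_mod_cast (by linarith : (D₁.card : ℝ) ≤ degS G u D₁ + e)
  · intro u hu
    have := h.missD₁ u hu
    exact_mod_cast (by linarith : (C₁.card : ℝ) ≤ degS G u C₁ + e)
  · intro u hu
    by_cases huC : u ∈ C₁
    · have := h.missC₁ u huC
      exact_mod_cast (by linarith : (d : ℝ) ≤ degS G u D₁)
    · exact hX u hu huC
  · intro u hu
    by_cases huC : u ∈ D₁
    · have := h.missD₁ u huC
      exact_mod_cast (by linarith : (d : ℝ) ≤ degS G u C₁)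
    · exact hY u hu huC
  · exact_mod_cast (by linarith : ((X \ C₁).card : ℝ) ≤ e)
  · exact_mod_cast (by linarith : ((Y \ D₁).card : ℝ) ≤ e)
  · exact_mod_cast (by linarith : (X.card : ℝ) ≤ Y.card + e)
  · exact_mod_cast (by linarith : (Y.card : ℝ) ≤ X.card + e)
  · exact_mod_cast (by linarith : (d : ℝ) ≤ C₁.card)
  · exact_mod_cast (by linarith : (d : ℝ) ≤ D₁.card)

theorem mono (h : TwoCores G P Q n ε C₁ C₂ D₁ D₂) {ε' : ℝ} (hε : ε ≤ ε') :
    TwoCores G P Q n ε' C₁ C₂ D₁ D₂ := by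
  have h1 : ε * n ≤ ε' * n := mul_le_mul_of_nonneg_right hε (by positivity)
  obtain ⟨h₁, h₂, h₃, h₄, h₅, h₆, h₇, h₈, h₉, k₁, k₂, k₃, k₄, k₅, k₆, k₇, k₈, k₉, l₁⟩ := h
  exact ⟨h₁, h₂, h₃, h₄, h₅, h₆, h₇, h₈, h₉, k₁, k₂, by linarith, by linarith, by linarith,
    by linarith, fun u hu => (k₇ u hu).trans (by linarith),
    fun u hu => (k₈ u hu).trans (by linarith), fun u hu => (k₉ u hu).trans (by linarith),
    fun u hu => (l₁ u hu).trans (by linarith)⟩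

end TwoCores

section

variable {α : Type*} [DecidableEq α] {G : SimpleGraph α} {P Q A B : Finset α} {n : ℕ} {a γ ε : ℝ}

/-- Few vertices of `S` have large degree into `T` when there are few edges. -/
theorem card_filter_mul_le_eAB (S T : Finset α) (x : ℝ) :
    ((S.filter fun u => ¬ (degS G u T : ℝ) ≤ x).card : ℝ) * x ≤ eAB G S T := by
  calc _ = ∑ _u ∈ S.filter (fun u => ¬ (degS G u T : ℝ) ≤ x), x := by simp
    _ ≤ ∑ u ∈ S.filter (fun u => ¬ (degS G u T : ℝ) ≤ x), (degS G u T : ℝ) :=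
      sum_le_sum fun u hu => (not_le.1 (mem_filter.1 hu).2).le
    _ ≤ ∑ u ∈ S, (degS G u T : ℝ) :=
      sum_le_sum_of_subset_of_nonneg (filter_subset _ _) fun _ _ _ => by positivity
    _ = _ := by simp [eAB]

theorem card_filter_le_degS (S T : Finset α) (x : ℝ) {M : ℝ} (hx : 0 < x) (h : eAB G S T ≤ M) :
    (S.card : ℝ) - M / x ≤ (S.filter fun u => (degS G u T : ℝ) ≤ x).card := by
  have h1 : ((S.filter fun u => (degS G u T : ℝ) ≤ x).card : ℝ) +
      (S.filter fun u => ¬ (degS G u T : ℝ) ≤ x).card = S.card := by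
    exact_mod_cast card_filter_add_card_filter_not _
  have h2 : ((S.filter fun u => ¬ (degS G u T : ℝ) ≤ x).card : ℝ) ≤ M / x := by
    rw [le_div_iff₀ hx]
    exact (card_filter_mul_le_eAB S T x).trans h
  linarith

end

section

variable {α : Type*} [DecidableEq α] {G : SimpleGraph α} {P Q A B : Finset α} {n : ℕ} {a γ ε : ℝ}

theorem degS_add_degS_compl {u : α} {S : Finset α} (hu : u ∉ S) :
    degS G u S + degS Gᶜ u S = S.card := by
  rw [← degS_add_card_nonadj (G := G) u S]
  congr 1
  unfold degS
  congr 1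
  ext v
  simp only [mem_filter, SimpleGraph.compl_adj]
  exact and_congr_right fun hv => and_iff_right fun h => hu (h ▸ hv)

theorem card_le_of_sparse (hP : P.card = n) (hdeg : ∀ v ∈ Q, n ≤ 2 * degS G v P) (hA : A ⊆ P)
    (hB : B ⊆ Q) (hBc : (1 / 4 : ℝ) * n ≤ B.card) (he : (eAB G A B : ℝ) < a * n ^ 2) :
    (A.card : ℝ) ≤ (1 / 2 + 4 * a) * n := by
  have h1 : (B.card : ℝ) * (n / 2) ≤ eAB G A B + B.card * (P \ A).card := by
    calc (B.card : ℝ) * (n / 2) = ∑ _v ∈ B, (n / 2 : ℝ) := by simp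
      _ ≤ ∑ v ∈ B, ((degS G v A : ℝ) + (P \ A).card) := sum_le_sum fun v hv => by
        have e1 := hdeg v (hB hv)
        have e2 := degS_le_add_of_sdiff (G := G) v P A
        have : (n : ℝ) ≤ 2 * (degS G v A + (P \ A).card) := by exact_mod_cast (by omega)
        linarith
      _ = _ := by
        rw [sum_add_distrib, eAB_comm, eAB]
        simp
  have h2 : ((P \ A).card : ℝ) + A.card = n := by
    rw [← hP]
    exact_mod_cast card_sdiff_add_card_eq_card hA
  by_contra! hcon
  have hn : (0 : ℝ) < n := by
    rcases Nat.eq_zero_or_pos n with rfl | h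
    · have : (0 : ℝ) ≤ eAB G A B := by positivity
      norm_num at he
      linarith
    · exact_mod_cast h
  have ha : 0 < a := by
    have : (0 : ℝ) ≤ eAB G A B := by positivity
    by_contra! h
    nlinarith [sq_nonneg (n : ℝ)]
  have h3 : 4 * a * n < n / 2 - (P \ A).card := by linarith
  nlinarith [mul_le_mul hBc h3.le (by positivity) (by positivity)]

theorem eAB_compl_le_of_sparse (hd : Disjoint P Q) (hP : P.card = n) (hQ : Q.card = n)
    (hdeg : ∀ v ∈ Q, n ≤ 2 * degS G v P)
    (hA : A ⊆ P) (hB : B ⊆ Q) (hAc : (1 / 2 - a) * n ≤ A.card)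
    (ha : 0 ≤ a) (he : (eAB G A B : ℝ) < a * n ^ 2) :
    (eAB Gᶜ (P \ A) B : ℝ) ≤ 2 * a * n ^ 2 := by
  have h2 : ((P \ A).card : ℝ) + A.card = n := by
    rw [← hP]
    exact_mod_cast card_sdiff_add_card_eq_card hA
  have hBn : (B.card : ℝ) ≤ n := by exact_mod_cast hQ ▸ card_le_card hB
  calc (eAB Gᶜ (P \ A) B : ℝ) = ∑ v ∈ B, (degS Gᶜ v (P \ A) : ℝ) := by
        rw [eAB_comm, eAB]
        push_cast
        rfl
    _ ≤ ∑ v ∈ B, ((degS G v A : ℝ) + a * n) := sum_le_sum fun v hv => by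
      have e1 := hdeg v (hB hv)
      have e2 := degS_union (G := G) v (disjoint_sdiff (s := A) (t := P))
      rw [union_sdiff_of_subset hA] at e2
      have e3 := degS_add_degS_compl (G := G) (u := v) (S := P \ A)
        fun h => disjoint_left.1 hd (sdiff_subset h) (hB hv)
      have e4 : (degS G v (P \ A) : ℝ) + degS Gᶜ v (P \ A) = (P \ A).card := by exact_mod_cast e3
      have e5 : (n : ℝ) ≤ 2 * (degS G v A + degS G v (P \ A)) := by exact_mod_cast e2 ▸ e1
      linarith
    _ = eAB G A B + B.card * (a * n) := by
      rw [sum_add_distrib, eAB_comm, eAB]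
      simp
    _ ≤ _ := by nlinarith [mul_le_mul_of_nonneg_right hBn (by positivity : 0 ≤ a * n)]

/-- The vertices of `A` with few neighbours in `B` miss few vertices of `Q \ B`. -/
theorem degS_compl_le_of_degS_le (hd : Disjoint P Q) (hQ : Q.card = n) {u : α} (hu : u ∈ P)
    (hdeg : n ≤ 2 * degS G u Q) (hB : B ⊆ Q) (hBc : (1 / 2 - a) * n ≤ B.card)
    (huB : (degS G u B : ℝ) ≤ γ * n) : (degS Gᶜ u (Q \ B) : ℝ) ≤ (γ + a) * n := by
  have h2 : ((Q \ B).card : ℝ) + B.card = n := by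
    rw [← hQ]
    exact_mod_cast card_sdiff_add_card_eq_card hB
  have e2 := degS_union (G := G) u (disjoint_sdiff (s := B) (t := Q))
  rw [union_sdiff_of_subset hB] at e2
  have e3 := degS_add_degS_compl (G := G) (u := u) (S := Q \ B)
    fun h => disjoint_left.1 hd hu (sdiff_subset h)
  have e4 : (degS G u (Q \ B) : ℝ) + degS Gᶜ u (Q \ B) = (Q \ B).card := by exact_mod_cast e3
  have e5 : (n : ℝ) ≤ 2 * (degS G u B + degS G u (Q \ B)) := by exact_mod_cast e2 ▸ hdeg
  linarith

theorem card_le_degS_add_of_compl {u : α} {S T : Finset α} {x : ℝ} (hu : u ∉ T)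
    (h : (degS Gᶜ u T : ℝ) ≤ x) (hST : S ⊆ T) : (S.card : ℝ) ≤ degS G u S + x := by
  have h1 := degS_add_degS_compl (G := G) (u := u) (S := S) fun h => hu (hST h)
  have h2 : (degS G u S : ℝ) + degS Gᶜ u S = S.card := by exact_mod_cast h1
  have h3 : (degS Gᶜ u S : ℝ) ≤ degS Gᶜ u T := by exact_mod_cast degS_mono u hST
  linarith

/-- A sparse pair of sets of size about `n / 2` yields the two-pair structure. -/
theorem exists_twoCores (hε : 0 < ε) (hε1 : ε ≤ 1) (hd : Disjoint P Q) (hP : P.card = n)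
    (hQ : Q.card = n) (hdegP : ∀ v ∈ P, n ≤ 2 * degS G v Q) (hdegQ : ∀ v ∈ Q, n ≤ 2 * degS G v P)
    (hA : A ⊆ P) (hB : B ⊆ Q) (hAc : (1 / 2 - ε ^ 2 / 64) * n ≤ A.card)
    (hBc : (1 / 2 - ε ^ 2 / 64) * n ≤ B.card) (he : (eAB G A B : ℝ) < ε ^ 2 / 64 * n ^ 2) :
    ∃ C₁ C₂ D₁ D₂, TwoCores G P Q n ε C₁ C₂ D₁ D₂ := by
  have he' : (eAB G B A : ℝ) < ε ^ 2 / 64 * n ^ 2 := by rwa [eAB_comm]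
  have ha : 0 < ε ^ 2 / 64 := by positivity
  have ha1 : ε ^ 2 ≤ ε := by nlinarith
  have hn : (0 : ℝ) < n := by
    rcases Nat.eq_zero_or_pos n with rfl | h
    · have : (0 : ℝ) ≤ eAB G A B := by positivity
      norm_num at he
      linarith
    · exact_mod_cast h
  have hεn : ε ^ 2 * n ≤ ε * n := mul_le_mul_of_nonneg_right ha1 hn.le
  have hεn1 : ε * n ≤ 1 * n := mul_le_mul_of_nonneg_right hε1 hn.le
  have hεn0 : 0 < ε * n := by positivity
  have hA1 := card_le_of_sparse hP hdegQ hA hB (by linarith) he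
  have hB1 := card_le_of_sparse hQ hdegP hB hA (by linarith) he'
  have f1 := eAB_compl_le_of_sparse hd hP hQ hdegQ hA hB hAc ha.le he
  have f2 := eAB_compl_le_of_sparse hd.symm hQ hP hdegP hB hA hBc ha.le he'
  have hA2 : ((P \ A).card : ℝ) + A.card = n := by
    rw [← hP]
    exact_mod_cast card_sdiff_add_card_eq_card hA
  have hB2 : ((Q \ B).card : ℝ) + B.card = n := by
    rw [← hQ]
    exact_mod_cast card_sdiff_add_card_eq_card hB
  have hγ : 0 < ε / 4 * n := by positivity
  have g1 := card_filter_le_degS A B (ε / 4 * n) hγ he.le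
  have g2 := card_filter_le_degS B A (ε / 4 * n) hγ he'.le
  have g3 := card_filter_le_degS (P \ A) B (ε / 4 * n) hγ f1
  have g4 := card_filter_le_degS (Q \ B) A (ε / 4 * n) hγ f2
  have q1 : ε ^ 2 / 64 * (n : ℝ) ^ 2 / (ε / 4 * n) = ε * n / 16 := by field_simp; norm_num
  have q2 : 2 * (ε ^ 2 / 64) * (n : ℝ) ^ 2 / (ε / 4 * n) = ε * n / 8 := by field_simp; norm_num
  rw [q1] at g1 g2
  rw [q2] at g3 g4
  refine ⟨A.filter fun u => (degS G u B : ℝ) ≤ ε / 4 * n,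
    (P \ A).filter fun u => (degS Gᶜ u B : ℝ) ≤ ε / 4 * n,
    (Q \ B).filter fun u => (degS Gᶜ u A : ℝ) ≤ ε / 4 * n,
    B.filter fun u => (degS G u A : ℝ) ≤ ε / 4 * n, hd, hP, hQ, hdegP, hdegQ,
    (filter_subset _ _).trans hA, (filter_subset _ _).trans sdiff_subset,
    (filter_subset _ _).trans sdiff_subset, (filter_subset _ _).trans hB,
    disjoint_filter_filter disjoint_sdiff, disjoint_filter_filter sdiff_disjoint, ?_, ?_, ?_, ?_,
    ?_, ?_, ?_, ?_⟩
  · linarith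
  · linarith
  · linarith
  · linarith
  · intro u hu
    rw [mem_filter] at hu
    have := degS_compl_le_of_degS_le hd hQ (hA hu.1) (hdegP u (hA hu.1)) hB hBc hu.2
    exact card_le_degS_add_of_compl
      (fun h => disjoint_left.1 hd (hA hu.1) (sdiff_subset h)) (this.trans (by linarith))
      (filter_subset _ _)
  · intro u hu
    rw [mem_filter, mem_sdiff] at hu
    exact card_le_degS_add_of_compl
      (fun h => disjoint_left.1 hd hu.1.1 (hB h)) (hu.2.trans (by linarith)) (filter_subset _ _)
  · intro u hu
    rw [mem_filter, mem_sdiff] at hu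
    exact card_le_degS_add_of_compl
      (fun h => disjoint_left.1 hd (hA h) hu.1.1) (hu.2.trans (by linarith)) (filter_subset _ _)
  · intro u hu
    rw [mem_filter] at hu
    have := degS_compl_le_of_degS_le hd.symm hP (hB hu.1) (hdegQ u (hB hu.1)) hA hAc hu.2
    exact card_le_degS_add_of_compl
      (fun h => disjoint_left.1 hd (sdiff_subset h) (hB hu.1)) (this.trans (by linarith))
      (filter_subset _ _)

end

/-- If no `s`-star from `U` to `V` avoids `Z`, then there are few edges between `U` and `V`. -/
theorem eAB_le_of_forall_degS_lt {α : Type*} [DecidableEq α] {G : SimpleGraph α}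
    {U V Z : Finset α} {s M : ℕ} (h : ∀ p ∈ U \ Z, degS G p (V \ Z) < s)
    (hU : ∀ u ∈ U, degS G u V ≤ M) (hV : ∀ v ∈ V, degS G v U ≤ M) :
    eAB G U V ≤ (s - 1) * U.card + 2 * Z.card * M := by
  have h1 : eAB G U V ≤ eAB G (U \ Z) (V \ Z) + eAB G U (V ∩ Z) + eAB G (U ∩ Z) V := by
    have e1 : eAB G U V = eAB G (U \ Z) V + eAB G (U ∩ Z) V := by
      rw [← eAB_union_left (disjoint_sdiff_inter U Z), sdiff_union_inter]
    have e2 : eAB G (U \ Z) V = eAB G (U \ Z) (V \ Z) + eAB G (U \ Z) (V ∩ Z) := by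
      rw [← eAB_union_right _ (disjoint_sdiff_inter V Z), sdiff_union_inter]
    have e3 : eAB G (U \ Z) (V ∩ Z) ≤ eAB G U (V ∩ Z) := eAB_mono sdiff_subset Subset.rfl
    omega
  have h2 : eAB G (U \ Z) (V \ Z) ≤ (s - 1) * U.card := by
    calc eAB G (U \ Z) (V \ Z) ≤ ∑ _p ∈ U \ Z, (s - 1) :=
          sum_le_sum fun p hp => Nat.le_sub_one_of_lt (h p hp)
      _ = (s - 1) * (U \ Z).card := by rw [sum_const, smul_eq_mul, mul_comm]
      _ ≤ _ := Nat.mul_le_mul_left _ (card_le_card sdiff_subset)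
  have h3 : eAB G U (V ∩ Z) ≤ Z.card * M := by
    rw [eAB_comm]
    calc eAB G (V ∩ Z) U ≤ ∑ _p ∈ V ∩ Z, M :=
          sum_le_sum fun p hp => hV p (inter_subset_left hp)
      _ = (V ∩ Z).card * M := by rw [sum_const, smul_eq_mul]
      _ ≤ _ := Nat.mul_le_mul_right _ (card_le_card inter_subset_right)
  have h4 : eAB G (U ∩ Z) V ≤ Z.card * M := by
    calc eAB G (U ∩ Z) V ≤ ∑ _p ∈ U ∩ Z, M :=
          sum_le_sum fun p hp => hU p (inter_subset_left hp)
      _ = (U ∩ Z).card * M := by rw [sum_const, smul_eq_mul]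
      _ ≤ _ := Nat.mul_le_mul_right _ (card_le_card inter_subset_right)
  linarith

theorem exists_tiled_of_twoCores_of_stars {s t : ℕ} (hs : 0 < s) (hst : s < t) :
    ∃ B n₀ : ℕ, ∀ n : ℕ, n₀ ≤ n → ∀ (α : Type) [DecidableEq α] (G : SimpleGraph α)
      (P Q C₁ C₂ D₁ D₂ U V : Finset α) (m : ℕ), n = m * (s + t) →
      TwoCores G P Q n (1 / (1000 * (s + t))) C₁ C₂ D₁ D₂ → U ⊆ P → V ⊆ Q →
      Disjoint U C₂ → Disjoint V D₁ →
      (∀ u ∈ U, (8 * s) * (D₁.card : ℝ) ≤ (8 * s) * degS G u D₁ + n) →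
      (∀ v ∈ V, (8 * s) * (C₂.card : ℝ) ≤ (8 * s) * degS G v C₂ + n) →
      (∀ Z : Finset α, Z.card ≤ B → ∃ p ∈ U \ Z, s ≤ degS G p (V \ Z)) →
      (∀ Z : Finset α, Z.card ≤ B → ∃ q ∈ V \ Z, s ≤ degS G q (U \ Z)) →
      Tiled G P Q s t (P ∪ Q) := by
  obtain ⟨B, e₀, he₀⟩ := exists_tiled_of_stars hs hst
  refine ⟨B, 500 * (s + t) * (e₀ + 4), fun n hn α _ G P Q C₁ C₂ D₁ D₂ U V m hnm hT hUP hVQ hUC hVD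
    hU hV hp hq => ?_⟩
  have hs' : (1 : ℝ) ≤ s := by exact_mod_cast hs
  have ht' : (1 : ℝ) ≤ t := by exact_mod_cast (by omega)
  set ε : ℝ := 1 / (1000 * (s + t)) with hε
  have hn0 : (0 : ℝ) ≤ n := by positivity
  have hεn : (1000 * (s + t)) * (ε * n) = n := by rw [hε]; field_simp
  have hεn' : 0 ≤ ε * n := by positivity
  have hε1 : 2000 * (ε * n) ≤ n := by nlinarith
  have hε16 : ε ≤ 1 / 16 := by
    rw [hε]
    apply one_div_le_one_div_of_le <;> linarith
  have hnR : 500 * ((s : ℝ) + t) * (e₀ + 4) ≤ n := by exact_mod_cast hn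
  set e := ⌈2 * ε * n⌉₊ with he
  have he1 : 2 * ε * n ≤ e := Nat.le_ceil _
  have he2 : (e : ℝ) < 2 * ε * n + 1 := Nat.ceil_lt_add_one (by positivity)
  have hee : e₀ ≤ e := by
    have : 500 * ((s : ℝ) + t) * e₀ ≤ 500 * ((s : ℝ) + t) * (2 * (ε * n)) := by linarith
    have := le_of_mul_le_mul_left this (by positivity)
    exact_mod_cast (by linarith : (e₀ : ℝ) ≤ e)
  have h2000 : 2000 * ((s : ℝ) + t) ≤ n := by
    have : (0 : ℝ) ≤ (s + t) * e₀ := by positivity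
    linarith
  have hed : 29 * (s + t) * e ≤ n / 8 := by
    rw [Nat.le_div_iff_mul_le (by norm_num)]
    have e1 : 29 * ((s : ℝ) + t) * e ≤ 29 * (s + t) * (2 * ε * n + 1) := by gcongr
    exact_mod_cast (by linarith : 29 * ((s : ℝ) + t) * e * 8 ≤ n)
  have hsf : s * (n / (8 * s)) * 8 ≤ n := by
    have := Nat.div_mul_le_self n (8 * s)
    linarith
  have hsf' : (s : ℝ) * ((n / (8 * s) : ℕ) : ℝ) * 8 ≤ n := by exact_mod_cast hsf
  have key : ∀ x y : ℕ, (8 * s) * (x : ℝ) ≤ (8 * s) * y + n → x ≤ y + n / (8 * s) := by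
    intro x y hxy
    have h1 : 8 * s * x ≤ 8 * s * y + n := by exact_mod_cast hxy
    by_contra! hc
    have h2 : n / (8 * s) < x - y := lt_tsub_iff_left.2 hc
    rw [Nat.div_lt_iff_lt_mul (by omega)] at h2
    obtain ⟨z, rfl⟩ : ∃ z, x = y + z := ⟨x - y, by
      have := (Nat.le_add_right _ _).trans hc.le
      omega⟩
    rw [Nat.add_sub_cancel_left] at h2
    linarith
  have hD1 := hT.leD₁
  have hC2 := hT.leC₂
  have hC1 := hT.leC₁
  have hD2 := hT.leD₂
  have hUX : ∀ u : α, (8 * s) * (D₁.card : ℝ) ≤ (8 * s) * degS G u D₁ + n →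
      (n : ℝ) ≤ 8 * degS G u D₁ := by
    intro u hu
    have : (8 * s : ℝ) * (D₁.card - degS G u D₁) ≤ 8 * s * (1 / 8 * n) := by nlinarith
    have := le_of_mul_le_mul_left this (by positivity)
    linarith
  have hVX : ∀ u : α, (8 * s) * (C₂.card : ℝ) ≤ (8 * s) * degS G u C₂ + n →
      (n : ℝ) ≤ 8 * degS G u C₂ := by
    intro u hu
    have : (8 * s : ℝ) * (C₂.card - degS G u C₂) ≤ 8 * s * (1 / 8 * n) := by nlinarith
    have := le_of_mul_le_mul_left this (by positivity)
    linarith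
  set X₁ := P.filter fun u => u ∉ C₂ ∧ n ≤ 8 * degS G u D₁ with hX₁
  set Y₂ := Q.filter fun v => v ∉ D₁ ∧ n ≤ 8 * degS G v C₂ with hY₂
  have hX₁P : X₁ ⊆ P := filter_subset _ _
  have hY₂Q : Y₂ ⊆ Q := filter_subset _ _
  have hUX₁ : U ⊆ X₁ := fun u hu => mem_filter.2 ⟨hUP hu, disjoint_left.1 hUC hu, by
    exact_mod_cast hUX u (hU u hu)⟩
  have hVY₂ : V ⊆ Y₂ := fun u hu => mem_filter.2 ⟨hVQ hu, disjoint_left.1 hVD hu, by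
    exact_mod_cast hVX u (hV u hu)⟩
  have hCX : C₁ ⊆ X₁ := fun u hu => mem_filter.2 ⟨hT.subC₁ hu, disjoint_left.1 hT.disjC hu, by
    have := hT.missC₁ u hu
    exact_mod_cast (by linarith : (n : ℝ) ≤ 8 * degS G u D₁)⟩
  have hDY : D₂ ⊆ Y₂ := fun u hu => mem_filter.2 ⟨hT.subD₂ hu, disjoint_right.1 hT.disjD hu, by
    have := hT.missD₂ u hu
    exact_mod_cast (by linarith : (n : ℝ) ≤ 8 * degS G u C₂)⟩
  have hXC : Disjoint X₁ C₂ := disjoint_left.2 fun u hu => (mem_filter.1 hu).2.1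
  have hYD : Disjoint Y₂ D₁ := disjoint_left.2 fun u hu => (mem_filter.1 hu).2.1
  have hCX2 : C₂ ⊆ P \ X₁ := subset_sdiff.2 ⟨hT.subC₂, hXC.symm⟩
  have hDY1 : D₁ ⊆ Q \ Y₂ := subset_sdiff.2 ⟨hT.subD₁, hYD.symm⟩
  have hX2C : Disjoint (P \ X₁) C₁ := disjoint_of_subset_right hCX sdiff_disjoint
  have hY1D : Disjoint (Q \ Y₂) D₂ := disjoint_of_subset_right hDY sdiff_disjoint
  have hd4 : 4 * (n / 8) ≤ n := by omega
  have n1 : NearBalanced G X₁ (Q \ Y₂) C₁ D₁ e (n / 8) := by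
    refine hT.nearBalanced hε16 hCX hX₁P hXC hDY1 sdiff_subset hY1D he1 hd4 ?_ ?_
    · intro u hu _
      have := (mem_filter.1 hu).2.2
      omega
    · intro v hv hvD
      rw [mem_sdiff, hY₂, mem_filter] at hv
      have h1 := hT.swap.half_le_degS hv.1
      have h2 : 8 * degS G v C₂ < n := by
        by_contra! hc
        exact hv.2 ⟨hv.1, hvD, hc⟩
      have h3 : 8 * (degS G v C₂ : ℝ) < n := by exact_mod_cast h2
      have h4 : n ≤ 8 * degS G v C₁ := by
        exact_mod_cast (by linarith : (n : ℝ) ≤ 8 * degS G v C₁)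
      omega
  have n2 : NearBalanced G (P \ X₁) Y₂ C₂ D₂ e (n / 8) := by
    refine hT.flip.nearBalanced hε16 hCX2 sdiff_subset hX2C hDY hY₂Q hYD he1 hd4 ?_ ?_
    · intro v hv hvD
      rw [mem_sdiff, hX₁, mem_filter] at hv
      have h1 := hT.half_le_degS hv.1
      have h2 : 8 * degS G v D₁ < n := by
        by_contra! hc
        exact hv.2 ⟨hv.1, hvD, hc⟩
      have h3 : 8 * (degS G v D₁ : ℝ) < n := by exact_mod_cast h2
      have h4 : n ≤ 8 * degS G v D₂ := by
        exact_mod_cast (by linarith : (n : ℝ) ≤ 8 * degS G v D₂)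
      omega
    · intro u hu _
      have := (mem_filter.1 hu).2.2
      omega
  have hPX : X₁ ∪ P \ X₁ = P := union_sdiff_of_subset hX₁P
  have hQY : Q \ Y₂ ∪ Y₂ = Q := sdiff_union_of_subset hY₂Q
  have key2 := he₀ e hee α G X₁ (Q \ Y₂) C₁ D₁ (P \ X₁) Y₂ C₂ D₂ U V (n / 8) (n / (8 * s)) m n1 n2
    disjoint_sdiff sdiff_disjoint (by rw [hPX, hQY]; exact hT.disj) hed
    (by rw [← hnm, add_comm, card_sdiff_add_card_eq_card hX₁P, hT.cardP])
    (by rw [← hnm, card_sdiff_add_card_eq_card hY₂Q, hT.cardQ]) hUX₁ hVY₂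
    (fun u hu => key _ _ (hU u hu)) (fun u hu => key _ _ (hV u hu))
    (by exact_mod_cast (by linarith : (e : ℝ) + s * ((n / (8 * s) : ℕ) : ℝ) ≤ D₁.card))
    (by exact_mod_cast (by linarith : (e : ℝ) + s * ((n / (8 * s) : ℕ) : ℝ) ≤ C₂.card)) hp hq
  rwa [hPX, hQY] at key2

/-- If the two pairs are joined by many edges, then the graph can be tiled. -/
theorem exists_tiled_of_twoCores_of_dense {s t : ℕ} (hs : 0 < s) (hst : s < t) {β : ℝ}
    (hβ : 0 < β) :
    ∃ n₀ : ℕ, ∀ n : ℕ, n₀ ≤ n → ∀ (α : Type) [DecidableEq α] (G : SimpleGraph α)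
      (P Q C₁ C₂ D₁ D₂ : Finset α) (m : ℕ), n = m * (s + t) →
      TwoCores G P Q n (1 / (1000 * (s + t))) C₁ C₂ D₁ D₂ → β * n ^ 2 ≤ eAB G C₁ D₂ →
      Tiled G P Q s t (P ∪ Q) := by
  obtain ⟨B, n₁, h₁⟩ := exists_tiled_of_twoCores_of_stars hs hst
  refine ⟨n₁ + ⌈((s : ℝ) + 2 * B) / β⌉₊ + 1, fun n hn α _ G P Q C₁ C₂ D₁ D₂ m hnm hT he => ?_⟩
  have hn1 : ((s : ℝ) + 2 * B) / β < n := by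
    refine (Nat.le_ceil _).trans_lt ?_
    exact Nat.cast_lt.2 (by omega)
  rw [div_lt_iff₀ hβ] at hn1
  have hs' : (1 : ℝ) ≤ s := by exact_mod_cast hs
  have ht' : (1 : ℝ) ≤ t := by exact_mod_cast (by omega)
  have hn0 : (0 : ℝ) < n := by exact_mod_cast (by omega)
  set ε : ℝ := 1 / (1000 * (s + t)) with hε
  have hεn : (1000 * (s + t)) * (ε * n) = n := by rw [hε]; field_simp
  have hεn' : 0 ≤ ε * n := by positivity
  have hsε : 8 * s * (ε * n) ≤ n := by nlinarith
  have hstar : ∀ U V : Finset α, U.card ≤ n → V.card ≤ n → β * n ^ 2 ≤ eAB G U V →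
      ∀ Z : Finset α, Z.card ≤ B → ∃ p ∈ U \ Z, s ≤ degS G p (V \ Z) := by
    intro U V hU hV he Z hZ
    by_contra! hc
    have h1 := eAB_le_of_forall_degS_lt hc (fun u _ => (degS_le_card u V).trans hV)
      (fun u _ => (degS_le_card u U).trans hU)
    have h2 : eAB G U V ≤ (s + 2 * B) * n := by
      have e1 : (s - 1) * U.card ≤ s * n := Nat.mul_le_mul (by omega) hU
      have e2 : 2 * Z.card * n ≤ 2 * B * n := by gcongr
      linarith
    have h3 : (eAB G U V : ℝ) ≤ (s + 2 * B) * n := by exact_mod_cast h2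
    nlinarith
  have hC : C₁.card ≤ n := hT.cardP ▸ card_le_card hT.subC₁
  have hD : D₂.card ≤ n := hT.cardQ ▸ card_le_card hT.subD₂
  refine h₁ n (by omega) α G P Q C₁ C₂ D₁ D₂ C₁ D₂ m hnm hT hT.subC₁ hT.subD₂ hT.disjC
    hT.disjD.symm ?_ ?_ (hstar C₁ D₂ hC hD he) (hstar D₂ C₁ hD hC (by rwa [eAB_comm]))
  · intro u hu
    nlinarith [hT.missC₁ u hu]
  · intro u hu
    nlinarith [hT.missD₂ u hu]

/-- Two nearly complete pairs whose cores are extended to the sets `U₁, U₂, V₁, V₂` of all vertices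
having few neighbours in the wrong core; the remaining vertices have many neighbours in both
opposite cores. -/
structure FourParts {α : Type*} [DecidableEq α] (G : SimpleGraph α) (P Q : Finset α) (n : ℕ)
    (ε ρ : ℝ) (C₁ C₂ D₁ D₂ U₁ U₂ V₁ V₂ : Finset α) : Prop
    extends TwoCores G P Q n ε C₁ C₂ D₁ D₂ where
  subU₁ : U₁ ⊆ P
  subU₂ : U₂ ⊆ P
  subV₁ : V₁ ⊆ Q
  subV₂ : V₂ ⊆ Q
  disjU : Disjoint U₁ U₂
  disjV : Disjoint V₁ V₂
  C₁U : C₁ ⊆ U₁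
  C₂U : C₂ ⊆ U₂
  D₁V : D₁ ⊆ V₁
  D₂V : D₂ ⊆ V₂
  smallU₁ : ∀ u ∈ U₁, (degS G u D₂ : ℝ) ≤ ρ * n
  smallU₂ : ∀ u ∈ U₂, (degS G u D₁ : ℝ) ≤ ρ * n
  smallV₁ : ∀ v ∈ V₁, (degS G v C₂ : ℝ) ≤ ρ * n
  smallV₂ : ∀ v ∈ V₂, (degS G v C₁ : ℝ) ≤ ρ * n
  restU₁ : ∀ u ∈ P, u ∉ U₁ → u ∉ U₂ → ρ / 2 * n ≤ degS G u D₁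
  restU₂ : ∀ u ∈ P, u ∉ U₁ → u ∉ U₂ → ρ / 2 * n ≤ degS G u D₂
  restV₁ : ∀ v ∈ Q, v ∉ V₁ → v ∉ V₂ → ρ / 2 * n ≤ degS G v C₁
  restV₂ : ∀ v ∈ Q, v ∉ V₁ → v ∉ V₂ → ρ / 2 * n ≤ degS G v C₂

section

variable {α : Type*} [DecidableEq α] {G : SimpleGraph α}
  {P Q C₁ C₂ D₁ D₂ U₁ U₂ V₁ V₂ : Finset α} {n : ℕ} {ε ρ : ℝ}

/-- Restricting the cores to the vertices of small degree into the wrong core. -/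
theorem TwoCores.exists_fourParts (h : TwoCores G P Q n ε C₁ C₂ D₁ D₂) (hn : 0 < n) (hε : 0 < ε)
    (hερ : 2 * ε ≤ ρ) (hρ : ρ ≤ 1 / 16) (he₁ : (eAB G C₁ D₂ : ℝ) ≤ ε * ρ * n ^ 2)
    (he₂ : (eAB G C₂ D₁ : ℝ) ≤ ε * ρ * n ^ 2) :
    ∃ C₁ C₂ D₁ D₂ U₁ U₂ V₁ V₂, FourParts G P Q n (2 * ε) ρ C₁ C₂ D₁ D₂ U₁ U₂ V₁ V₂ := by
  have hn' : (0 : ℝ) < n := by exact_mod_cast hn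
  have hρ0 : 0 < ρ := by linarith
  have hx : 0 < ρ * n := by positivity
  have hρn : 16 * (ρ * n) ≤ n := by nlinarith
  have hερn : 2 * (ε * n) ≤ ρ * n := by nlinarith
  have hεn : 0 < ε * n := by positivity
  have hq : ε * ρ * (n : ℝ) ^ 2 / (ρ * n) = ε * n := by field_simp
  have c1 := card_filter_le_degS C₁ D₂ (ρ * n) hx he₁
  have c2 := card_filter_le_degS C₂ D₁ (ρ * n) hx he₂
  rw [eAB_comm] at he₁ he₂
  have d1 := card_filter_le_degS D₁ C₂ (ρ * n) hx he₂
  have d2 := card_filter_le_degS D₂ C₁ (ρ * n) hx he₁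
  rw [hq] at c1 c2 d1 d2
  have miss : ∀ (u : α) (S T : Finset α), T ⊆ S → (S.card : ℝ) ≤ degS G u S + ε * n →
      (T.card : ℝ) ≤ degS G u T + 2 * ε * n := by
    intro u S T hTS hS
    have h1 := degS_le_add_of_sdiff (G := G) u S T
    have h2 := card_sdiff_add_card_eq_card hTS
    have h3 : (degS G u S : ℝ) + T.card ≤ degS G u T + S.card := by exact_mod_cast (by omega)
    linarith
  have rest : ∀ (u : α) (S T : Finset α), T ⊆ S → (S.card : ℝ) - ε * n ≤ T.card →
      ¬ (degS G u S : ℝ) ≤ ρ * n → ρ / 2 * n ≤ degS G u T := by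
    intro u S T hTS hS hu
    have h1 := degS_le_add_of_sdiff (G := G) u S T
    have h2 := card_sdiff_add_card_eq_card hTS
    have h3 : (degS G u S : ℝ) + T.card ≤ degS G u T + S.card := by exact_mod_cast (by omega)
    linarith
  have small : ∀ (u : α) (S T : Finset α), T ⊆ S → (degS G u S : ℝ) ≤ ρ * n →
      (degS G u T : ℝ) ≤ ρ * n := fun u S T hTS hS =>
    (by exact_mod_cast degS_mono u hTS : (degS G u T : ℝ) ≤ degS G u S).trans hS
  refine ⟨C₁.filter fun u => (degS G u D₂ : ℝ) ≤ ρ * n,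
    C₂.filter fun u => (degS G u D₁ : ℝ) ≤ ρ * n, D₁.filter fun u => (degS G u C₂ : ℝ) ≤ ρ * n,
    D₂.filter fun u => (degS G u C₁ : ℝ) ≤ ρ * n, P.filter fun u => (degS G u D₂ : ℝ) ≤ ρ * n,
    P.filter fun u => (degS G u D₁ : ℝ) ≤ ρ * n, Q.filter fun u => (degS G u C₂ : ℝ) ≤ ρ * n,
    Q.filter fun u => (degS G u C₁ : ℝ) ≤ ρ * n, ⟨h.disj, h.cardP, h.cardQ, h.degP, h.degQ,
    (filter_subset _ _).trans h.subC₁, (filter_subset _ _).trans h.subC₂,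
    (filter_subset _ _).trans h.subD₁, (filter_subset _ _).trans h.subD₂,
    disjoint_filter_filter h.disjC, disjoint_filter_filter h.disjD, ?_, ?_, ?_, ?_, ?_, ?_, ?_, ?_⟩,
    filter_subset _ _, filter_subset _ _, filter_subset _ _, filter_subset _ _, ?_, ?_,
    filter_subset_filter _ h.subC₁, filter_subset_filter _ h.subC₂,
    filter_subset_filter _ h.subD₁, filter_subset_filter _ h.subD₂, ?_, ?_, ?_, ?_, ?_, ?_, ?_, ?_⟩
  · linarith [h.leC₁]
  · linarith [h.leC₂]
  · linarith [h.leD₁]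
  · linarith [h.leD₂]
  · exact fun u hu => miss u _ _ (filter_subset _ _) (h.missC₁ u (filter_subset _ _ hu))
  · exact fun u hu => miss u _ _ (filter_subset _ _) (h.missC₂ u (filter_subset _ _ hu))
  · exact fun u hu => miss u _ _ (filter_subset _ _) (h.missD₁ u (filter_subset _ _ hu))
  · exact fun u hu => miss u _ _ (filter_subset _ _) (h.missD₂ u (filter_subset _ _ hu))
  · refine disjoint_left.2 fun u hu hu' => ?_
    rw [mem_filter] at hu hu'
    linarith [h.half_le_degS hu.1]
  · refine disjoint_left.2 fun u hu hu' => ?_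
    rw [mem_filter] at hu hu'
    linarith [h.swap.half_le_degS hu.1]
  · exact fun u hu => small u _ _ (filter_subset _ _) (mem_filter.1 hu).2
  · exact fun u hu => small u _ _ (filter_subset _ _) (mem_filter.1 hu).2
  · exact fun u hu => small u _ _ (filter_subset _ _) (mem_filter.1 hu).2
  · exact fun u hu => small u _ _ (filter_subset _ _) (mem_filter.1 hu).2
  · exact fun u hu h1 h2 => rest u _ _ (filter_subset _ _) d1 fun hh => h2 (mem_filter.2 ⟨hu, hh⟩)
  · exact fun u hu h1 h2 => rest u _ _ (filter_subset _ _) d2 fun hh => h1 (mem_filter.2 ⟨hu, hh⟩)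
  · exact fun u hu h1 h2 => rest u _ _ (filter_subset _ _) c1 fun hh => h2 (mem_filter.2 ⟨hu, hh⟩)
  · exact fun u hu h1 h2 => rest u _ _ (filter_subset _ _) c2 fun hh => h1 (mem_filter.2 ⟨hu, hh⟩)

namespace FourParts

/-- Exchange the two sides of the graph. -/
theorem swap (h : FourParts G P Q n ε ρ C₁ C₂ D₁ D₂ U₁ U₂ V₁ V₂) :
    FourParts G Q P n ε ρ D₁ D₂ C₁ C₂ V₁ V₂ U₁ U₂ :=
  ⟨h.toTwoCores.swap, h.subV₁, h.subV₂, h.subU₁, h.subU₂, h.disjV, h.disjU, h.D₁V, h.D₂V, h.C₁U,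
    h.C₂U, h.smallV₁, h.smallV₂, h.smallU₁, h.smallU₂, h.restV₁, h.restV₂, h.restU₁, h.restU₂⟩

/-- Exchange the two pairs. -/
theorem flip (h : FourParts G P Q n ε ρ C₁ C₂ D₁ D₂ U₁ U₂ V₁ V₂) :
    FourParts G P Q n ε ρ C₂ C₁ D₂ D₁ U₂ U₁ V₂ V₁ :=
  ⟨h.toTwoCores.flip, h.subU₂, h.subU₁, h.subV₂, h.subV₁, h.disjU.symm, h.disjV.symm, h.C₂U, h.C₁U,
    h.D₂V, h.D₁V, h.smallU₂, h.smallU₁, h.smallV₂, h.smallV₁,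
    fun u hu h1 h2 => h.restU₂ u hu h2 h1, fun u hu h1 h2 => h.restU₁ u hu h2 h1,
    fun u hu h1 h2 => h.restV₂ u hu h2 h1, fun u hu h1 h2 => h.restV₁ u hu h2 h1⟩

theorem card_U₁_le (h : FourParts G P Q n ε ρ C₁ C₂ D₁ D₂ U₁ U₂ V₁ V₂) :
    (U₁.card : ℝ) ≤ (1 / 2 + ε) * n :=
  h.card_le h.subU₁ (disjoint_of_subset_right h.C₂U h.disjU)

theorem le_card_U₁ (h : FourParts G P Q n ε ρ C₁ C₂ D₁ D₂ U₁ U₂ V₁ V₂) :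
    (1 / 2 - ε) * n ≤ U₁.card :=
  h.leC₁.trans (by exact_mod_cast card_le_card h.C₁U)

theorem degS_V₂_le (h : FourParts G P Q n ε ρ C₁ C₂ D₁ D₂ U₁ U₂ V₁ V₂) {u : α} (hu : u ∈ U₁) :
    (degS G u V₂ : ℝ) ≤ (ρ + 2 * ε) * n := by
  have h1 := degS_le_add_of_sdiff (G := G) u V₂ D₂
  have h2 := card_sdiff_add_card_eq_card h.D₂V
  have h3 : (degS G u V₂ : ℝ) + D₂.card ≤ degS G u D₂ + V₂.card := by exact_mod_cast (by omega)
  linarith [h.leD₂, h.flip.swap.card_U₁_le, h.smallU₁ u hu]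

theorem card_D₁_le (h : FourParts G P Q n ε ρ C₁ C₂ D₁ D₂ U₁ U₂ V₁ V₂) {u : α} (hu : u ∈ U₁) :
    (D₁.card : ℝ) ≤ degS G u D₁ + (ρ + 3 * ε) * n := by
  linarith [h.half_le_degS (h.subU₁ hu), h.smallU₁ u hu, h.toTwoCores.swap.card_C₁_le]

/-- If there are few edges between `U₁` and `V₂`, then `U₁` is not much larger than `n / 2`. -/
theorem two_mul_card_U₁_add_le (h : FourParts G P Q n ε ρ C₁ C₂ D₁ D₂ U₁ U₂ V₁ V₂) {s : ℕ}
    (hn : 0 < n) (hs : 0 < s) (hε : ε * (10 * s) ≤ 1)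
    (hdeg : ∀ v ∈ Q, n + 3 * s ≤ 2 * degS G v P + 2)
    (he : 2 * (eAB G U₁ V₂ : ℝ) ≤ (s - 9 / 10) * n) : 2 * U₁.card + s ≤ n := by
  have hn' : (0 : ℝ) < n := by exact_mod_cast hn
  obtain ⟨v, hv, hvs⟩ : ∃ v ∈ V₂, degS G v U₁ < s := by
    by_contra! hc
    have h1 : V₂.card * s ≤ eAB G V₂ U₁ := by
      rw [← smul_eq_mul, ← sum_const]
      exact sum_le_sum hc
    rw [eAB_comm] at h1
    have h2 : (V₂.card : ℝ) * s ≤ eAB G U₁ V₂ := by exact_mod_cast h1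
    have h3 := h.flip.swap.le_card_U₁
    have hs' : (1 : ℝ) ≤ s := by exact_mod_cast hs
    have h4 := mul_le_mul_of_nonneg_right h3 (by positivity : (0 : ℝ) ≤ s)
    nlinarith [mul_le_mul_of_nonneg_right hε hn'.le]
  have h1 := hdeg v (h.subV₂ hv)
  have h2 := degS_le_add_of_sdiff (G := G) v P U₁
  have h3 := card_sdiff_add_card_eq_card h.subU₁
  rw [h.cardP] at h3
  omega

end FourParts

end

/-- Either the stars between `U₁` and `V₂` allow to tile the graph, or there are few edges between
these sets. -/
theorem exists_tiled_or_eAB_le {s t : ℕ} (hs : 0 < s) (hst : s < t) :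
    ∃ B n₀ : ℕ, ∀ n : ℕ, n₀ ≤ n → ∀ (ε ρ : ℝ), 0 < ε → ε ≤ ρ → 1000 * (s + t) * ε ≤ 1 →
      1000 * s * (B + 1) * ρ ≤ 1 → ∀ (α : Type) [DecidableEq α] (G : SimpleGraph α)
      (P Q C₁ C₂ D₁ D₂ U₁ U₂ V₁ V₂ : Finset α) (m : ℕ), n = m * (s + t) →
      FourParts G P Q n ε ρ C₁ C₂ D₁ D₂ U₁ U₂ V₁ V₂ →
      Tiled G P Q s t (P ∪ Q) ∨ 2 * (eAB G U₁ V₂ : ℝ) ≤ (s - 9 / 10) * n := by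
  obtain ⟨B, n₀, h₀⟩ := exists_tiled_of_twoCores_of_stars hs hst
  refine ⟨B, n₀, fun n hn ε ρ hε hερ hε1 hρ1 α _ G P Q C₁ C₂ D₁ D₂ U₁ U₂ V₁ V₂ m hnm h => ?_⟩
  have hs' : (1 : ℝ) ≤ s := by exact_mod_cast hs
  have ht' : (1 : ℝ) ≤ t := by exact_mod_cast (by omega)
  have hn0 : (0 : ℝ) ≤ n := by positivity
  have hρ : 0 < ρ := hε.trans_le hερ
  have hB : (0 : ℝ) ≤ B := by positivity
  have hsρ : 1000 * s * ρ ≤ 1 := by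
    have : 0 ≤ s * B * ρ := by positivity
    nlinarith
  have hBρ : 1000 * B * ρ ≤ 1 := by
    have h1 : 0 ≤ (s - 1) * ((B + 1) * ρ) := mul_nonneg (by linarith) (by positivity)
    nlinarith
  have hsρn := mul_le_mul_of_nonneg_right hsρ hn0
  have hBρn := mul_le_mul_of_nonneg_right hBρ hn0
  have hερn := mul_le_mul_of_nonneg_right hερ hn0
  have hsε := mul_le_mul_of_nonneg_left hερn (by positivity : (0 : ℝ) ≤ s)
  have hBε := mul_le_mul_of_nonneg_left hερn hB
  have hεn : 0 ≤ ε * n := by positivity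
  set M := ⌊(ρ + 2 * ε) * n⌋₊ with hM
  have hM' : (M : ℝ) ≤ (ρ + 2 * ε) * n := Nat.floor_le (by positivity)
  have few : ∀ U V Z : Finset α, (U.card : ℝ) ≤ (1 / 2 + ε) * n → Z.card ≤ B →
      (∀ u ∈ U, (degS G u V : ℝ) ≤ (ρ + 2 * ε) * n) →
      (∀ v ∈ V, (degS G v U : ℝ) ≤ (ρ + 2 * ε) * n) →
      (∀ p ∈ U \ Z, degS G p (V \ Z) < s) → 2 * (eAB G U V : ℝ) ≤ (s - 9 / 10) * n := by
    intro U V Z hUc hZ hU hV hstar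
    have h1 := eAB_le_of_forall_degS_lt hstar (fun u hu => Nat.le_floor (hU u hu))
      (fun u hu => Nat.le_floor (hV u hu))
    rw [← hM] at h1
    have h2 : (eAB G U V : ℝ) ≤ (s - 1) * U.card + 2 * Z.card * M := by
      have : ((s - 1 : ℕ) : ℝ) = s - 1 := by push_cast [hs]; ring
      rw [← this]
      exact_mod_cast h1
    have h3 : (Z.card : ℝ) * M ≤ B * ((ρ + 2 * ε) * n) := by gcongr
    have h4 : (s - 1 : ℝ) * U.card ≤ (s - 1) * ((1 / 2 + ε) * n) :=
      mul_le_mul_of_nonneg_left hUc (by linarith)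
    nlinarith
  rw [or_iff_not_imp_left]
  intro hnot
  by_contra hcon
  refine hnot (h₀ n hn α G P Q C₁ C₂ D₁ D₂ U₁ V₂ m hnm (h.toTwoCores.mono ?_) h.subU₁ h.subV₂
    (disjoint_of_subset_right h.C₂U h.disjU) (disjoint_of_subset_right h.D₁V h.disjV.symm)
    ?_ ?_ ?_ ?_)
  · rw [le_div_iff₀ (by positivity)]
    linarith
  · intro u hu
    have := mul_le_mul_of_nonneg_left (h.card_D₁_le hu) (by positivity : (0 : ℝ) ≤ 8 * s)
    linarith
  · intro u hu
    have := mul_le_mul_of_nonneg_left (h.flip.swap.card_D₁_le hu) (by positivity : (0 : ℝ) ≤ 8 * s)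
    linarith
  · intro Z hZ
    by_contra! hc
    exact hcon (few U₁ V₂ Z h.card_U₁_le hZ (fun u hu => h.degS_V₂_le hu)
      (fun u hu => h.flip.swap.degS_V₂_le hu) hc)
  · intro Z hZ
    by_contra! hc
    refine hcon ?_
    rw [eAB_comm]
    exact few V₂ U₁ Z h.flip.swap.card_U₁_le hZ (fun u hu => h.flip.swap.degS_V₂_le hu)
      (fun u hu => h.degS_V₂_le hu) hc

/-- If the vertices of a bounded set see many pairs of `U₁ × U₂`, then `s` of them have `t` common
neighbours in both `U₁` and `U₂`. -/
theorem exists_common_of_sum {α : Type*} [DecidableEq α] {G : SimpleGraph α} {V₀ U₁ U₂ : Finset α}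
    {s t b n : ℕ} (hb : V₀.card ≤ b) (h₁ : U₁.card ≤ n) (h₂ : U₂.card ≤ n)
    (h : (s - 1) * (U₁.card * U₂.card) + b * (2 ^ b * (t * n)) <
      ∑ v ∈ V₀, degS G v U₁ * degS G v U₂) :
    ∃ S ⊆ V₀, S.card = s ∧ t ≤ (U₁.filter fun u => ∀ v ∈ S, G.Adj v u).card ∧
      t ≤ (U₂.filter fun u => ∀ v ∈ S, G.Adj v u).card := by
  by_contra! hc
  refine h.not_ge ?_
  have e1 : ∑ v ∈ V₀, degS G v U₁ * degS G v U₂ =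
      ∑ p ∈ U₁ ×ˢ U₂, (V₀.filter fun v => G.Adj v p.1 ∧ G.Adj v p.2).card := by
    simp_rw [card_filter _ V₀]
    rw [sum_comm]
    refine sum_congr rfl fun v _ => ?_
    rw [← card_filter, degS, degS, ← card_product, ← filter_product]
  have e2 : ∀ p : α × α, (V₀.filter fun v => G.Adj v p.1 ∧ G.Adj v p.2).card ≤ (s - 1) +
      b * ((V₀.powersetCard s).filter fun S => ∀ v ∈ S, G.Adj v p.1 ∧ G.Adj v p.2).card := by
    intro p
    by_cases hp : (V₀.filter fun v => G.Adj v p.1 ∧ G.Adj v p.2).card ≤ s - 1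
    · exact hp.trans (Nat.le_add_right _ _)
    obtain ⟨S, hS, hSc⟩ := exists_subset_card_eq
      (s := V₀.filter fun v => G.Adj v p.1 ∧ G.Adj v p.2) (n := s) (by omega)
    have h1 : 0 < ((V₀.powersetCard s).filter fun S => ∀ v ∈ S, G.Adj v p.1 ∧ G.Adj v p.2).card :=
      card_pos.2 ⟨S, mem_filter.2 ⟨mem_powersetCard.2 ⟨hS.trans (filter_subset _ _), hSc⟩,
        fun v hv => (mem_filter.1 (hS hv)).2⟩⟩
    have h2 := (card_filter_le V₀ fun v => G.Adj v p.1 ∧ G.Adj v p.2).trans hb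
    nlinarith
  have e3 : ∑ p ∈ U₁ ×ˢ U₂,
      ((V₀.powersetCard s).filter fun S => ∀ v ∈ S, G.Adj v p.1 ∧ G.Adj v p.2).card =
      ∑ S ∈ V₀.powersetCard s, (U₁.filter fun u => ∀ v ∈ S, G.Adj v u).card *
        (U₂.filter fun u => ∀ v ∈ S, G.Adj v u).card := by
    simp_rw [card_filter _ (V₀.powersetCard s)]
    rw [sum_comm]
    refine sum_congr rfl fun S _ => ?_
    rw [← card_filter, ← card_product, ← filter_product]
    refine congrArg card (filter_congr fun p _ => ?_)
    exact ⟨fun hh => ⟨fun v hv => (hh v hv).1, fun v hv => (hh v hv).2⟩,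
      fun hh v hv => ⟨hh.1 v hv, hh.2 v hv⟩⟩
  have e4 : ∑ S ∈ V₀.powersetCard s, (U₁.filter fun u => ∀ v ∈ S, G.Adj v u).card *
        (U₂.filter fun u => ∀ v ∈ S, G.Adj v u).card ≤ 2 ^ b * (t * n) := by
    calc _ ≤ ∑ _S ∈ V₀.powersetCard s, t * n := by
          refine sum_le_sum fun S hS => ?_
          rw [mem_powersetCard] at hS
          have c1 := (card_filter_le U₁ fun u => ∀ v ∈ S, G.Adj v u).trans h₁
          have c2 := (card_filter_le U₂ fun u => ∀ v ∈ S, G.Adj v u).trans h₂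
          rcases lt_or_ge (U₁.filter fun u => ∀ v ∈ S, G.Adj v u).card t with h3 | h3
          · exact Nat.mul_le_mul h3.le c2
          · rw [mul_comm]
            exact Nat.mul_le_mul (hc S hS.1 hS.2 h3).le c1
      _ = (V₀.powersetCard s).card * (t * n) := by rw [sum_const, smul_eq_mul]
      _ ≤ _ := by
          refine Nat.mul_le_mul_right _ ?_
          calc _ ≤ V₀.powerset.card := card_le_card fun S hS =>
                mem_powerset.2 (mem_powersetCard.1 hS).1
            _ = 2 ^ V₀.card := card_powerset _
            _ ≤ _ := Nat.pow_le_pow_right (by norm_num) hb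
  rw [e1]
  calc _ ≤ _ := sum_le_sum fun p _ => e2 p
    _ = (s - 1) * (U₁.card * U₂.card) + b * ∑ p ∈ U₁ ×ˢ U₂,
        ((V₀.powersetCard s).filter fun S => ∀ v ∈ S, G.Adj v p.1 ∧ G.Adj v p.2).card := by
      rw [sum_add_distrib, ← mul_sum, sum_const, card_product, smul_eq_mul, mul_comm]
    _ ≤ _ := by
      rw [e3]
      exact Nat.add_le_add_left (Nat.mul_le_mul_left _ e4) _

theorem FourParts.le_sum {α : Type*} [DecidableEq α] {G : SimpleGraph α}
    {P Q C₁ C₂ D₁ D₂ U₁ U₂ V₁ V₂ : Finset α} {n s : ℕ} {ε ρ : ℝ}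
    (h : FourParts G P Q n ε ρ C₁ C₂ D₁ D₂ U₁ U₂ V₁ V₂) (hs : 0 < s) (hε : 0 ≤ ε)
    (hεs : 100 * s * ε ≤ 1) (hdeg : ∀ u ∈ P, n + 3 * s ≤ 2 * degS G u Q + 2)
    (he₁ : 2 * (eAB G U₁ V₂ : ℝ) ≤ (s - 9 / 10) * n)
    (he₂ : 2 * (eAB G U₂ V₁ : ℝ) ≤ (s - 9 / 10) * n) :
    ((s : ℝ) - 1 / 2) * (U₁.card * U₂.card) ≤
      ∑ v ∈ Q \ (V₁ ∪ V₂), (degS G v U₁ : ℝ) * degS G v U₂ := by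
  have hs' : (1 : ℝ) ≤ s := by exact_mod_cast hs
  have hn0 : (0 : ℝ) ≤ n := by positivity
  set V₀ := Q \ (V₁ ∪ V₂) with hV₀
  have hQ : V₁ ∪ V₂ ∪ V₀ = Q := union_sdiff_of_subset (union_subset h.subV₁ h.subV₂)
  have hd0 : Disjoint (V₁ ∪ V₂) V₀ := disjoint_sdiff
  have hc : V₁.card + V₂.card + V₀.card = n := by
    rw [← h.cardQ, ← hQ, card_union_of_disjoint hd0, card_union_of_disjoint h.disjV]
  have hc' : (V₁.card : ℝ) + V₂.card + V₀.card = n := by exact_mod_cast hc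
  have key : ∀ U ⊆ P, (U.card : ℝ) * (n + 3 * s - 2) ≤
      2 * ((eAB G U V₁ : ℝ) + eAB G U V₂ + eAB G U V₀) := by
    intro U hU
    have h1 : eAB G U Q = eAB G U V₁ + eAB G U V₂ + eAB G U V₀ := by
      rw [← eAB_union_right _ h.disjV, ← eAB_union_right _ hd0, hQ]
    have h2 : U.card * (n + 3 * s) ≤ 2 * eAB G U Q + U.card * 2 := by
      unfold eAB
      rw [mul_sum, ← smul_eq_mul, ← sum_const, ← smul_eq_mul U.card, ← sum_const, ← sum_add_distrib]
      exact sum_le_sum fun u hu => hdeg u (hU hu)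
    rw [h1] at h2
    have h3 : (U.card : ℝ) * (n + 3 * s) ≤
        2 * ((eAB G U V₁ : ℝ) + eAB G U V₂ + eAB G U V₀) + U.card * 2 := by exact_mod_cast h2
    linarith
  have k1 := key U₁ h.subU₁
  have k2 := key U₂ h.subU₂
  have m1 : (eAB G U₁ V₁ : ℝ) ≤ U₁.card * V₁.card := by exact_mod_cast eAB_le_mul _ _
  have m2 : (eAB G U₂ V₂ : ℝ) ≤ U₂.card * V₂.card := by exact_mod_cast eAB_le_mul _ _
  have hlow : ((U₂.card : ℝ) * eAB G U₁ V₀ + U₁.card * eAB G U₂ V₀) -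
      U₁.card * U₂.card * V₀.card ≤ ∑ v ∈ V₀, (degS G v U₁ : ℝ) * degS G v U₂ := by
    have e : ((U₂.card : ℝ) * eAB G U₁ V₀ + U₁.card * eAB G U₂ V₀) -
        U₁.card * U₂.card * V₀.card = ∑ v ∈ V₀, ((U₂.card : ℝ) * degS G v U₁ +
          U₁.card * degS G v U₂ - U₁.card * U₂.card) := by
      rw [sum_sub_distrib, sum_add_distrib, ← mul_sum, ← mul_sum, eAB_comm U₁, eAB_comm U₂,
        sum_const, nsmul_eq_mul]
      unfold eAB
      push_cast
      ring
    rw [e]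
    refine sum_le_sum fun v _ => ?_
    have a1 : (degS G v U₁ : ℝ) ≤ U₁.card := by exact_mod_cast degS_le_card _ _
    have a2 : (degS G v U₂ : ℝ) ≤ U₂.card := by exact_mod_cast degS_le_card _ _
    nlinarith
  have q1 := h.le_card_U₁
  have q2 := h.flip.le_card_U₁
  have q3 : (U₁.card : ℝ) + U₂.card ≤ n := by
    rw [← Nat.cast_add, ← card_union_of_disjoint h.disjU, ← h.cardP]
    exact_mod_cast card_le_card (union_subset h.subU₁ h.subU₂)
  have hε1 : ε ≤ 1 / 100 := by nlinarith
  have q4 : (1 / 4 - ε) * n ^ 2 ≤ (U₁.card : ℝ) * U₂.card := by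
    have : 0 ≤ (1 / 2 - ε) * n := mul_nonneg (by linarith) hn0
    have := mul_le_mul q1 q2 this (by positivity)
    nlinarith [mul_nonneg (sq_nonneg ε) (sq_nonneg (n : ℝ))]
  set a₁ := (U₁.card : ℝ)
  set a₂ := (U₂.card : ℝ)
  have p1 : (0 : ℝ) ≤ a₁ := by positivity
  have p2 : (0 : ℝ) ≤ a₂ := by positivity
  have r1 : a₂ * (a₁ * (n + 3 * s - 2)) ≤ a₂ * (2 * (a₁ * V₁.card + eAB G U₁ V₂ + eAB G U₁ V₀)) :=
    mul_le_mul_of_nonneg_left (by linarith) p2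
  have r2 : a₁ * (a₂ * (n + 3 * s - 2)) ≤ a₁ * (2 * (eAB G U₂ V₁ + a₂ * V₂.card + eAB G U₂ V₀)) :=
    mul_le_mul_of_nonneg_left (by linarith) p1
  have r3 := mul_le_mul_of_nonneg_left he₁ p2
  have r4 := mul_le_mul_of_nonneg_left he₂ p1
  have r5 : (a₁ + a₂) * ((s - 9 / 10) * n) ≤ n * ((s - 9 / 10) * n) :=
    mul_le_mul_of_nonneg_right q3 (mul_nonneg (by linarith) hn0)
  have r6 : (2 * s - 3 / 2) * ((1 / 4 - ε) * n ^ 2) ≤ (2 * s - 3 / 2) * (a₁ * a₂) :=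
    mul_le_mul_of_nonneg_left q4 (by linarith)
  have r7 : ((s : ℝ) - 9 / 10) / 2 * n ^ 2 ≤ (2 * s - 3 / 2) * (1 / 4 - ε) * n ^ 2 :=
    mul_le_mul_of_nonneg_right (by nlinarith) (sq_nonneg _)
  have r8 : a₁ * a₂ * (V₁.card + V₂.card + V₀.card) = a₁ * a₂ * n := by rw [hc']
  linarith

/-- There are `s` exceptional vertices with many common neighbours in both `U₁` and `U₂`. -/
theorem exists_exceptional {s : ℕ} (hs : 0 < s) (t : ℕ) {ρ : ℝ} (hρ : 0 < ρ) :
    ∃ n₀ : ℕ, ∀ n : ℕ, n₀ ≤ n → ∀ ε : ℝ, 0 ≤ ε → 100 * s * ε ≤ 1 →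
      ∀ (α : Type) [DecidableEq α] (G : SimpleGraph α) (P Q C₁ C₂ D₁ D₂ U₁ U₂ V₁ V₂ : Finset α),
      FourParts G P Q n ε ρ C₁ C₂ D₁ D₂ U₁ U₂ V₁ V₂ →
      (∀ u ∈ P, n + 3 * s ≤ 2 * degS G u Q + 2) →
      2 * (eAB G U₁ V₂ : ℝ) ≤ (s - 9 / 10) * n → 2 * (eAB G U₂ V₁ : ℝ) ≤ (s - 9 / 10) * n →
      ∃ S ⊆ Q \ (V₁ ∪ V₂), S.card = s ∧ t ≤ (U₁.filter fun u => ∀ v ∈ S, G.Adj v u).card ∧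
        t ≤ (U₂.filter fun u => ∀ v ∈ S, G.Adj v u).card := by
  set b := ⌈4 * s / ρ ^ 2⌉₊ with hb
  have hbρ : 4 * s ≤ b * ρ ^ 2 := by
    have := Nat.le_ceil (4 * s / ρ ^ 2)
    rwa [div_le_iff₀ (by positivity)] at this
  refine ⟨32 * (b * (2 ^ b * t)) + 1, fun n hn ε hε hεs α _ G P Q C₁ C₂ D₁ D₂ U₁ U₂ V₁ V₂ h hdeg
    he₁ he₂ => ?_⟩
  have hs' : (1 : ℝ) ≤ s := by exact_mod_cast hs
  have hsc : ((s - 1 : ℕ) : ℝ) = s - 1 := by push_cast [hs]; ring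
  have hn' : 32 * ((b : ℝ) * (2 ^ b * t)) + 1 ≤ n := by exact_mod_cast hn
  set K : ℝ := b * (2 ^ b * t) with hK
  have hK0 : 0 ≤ K := by positivity
  have hn0 : (0 : ℝ) < n := by linarith
  have hKn : 32 * (K * n) < n ^ 2 := by nlinarith
  have hU₁ : U₁.card ≤ n := h.cardP ▸ card_le_card h.subU₁
  have hU₂ : U₂.card ≤ n := h.cardP ▸ card_le_card h.subU₂
  have hU₁' : (U₁.card : ℝ) ≤ n := by exact_mod_cast hU₁
  have hU₂' : (U₂.card : ℝ) ≤ n := by exact_mod_cast hU₂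
  obtain ⟨V₀, hV₀, hc, hsum⟩ : ∃ V₀ ⊆ Q \ (V₁ ∪ V₂), V₀.card ≤ b ∧
      ((s : ℝ) - 1) * (U₁.card * U₂.card) + K * n <
        ∑ v ∈ V₀, (degS G v U₁ : ℝ) * degS G v U₂ := by
    rcases le_total (Q \ (V₁ ∪ V₂)).card b with hle | hle
    · refine ⟨_, Subset.rfl, hle, lt_of_lt_of_le ?_ (h.le_sum hs hε hεs hdeg he₁ he₂)⟩
      have hε1 : ε ≤ 1 / 100 := by nlinarith
      have q1 : n / 4 ≤ (U₁.card : ℝ) := by nlinarith [h.le_card_U₁]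
      have q2 : n / 4 ≤ (U₂.card : ℝ) := by nlinarith [h.flip.le_card_U₁]
      have := mul_le_mul q1 q2 (by positivity) (by positivity)
      nlinarith
    · obtain ⟨V₀, h1, h2⟩ := exists_subset_card_eq hle
      refine ⟨V₀, h1, h2.le, ?_⟩
      have h3 : ∀ v ∈ V₀, (ρ / 2 * n) * (ρ / 2 * n) ≤ (degS G v U₁ : ℝ) * degS G v U₂ := by
        intro v hv
        have hv' := h1 hv
        rw [mem_sdiff, mem_union, not_or] at hv'
        have m1 : (degS G v C₁ : ℝ) ≤ degS G v U₁ := by exact_mod_cast degS_mono v h.C₁U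
        have m2 : (degS G v C₂ : ℝ) ≤ degS G v U₂ := by exact_mod_cast degS_mono v h.C₂U
        exact mul_le_mul ((h.restV₁ v hv'.1 hv'.2.1 hv'.2.2).trans m1)
          ((h.restV₂ v hv'.1 hv'.2.1 hv'.2.2).trans m2) (by positivity) (by positivity)
      have h4 := card_nsmul_le_sum V₀ _ _ h3
      rw [h2, nsmul_eq_mul] at h4
      have h5 : (s : ℝ) * n ^ 2 ≤ b * (ρ / 2 * n * (ρ / 2 * n)) := by
        nlinarith [mul_le_mul_of_nonneg_right hbρ (sq_nonneg (n : ℝ))]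
      have h6 : (U₁.card : ℝ) * U₂.card ≤ n ^ 2 := by
        rw [sq]
        exact mul_le_mul hU₁' hU₂' (by positivity) (by positivity)
      have h7 := mul_le_mul_of_nonneg_left h6 (by linarith : (0 : ℝ) ≤ s - 1)
      nlinarith
  obtain ⟨S, hS, hS'⟩ := exists_common_of_sum (s := s) (t := t) hc hU₁ hU₂ (by
    rw [hK, ← hsc] at hsum
    have : (s - 1) * (U₁.card * U₂.card) + b * (2 ^ b * t) * n <
      ∑ v ∈ V₀, degS G v U₁ * degS G v U₂ := by exact_mod_cast hsum
    calc _ = (s - 1) * (U₁.card * U₂.card) + b * (2 ^ b * t) * n := by ring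
      _ < _ := this)
  exact ⟨S, hS.trans hV₀, hS'⟩

/-- The side `P` is split into `X ⊇ U₁` and its complement, and a set `T` of size `t` is chosen, such
that after removing `S` and `T` both pieces have equal size. -/
theorem exists_equal_split {α : Type*} [DecidableEq α] {P U₁ U₂ S A₁ A₂ : Finset α} {k s t : ℕ}
    (hU₁ : U₁ ⊆ P) (hU₂ : U₂ ⊆ P) (hU : Disjoint U₁ U₂) (hS : S ⊆ P \ (U₁ ∪ U₂)) (hSc : S.card = s)
    (hP : P.card = (2 * k + 1) * (s + t)) (hc₁ : 2 * U₁.card + s ≤ (2 * k + 1) * (s + t))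
    (hc₂ : 2 * U₂.card + s ≤ (2 * k + 1) * (s + t)) (hA₁ : A₁ ⊆ U₁) (hA₂ : A₂ ⊆ U₂)
    (ht₁ : t ≤ A₁.card) (ht₂ : t ≤ A₂.card) :
    ∃ X ⊆ P, ∃ T ⊆ A₁ ∪ A₂, U₁ ⊆ X ∧ Disjoint X U₂ ∧ T.card = t ∧
      (X \ (S ∪ T)).card = k * (s + t) ∧ ((P \ X) \ (S ∪ T)).card = k * (s + t) := by
  have hm : (2 * k + 1) * (s + t) = 2 * (k * (s + t)) + (s + t) := by ring
  rw [hm] at hP hc₁ hc₂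
  set K := k * (s + t)
  obtain ⟨X, y, hXP, hUX, hXU, hXS, hy, hXc⟩ : ∃ (X : Finset α) (y : ℕ), X ⊆ P ∧ U₁ ⊆ X ∧
      Disjoint X U₂ ∧ Disjoint X S ∧ y ≤ t ∧ X.card = K + y := by
    have hUS : Disjoint (U₁ ∪ U₂) S := disjoint_of_subset_right hS disjoint_sdiff
    rw [disjoint_union_left] at hUS
    rcases le_total K U₁.card with hK | hK
    · exact ⟨U₁, U₁.card - K, hU₁, Subset.rfl, hU, hUS.1, by omega, by omega⟩
    · have h1 : ((U₁ ∪ U₂) ∪ S).card = U₁.card + U₂.card + s := by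
        rw [card_union_of_disjoint (disjoint_union_left.2 hUS), card_union_of_disjoint hU, hSc]
      have h2 := card_sdiff_add_card_eq_card
        (union_subset (union_subset hU₁ hU₂) (hS.trans sdiff_subset))
      obtain ⟨Z, hZ, hZc⟩ := exists_subset_card_eq (s := P \ ((U₁ ∪ U₂) ∪ S)) (n := K - U₁.card)
        (by omega)
      have hZd : Disjoint Z ((U₁ ∪ U₂) ∪ S) := disjoint_of_subset_left hZ sdiff_disjoint
      rw [disjoint_union_right, disjoint_union_right] at hZd
      refine ⟨U₁ ∪ Z, 0, union_subset hU₁ (hZ.trans sdiff_subset), subset_union_left,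
        disjoint_union_left.2 ⟨hU, hZd.1.2⟩, disjoint_union_left.2 ⟨hUS.1, hZd.2⟩, by omega, ?_⟩
      rw [card_union_of_disjoint hZd.1.1.symm]
      omega
  obtain ⟨T₁, hT₁, hc1⟩ := exists_subset_card_eq (hy.trans ht₁)
  obtain ⟨T₂, hT₂, hc2⟩ := exists_subset_card_eq ((Nat.sub_le t y).trans ht₂)
  have m1 : T₁ ⊆ X := (hT₁.trans hA₁).trans hUX
  have m2 : Disjoint X T₂ := disjoint_of_subset_right (hT₂.trans hA₂) hXU
  have m3 : T₂ ⊆ P := (hT₂.trans hA₂).trans hU₂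
  have m4 : S ⊆ P := hS.trans sdiff_subset
  have m5 : Disjoint S T₂ := disjoint_of_subset_left hS
    (disjoint_of_subset_right ((hT₂.trans hA₂).trans subset_union_right) sdiff_disjoint)
  refine ⟨X, hXP, T₁ ∪ T₂, union_subset_union hT₁ hT₂, hUX, hXU, ?_, ?_, ?_⟩
  · rw [card_union_of_disjoint (disjoint_of_subset_left m1 m2)]
    omega
  · have e : X \ (S ∪ (T₁ ∪ T₂)) = X \ T₁ := by
      rw [disjoint_left] at hXS m2
      ext v
      simp only [mem_sdiff, mem_union]
      grind
    have := card_sdiff_add_card_eq_card m1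
    rw [e]
    omega
  · have e : (P \ X) \ (S ∪ (T₁ ∪ T₂)) = (P \ X) \ (S ∪ T₂) := by
      ext v
      have := @m1 v
      simp only [mem_sdiff, mem_union]
      grind
    have h1 : S ∪ T₂ ⊆ P \ X := subset_sdiff.2 ⟨union_subset m4 m3,
      disjoint_union_left.2 ⟨hXS.symm, m2.symm⟩⟩
    have h2 := card_sdiff_add_card_eq_card h1
    have h3 := card_sdiff_add_card_eq_card hXP
    rw [card_union_of_disjoint m5] at h2
    rw [e]
    omega

theorem FourParts.le_degS_D₁ {α : Type*} [DecidableEq α] {G : SimpleGraph α}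
    {P Q C₁ C₂ D₁ D₂ U₁ U₂ V₁ V₂ : Finset α} {n : ℕ} {ε ρ : ℝ}
    (h : FourParts G P Q n ε ρ C₁ C₂ D₁ D₂ U₁ U₂ V₁ V₂) (hε : ε ≤ 1 / 32) (hρ : ρ ≤ 1 / 16)
    {u : α} (hu : u ∈ P) (hu₂ : u ∉ U₂) : ρ / 2 * n ≤ degS G u D₁ := by
  have hn : (0 : ℝ) ≤ n := by positivity
  by_cases hu₁ : u ∈ U₁
  · nlinarith [h.card_D₁_le hu₁, h.leD₁]
  · exact h.restU₁ u hu hu₁ hu₂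

/-- Four parts, none of which is much larger than `n / 2`, with exceptional copies of `K_{s,t}` that
allow to balance them. -/
theorem exists_tiled_of_exceptional {s t : ℕ} (hs : 0 < s) (hst : s < t) :
    ∃ e₀ : ℕ, ∀ e : ℕ, e₀ ≤ e → ∀ (α : Type) [DecidableEq α] (G : SimpleGraph α)
      (P Q C₁ C₂ D₁ D₂ U₁ U₂ V₁ V₂ S S' : Finset α) (n k d : ℕ) (ε ρ : ℝ),
      n = (2 * k + 1) * (s + t) → FourParts G P Q n ε ρ C₁ C₂ D₁ D₂ U₁ U₂ V₁ V₂ →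
      ε ≤ 1 / 32 → ρ ≤ 1 / 16 → 2 * ε * n ≤ e → d ≤ ρ / 2 * n → 29 * (s + t) * e ≤ d →
      2 * U₁.card + s ≤ n → 2 * U₂.card + s ≤ n → 2 * V₁.card + s ≤ n → 2 * V₂.card + s ≤ n →
      S ⊆ Q \ (V₁ ∪ V₂) → S.card = s → S' ⊆ P \ (U₁ ∪ U₂) → S'.card = s →
      t ≤ (U₁.filter fun u => ∀ v ∈ S, G.Adj v u).card →
      t ≤ (U₂.filter fun u => ∀ v ∈ S, G.Adj v u).card →
      t ≤ (V₁.filter fun u => ∀ v ∈ S', G.Adj v u).card →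
      t ≤ (V₂.filter fun u => ∀ v ∈ S', G.Adj v u).card →
      Tiled G P Q s t (P ∪ Q) := by
  obtain ⟨e₀, h₀⟩ := exists_tiled_of_two_nearBalanced hs hst
  refine ⟨e₀ + 2 * (s + t), fun e he α _ G P Q C₁ C₂ D₁ D₂ U₁ U₂ V₁ V₂ S S' n k d ε ρ hn h hε hρ hεe
    hd hed hU₁ hU₂ hV₁ hV₂ hS hSc hS' hSc' hA₁ hA₂ hB₁ hB₂ => ?_⟩
  obtain ⟨X, hXP, T, hT, hUX, hXU, hTc, hX1, hX2⟩ := exists_equal_split h.subU₁ h.subU₂ h.disjU hS'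
    hSc' (h.cardP.trans hn) (hn ▸ hU₁) (hn ▸ hU₂) (filter_subset _ _) (filter_subset _ _) hA₁ hA₂
  obtain ⟨Y, hYQ, T', hT', hVY, hYV, hTc', hY1, hY2⟩ := exists_equal_split h.subV₁ h.subV₂ h.disjV hS
    hSc (h.cardQ.trans hn) (hn ▸ hV₁) (hn ▸ hV₂) (filter_subset _ _) (filter_subset _ _) hB₁ hB₂
  have aT : ∀ u ∈ T, ∀ v ∈ S, G.Adj u v := by
    intro u hu v hv
    have := hT hu
    rw [← filter_union, mem_filter] at this
    exact (this.2 v hv).symm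
  have aT' : ∀ u ∈ S', ∀ v ∈ T', G.Adj u v := by
    intro u hu v hv
    have := hT' hv
    rw [← filter_union, mem_filter] at this
    exact this.2 u hu
  have sT : T ⊆ U₁ ∪ U₂ := hT.trans (union_subset_union (filter_subset _ _) (filter_subset _ _))
  have sT' : T' ⊆ V₁ ∪ V₂ := hT'.trans (union_subset_union (filter_subset _ _) (filter_subset _ _))
  have sTP : T ⊆ P := sT.trans (union_subset h.subU₁ h.subU₂)
  have sTQ : T' ⊆ Q := sT'.trans (union_subset h.subV₁ h.subV₂)
  have hSQ : S ⊆ Q := hS.trans sdiff_subset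
  have hSP : S' ⊆ P := hS'.trans sdiff_subset
  have dPQ := disjoint_left.1 h.disj
  have hW : Tiled G P Q s t ((T ∪ S) ∪ (S' ∪ T')) := by
    refine (Tiled.single sTP hSQ (Or.inr ⟨hTc, hSc⟩) aT).union
      (Tiled.single hSP sTQ (Or.inl ⟨hSc', hTc'⟩) aT') ?_
    have d1 := disjoint_of_subset_left hS' sdiff_disjoint
    have d2 := disjoint_of_subset_left hS sdiff_disjoint
    rw [disjoint_left] at d1 d2 ⊢
    intro v hv hv'
    rw [mem_union] at hv hv'
    rcases hv with hv | hv <;> rcases hv' with hv' | hv'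
    · exact d1 hv' (sT hv)
    · exact dPQ (sTP hv) (sTQ hv')
    · exact dPQ (hSP hv') (hSQ hv)
    · exact d2 hv (sT' hv')
  have restrP : ∀ Z ⊆ P, Z \ ((T ∪ S) ∪ (S' ∪ T')) = Z \ (S' ∪ T) := by
    intro Z hZ
    ext v
    have h1 := @hZ v
    have h2 := @dPQ v
    have h3 := @hSQ v
    have h4 := @sTQ v
    simp only [mem_sdiff, mem_union]
    tauto
  have restrQ : ∀ Z ⊆ Q, Z \ ((T ∪ S) ∪ (S' ∪ T')) = Z \ (S ∪ T') := by
    intro Z hZ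
    ext v
    have h1 := @hZ v
    have h2 := @dPQ v
    have h3 := @hSP v
    have h4 := @sTP v
    simp only [mem_sdiff, mem_union]
    tauto
  have hn0 : (0 : ℝ) ≤ n := by positivity
  have hd4 : 4 * d ≤ n := by
    have : 4 * (d : ℝ) ≤ n := by nlinarith
    exact_mod_cast this
  have toNat : ∀ {a : ℕ}, ρ / 2 * n ≤ a → d ≤ a := fun ha => by exact_mod_cast hd.trans ha
  have nb₁ : NearBalanced G X Y C₁ D₁ e d := by
    refine h.toTwoCores.nearBalanced (by linarith) (h.C₁U.trans hUX) hXP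
      (disjoint_of_subset_right h.C₂U hXU) (h.D₁V.trans hVY) hYQ (disjoint_of_subset_right h.D₂V hYV)
      hεe hd4 ?_ ?_
    · exact fun u hu _ => toNat (h.le_degS_D₁ hε hρ (hXP hu) (disjoint_left.1 hXU hu))
    · exact fun u hu _ => toNat (h.swap.le_degS_D₁ hε hρ (hYQ hu) (disjoint_left.1 hYV hu))
  have nb₂ : NearBalanced G (P \ X) (Q \ Y) C₂ D₂ e d := by
    refine h.flip.toTwoCores.nearBalanced (by linarith)
      (subset_sdiff.2 ⟨h.subC₂, (disjoint_of_subset_right h.C₂U hXU).symm⟩) sdiff_subset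
      (disjoint_of_subset_right (h.C₁U.trans hUX) sdiff_disjoint)
      (subset_sdiff.2 ⟨h.subD₂, (disjoint_of_subset_right h.D₂V hYV).symm⟩) sdiff_subset
      (disjoint_of_subset_right (h.D₁V.trans hVY) sdiff_disjoint) hεe hd4 ?_ ?_
    · intro u hu _
      rw [mem_sdiff] at hu
      exact toNat (h.flip.le_degS_D₁ hε hρ hu.1 fun hh => hu.2 (hUX hh))
    · intro u hu _
      rw [mem_sdiff] at hu
      exact toNat (h.flip.swap.le_degS_D₁ hε hρ hu.1 fun hh => hu.2 (hVY hh))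
  have eP : X ∪ P \ X = P := union_sdiff_of_subset hXP
  have eQ : Y ∪ Q \ Y = Q := union_sdiff_of_subset hYQ
  have key := h₀ e (by omega) α G X Y C₁ D₁ (P \ X) (Q \ Y) C₂ D₂ ((T ∪ S) ∪ (S' ∪ T')) d k k k k
    nb₁ nb₂ disjoint_sdiff disjoint_sdiff (by rw [eP, eQ]; exact h.disj) hed (by rwa [eP, eQ]) (by
      have h1 := card_union_le (T ∪ S) (S' ∪ T')
      have h2 := card_union_le T S
      have h3 := card_union_le S' T'
      omega) ?_ ?_ ?_ ?_
  · rwa [eP, eQ] at key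
  · rw [restrP _ hXP, hX1]
    push_cast
    ring
  · rw [restrQ _ hYQ, hY1]
    push_cast
    ring
  · rw [restrP _ sdiff_subset, hX2]
    push_cast
    ring
  · rw [restrQ _ sdiff_subset, hY2]
    push_cast
    ring

theorem exists_tiled_of_fourParts {s t : ℕ} (hs : 0 < s) (hst : s < t) :
    ∃ ρ ε : ℝ, 0 < ε ∧ 2 * ε ≤ ρ ∧ ρ ≤ 1 / 16 ∧ ∃ n₀ : ℕ, ∀ n : ℕ, n₀ ≤ n →
      ∀ (α : Type) [DecidableEq α] (G : SimpleGraph α) (P Q C₁ C₂ D₁ D₂ U₁ U₂ V₁ V₂ : Finset α)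
      (k : ℕ), n = (2 * k + 1) * (s + t) →
      FourParts G P Q n (2 * ε) ρ C₁ C₂ D₁ D₂ U₁ U₂ V₁ V₂ →
      (∀ u ∈ P, n + 3 * s ≤ 2 * degS G u Q + 2) → (∀ v ∈ Q, n + 3 * s ≤ 2 * degS G v P + 2) →
      Tiled G P Q s t (P ∪ Q) := by
  obtain ⟨B, n₁, h₁⟩ := exists_tiled_or_eAB_le hs hst
  obtain ⟨e₀, h₂⟩ := exists_tiled_of_exceptional hs hst
  have hs' : (1 : ℝ) ≤ s := by exact_mod_cast hs
  have ht' : (1 : ℝ) ≤ t := by exact_mod_cast (by omega)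
  obtain ⟨ρ, hρ⟩ : ∃ ρ : ℝ, ρ = 1 / (1000 * (s + t) * (B + 1)) := ⟨_, rfl⟩
  obtain ⟨δ, hδ⟩ : ∃ δ : ℝ, δ = ρ / (1000 * (s + t)) := ⟨_, rfl⟩
  have hρ0 : 0 < ρ := by rw [hρ]; positivity
  have hδ0 : 0 < δ := by rw [hδ]; positivity
  have hρ1 : 1000 * (s + t) * (B + 1) * ρ = 1 := by rw [hρ]; field_simp
  have hδ1 : 1000 * (s + t) * δ = ρ := by rw [hδ]; field_simp
  have hB : (0 : ℝ) ≤ (s + t) * B * ρ := by positivity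
  have hsρ : 0 ≤ s * (B + 1) * ρ := by positivity
  have htρ : 0 ≤ t * (B + 1) * ρ := by positivity
  have hsρ' : 0 ≤ (s - 1) * ρ := mul_nonneg (by linarith) hρ0.le
  have htρ' : 0 ≤ (t - 1) * ρ := mul_nonneg (by linarith) hρ0.le
  have hρ2 : ρ ≤ 1 / 16 := by linarith
  have hsδ : 0 ≤ (s - 1) * δ := mul_nonneg (by linarith) hδ0.le
  have htδ : 0 ≤ (t - 1) * δ := mul_nonneg (by linarith) hδ0.le
  obtain ⟨n₂, h₃⟩ := exists_exceptional hs t hρ0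
  refine ⟨ρ, δ / 2, by positivity, by linarith, hρ2, n₁ + n₂ + ⌈(e₀ : ℝ) / δ⌉₊ +
    ⌈200 * (s + t) / ρ⌉₊ + 1, fun n hn α _ G P Q C₁ C₂ D₁ D₂ U₁ U₂ V₁ V₂ k hnk h hdP hdQ => ?_⟩
  rw [mul_div_cancel₀ δ two_ne_zero] at h
  have large : ∀ x y : ℝ, 0 < y → ⌈x / y⌉₊ ≤ n → x ≤ y * n := by
    intro x y hy hx
    have := (Nat.le_ceil (x / y)).trans (Nat.cast_le.2 hx)
    rw [div_le_iff₀ hy] at this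
    linarith
  have l1 := large e₀ δ hδ0 (by omega)
  have l2 := large (200 * (s + t)) ρ hρ0 (by omega)
  have hn0 : 0 < n := by omega
  by_contra hnot
  have bound := fun {P Q C₁ C₂ D₁ D₂ U₁ U₂ V₁ V₂ : Finset α}
    (h : FourParts G P Q n δ ρ C₁ C₂ D₁ D₂ U₁ U₂ V₁ V₂) =>
    h₁ n (by omega) δ ρ hδ0 (by linarith) (by linarith) (by linarith) α G P Q C₁ C₂ D₁ D₂ U₁ U₂
      V₁ V₂ _ hnk h
  have b₁ := (bound h).resolve_left hnot
  have b₂ := (bound h.flip).resolve_left hnot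
  have b₁' := b₁
  have b₂' := b₂
  rw [eAB_comm] at b₁' b₂'
  have hδs : 100 * s * δ ≤ 1 := by
    have : 0 ≤ t * δ := by positivity
    have : 0 ≤ s * δ := by positivity
    linarith
  have hδs' : δ * (10 * s) ≤ 1 := by
    have : 0 ≤ s * δ := by positivity
    linarith
  obtain ⟨S, hS, hSc, hA₁, hA₂⟩ := h₃ n (by omega) δ hδ0.le hδs α G P Q C₁ C₂ D₁ D₂ U₁ U₂ V₁ V₂ h
    hdP b₁ b₂
  obtain ⟨S', hS', hSc', hB₁, hB₂⟩ := h₃ n (by omega) δ hδ0.le hδs α G Q P D₁ D₂ C₁ C₂ V₁ V₂ U₁ U₂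
    h.swap hdQ b₂' b₁'
  refine hnot (h₂ ⌈2 * δ * n⌉₊ ?_ α G P Q C₁ C₂ D₁ D₂ U₁ U₂ V₁ V₂ S S' n k ⌊ρ / 2 * n⌋₊ δ ρ hnk h
    (by linarith) hρ2 (Nat.le_ceil _) (Nat.floor_le (by positivity)) ?_
    (h.two_mul_card_U₁_add_le hn0 hs hδs' hdQ b₁) (h.flip.two_mul_card_U₁_add_le hn0 hs hδs' hdQ b₂)
    (h.swap.two_mul_card_U₁_add_le hn0 hs hδs' hdP b₂')
    (h.swap.flip.two_mul_card_U₁_add_le hn0 hs hδs' hdP b₁') hS hSc hS' hSc' hA₁ hA₂ hB₁ hB₂)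
  · have h1 := Nat.le_ceil (2 * δ * n)
    have h2 : 0 ≤ δ * n := by positivity
    have h3 : (e₀ : ℝ) ≤ ⌈2 * δ * n⌉₊ := by linarith
    exact_mod_cast h3
  · refine Nat.le_floor ?_
    have h1 := (Nat.ceil_lt_add_one (by positivity : 0 ≤ 2 * δ * n)).le
    have h2 : (29 * ((s : ℝ) + t)) * ⌈2 * δ * n⌉₊ ≤ 29 * (s + t) * (2 * δ * n + 1) :=
      mul_le_mul_of_nonneg_left h1 (by positivity)
    push_cast
    have h3 : 1000 * (s + t) * δ * n = ρ * n := by rw [hδ1]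
    have h4 : 0 ≤ ρ * n := by positivity
    linarith

theorem exists_tiled_of_twoCores {s t : ℕ} (hs : 0 < s) (hst : s < t) :
    ∃ ε : ℝ, 0 < ε ∧ ε ≤ 1 ∧ ∃ n₀ : ℕ, ∀ n : ℕ, n₀ ≤ n →
      ∀ (α : Type) [DecidableEq α] (G : SimpleGraph α) (P Q C₁ C₂ D₁ D₂ : Finset α)
      (k : ℕ), n = (2 * k + 1) * (s + t) → TwoCores G P Q n ε C₁ C₂ D₁ D₂ →
      (∀ u ∈ P, n + 3 * s ≤ 2 * degS G u Q + 2) → (∀ v ∈ Q, n + 3 * s ≤ 2 * degS G v P + 2) →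
      Tiled G P Q s t (P ∪ Q) := by
  obtain ⟨ρ, ε, hε, hερ, hρ, n₁, h₁⟩ := exists_tiled_of_fourParts hs hst
  have hβ : 0 < ε * ρ := mul_pos hε (by linarith)
  obtain ⟨n₂, h₂⟩ := exists_tiled_of_twoCores_of_dense hs hst hβ
  have hh : (0 : ℝ) < 1 / (1000 * (s + t)) := by
    have : (0 : ℝ) < s := by exact_mod_cast hs
    positivity
  refine ⟨min ε (1 / (1000 * (s + t))), lt_min hε hh, (min_le_left _ _).trans (by linarith),
    n₁ + n₂ + 1, fun n hn α _ G P Q C₁ C₂ D₁ D₂ k hnk h hdP hdQ => ?_⟩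
  by_cases e₁ : ε * ρ * n ^ 2 ≤ eAB G C₁ D₂
  · exact h₂ n (by omega) α G P Q C₁ C₂ D₁ D₂ _ hnk (h.mono (min_le_right _ _)) e₁
  by_cases e₂ : ε * ρ * n ^ 2 ≤ eAB G C₂ D₁
  · exact h₂ n (by omega) α G P Q C₂ C₁ D₂ D₁ _ hnk (h.flip.mono (min_le_right _ _)) e₂
  obtain ⟨C₁, C₂, D₁, D₂, U₁, U₂, V₁, V₂, h'⟩ := (h.mono (min_le_left _ _)).exists_fourParts
    (by omega) hε hερ hρ (not_le.1 e₁).le (not_le.1 e₂).le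
  exact h₁ n (by omega) α G P Q C₁ C₂ D₁ D₂ U₁ U₂ V₁ V₂ k hnk h' hdP hdQ

theorem exists_tiled {s t : ℕ} (hs : 0 < s) (hst : s < t) :
    ∃ n₀ : ℕ, ∀ n : ℕ, n₀ ≤ n →
      ∀ (α : Type) [DecidableEq α] (G : SimpleGraph α) (P Q : Finset α)
      (k : ℕ), n = (2 * k + 1) * (s + t) → Disjoint P Q → P.card = n → Q.card = n →
      (∀ u ∈ P, n + 3 * s ≤ 2 * degS G u Q + 2) → (∀ v ∈ Q, n + 3 * s ≤ 2 * degS G v P + 2) →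
      Tiled G P Q s t (P ∪ Q) := by
  obtain ⟨ε, hε, hε1, n₁, h₁⟩ := exists_tiled_of_twoCores hs hst
  obtain ⟨n₂, h₂⟩ := Robust.exists_tiled (a := ε ^ 2 / 64) (by positivity) (by nlinarith)
    (h := s + t) (by omega)
  refine ⟨n₁ + n₂, fun n hn α _ G P Q k hnk hd hP hQ hdP hdQ => ?_⟩
  have hdP' : ∀ u ∈ P, n ≤ 2 * degS G u Q := fun u hu => by
    have := hdP u hu
    omega
  have hdQ' : ∀ v ∈ Q, n ≤ 2 * degS G v P := fun v hv => by
    have := hdQ v hv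
    omega
  by_cases hR : ∀ S ⊆ P, ∀ T ⊆ Q, (1 / 2 - ε ^ 2 / 64) * n ≤ S.card →
      (1 / 2 - ε ^ 2 / 64) * n ≤ T.card → ε ^ 2 / 64 * n ^ 2 ≤ eAB G S T
  · exact (h₂ n (by omega) ⟨_, hnk.trans (mul_comm _ _)⟩ α G P Q
      ⟨hd, hP, hQ, hdP', hdQ', hR⟩).split hd
  · push Not at hR
    obtain ⟨S, hS, T, hT, hSc, hTc, he⟩ := hR
    obtain ⟨C₁, C₂, D₁, D₂, h⟩ :=
      exists_twoCores hε hε1 hd hP hQ hdP' hdQ' hS hT hSc hTc he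
    exact h₁ n (by omega) α G P Q C₁ C₂ D₁ D₂ k hnk h hdP hdQ

/-- Main theorem: for `1 ≤ s < t` with `t ≥ 2s+1` and all
sufficiently large odd `m`, every balanced bipartite graph on
`2n = 2m(s+t)` vertices with `δ(G) ≥ (n+3s)/2 − 1` can be tiled
with `K_{s,t}`. -/
theorem main_theorem (s t : ℕ) (hs : 1 ≤ s) (hst : s < t) (ht : 2 * s + 1 ≤ t) :
    ∃ m₀ : ℕ, ∀ m : ℕ, m₀ ≤ m → Odd m →
      ∀ (V : Type) (_ : Fintype V) (_ : DecidableEq V),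
      ∀ (G : SimpleGraph V) (A B : Finset V) (n : ℕ),
        IsBipartition G A B → A.card = n → B.card = n → n = m * (s + t) →
        (∀ v : V, ((n : ℝ) + 3 * s) / 2 - 1 ≤ (degS G v Finset.univ : ℝ)) →
        KstTileable G s t := by
  obtain ⟨n₀, h₀⟩ := exists_tiled hs hst
  refine ⟨n₀, fun m hm hodd V _ _ G A B n hG hA hB hn hdeg => ?_⟩
  obtain ⟨k, rfl⟩ := hodd
  obtain ⟨hAB, huniv, hadj⟩ := hG
  have hn₀ : n₀ ≤ n := by
    rw [hn]
    exact hm.trans (Nat.le_mul_of_pos_right _ (by omega))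
  have deg : ∀ v : V, n + 3 * s ≤ 2 * degS G v univ + 2 := by
    intro v
    have h1 : (n : ℝ) + 3 * s ≤ 2 * degS G v univ + 2 := by linarith [hdeg v]
    exact_mod_cast h1
  have dis := disjoint_left.1 hAB
  have degA : ∀ v ∈ A, degS G v univ ≤ degS G v B := fun v hv => card_le_card fun w hw => by
    rw [mem_filter] at hw ⊢
    rcases hadj v w hw.2 with h | h
    · exact ⟨h.2, hw.2⟩
    · exact absurd h.1 (dis hv)
  have degB : ∀ v ∈ B, degS G v univ ≤ degS G v A := fun v hv => card_le_card fun w hw => by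
    rw [mem_filter] at hw ⊢
    rcases hadj v w hw.2 with h | h
    · exact absurd hv (dis h.1)
    · exact ⟨h.2, hw.2⟩
  refine Tiled.kstTileable hAB ?_
  rw [← huniv]
  refine h₀ n hn₀ V G A B k hn hAB hA hB (fun v hv => ?_) fun v hv => ?_
  · have := deg v
    have := degA v hv
    omega
  · have := deg v
    have := degB v hv
    omega

end PaperTiling
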